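/- The fifth group cohomology H^5(Γ_0(9), ℂ) has dimension 3 as a ℂ-vector space. -/

import Mathlib

/-- The congruence subgroup `Γ₀(N) ⊆ SL(4, ℤ)` consisting of matrices whose last row is
congruent to `(0,0,0,*)` modulo `N`, i.e. whose first three entries of the last row are
divisible by `N`. -/
def Gamma0 (N : ℕ) : Subgroup (Matrix.SpecialLinearGroup (Fin 4) ℤ) where
  carrier := {A | ∀ j : Fin 4, j ≠ 3 → (N : ℤ) ∣ A.1 3 j}
  one_mem' := by
    intro j hj
    simp [Matrix.one_apply_ne' hj]
  mul_mem' := by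
    intro A B hA hB j hj
    show (N : ℤ) ∣ (A.1 * B.1) 3 j
    rw [Matrix.mul_apply]
    refine Finset.dvd_sum fun k _ => ?_
    by_cases hk : k = 3
    · subst hk
      exact (hB j hj).mul_left _
    · exact (hA k hk).mul_right _
  inv_mem' := by
    intro A hA j hj
    have hAB : (A.1 : Matrix (Fin 4) (Fin 4) ℤ) * (A⁻¹).1 = 1 := by
      rw [← Matrix.SpecialLinearGroup.coe_mul, mul_inv_cancel,
        Matrix.SpecialLinearGroup.coe_one]
    set f : ℤ →+* ZMod N := Int.castRingHom (ZMod N) with hf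
    have hab : (A.1.map f) * ((A⁻¹).1.map f) = 1 := by
      rw [← Matrix.map_mul, hAB, Matrix.map_one f f.map_zero f.map_one]
    have ha0 : ∀ k : Fin 4, k ≠ 3 → (A.1.map f) 3 k = 0 := by
      intro k hk
      have := hA k hk
      simpa [Matrix.map_apply, hf, ZMod.intCast_zmod_eq_zero_iff_dvd] using this
    have hsum : ∀ i, ∑ k, (A.1.map f) 3 k * ((A⁻¹).1.map f) k i
        = (1 : Matrix (Fin 4) (Fin 4) (ZMod N)) 3 i := by
      intro i
      rw [← Matrix.mul_apply, hab]
    have hsum' : ∀ i, (A.1.map f) 3 3 * ((A⁻¹).1.map f) 3 i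
        = (1 : Matrix (Fin 4) (Fin 4) (ZMod N)) 3 i := by
      intro i
      have h := hsum i
      rw [Fin.sum_univ_four, ha0 0 (by decide), ha0 1 (by decide),
        ha0 2 (by decide), zero_mul, zero_mul, zero_mul, zero_add, zero_add,
        zero_add] at h
      exact h
    have hunit : (A.1.map f) 3 3 * ((A⁻¹).1.map f) 3 3 = 1 := by
      simpa [Matrix.one_apply] using hsum' 3
    have hzero : (A.1.map f) 3 3 * ((A⁻¹).1.map f) 3 j = 0 := by
      simpa [Matrix.one_apply_ne' hj] using hsum' j
    have hb : ((A⁻¹).1.map f) 3 j = 0 := by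
      calc ((A⁻¹).1.map f) 3 j
          = ((A.1.map f) 3 3 * ((A⁻¹).1.map f) 3 3) * ((A⁻¹).1.map f) 3 j := by
            rw [hunit, one_mul]
        _ = ((A⁻¹).1.map f) 3 3 * ((A.1.map f) 3 3 * ((A⁻¹).1.map f) 3 j) := by ring
        _ = 0 := by rw [hzero, mul_zero]
    show (N : ℤ) ∣ (A⁻¹).1 3 j
    rw [← ZMod.intCast_zmod_eq_zero_iff_dvd]
    simpa [Matrix.map_apply, hf] using hb

namespace Voronoi

open scoped Pointwise Matrix

section Sign

variable {α : Type*} [LinearOrder α] {G : Type*} [Group G] [MulAction G α]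

/-- The sign recording whether `a` precedes `b`. -/
def ordSign (a b : α) : ℤˣ := if b < a then -1 else 1

lemma ordSign_swap {a b : α} (h : a ≠ b) : ordSign a b = -ordSign b a := by
  unfold ordSign
  rcases lt_or_gt_of_ne h with h | h <;> simp [h, h.not_gt]

/-- The sign of moving `v` into its sorted position in `S`. -/
def insSign (v : α) (S : Finset α) : ℤˣ := ∏ s ∈ S, ordSign v s

lemma insSign_insert {v w : α} {S : Finset α} (hw : w ∉ S) :
    insSign v (insert w S) = ordSign v w * insSign v S := by
  simp [insSign, Finset.prod_insert hw]

lemma insSign_anti {v w : α} {S : Finset α} (h : v ≠ w) (hv : v ∉ S) (hw : w ∉ S) :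
    insSign v (insert w S) * insSign w S = -(insSign w (insert v S) * insSign v S) := by
  rw [insSign_insert hw, insSign_insert hv, ordSign_swap h, neg_mul, neg_mul, mul_assoc, mul_assoc,
    mul_comm (insSign v S)]

/-- The change of relative order of `a` and `b` under `g`. -/
def invSign (g : G) (a b : α) : ℤˣ := ordSign a b * ordSign (g • a) (g • b)

lemma invSign_symm (g : G) (a b : α) : invSign g a b = invSign g b a := by
  by_cases h : a = b
  · rw [h]
  · have h' : g • a ≠ g • b := fun e => h (MulAction.injective g e)
    simp [invSign, ordSign_swap h, ordSign_swap h']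

lemma invSign_mul (g h : G) (a b : α) :
    invSign (g * h) a b = invSign g (h • a) (h • b) * invSign h a b := by
  have key : ∀ x y z : ℤˣ, x * z = y * z * (x * y) := by decide
  simp only [invSign, mul_smul]
  exact key _ _ _

/-- The sign of the permutation of `S` induced by sorting before and after applying `g`. -/
def setSign (g : G) (S : Finset α) : ℤˣ :=
  ∏ a ∈ S, ∏ b ∈ S, if a < b then invSign g a b else 1

@[simp] lemma setSign_empty (g : G) : setSign g (∅ : Finset α) = 1 := by simp [setSign]

lemma setSign_insert (g : G) {v : α} {S : Finset α} (hv : v ∉ S) :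
    setSign g (insert v S) = (∏ s ∈ S, invSign g v s) * setSign g S := by
  simp only [setSign, Finset.prod_insert hv, lt_irrefl, if_false, one_mul]
  rw [Finset.prod_mul_distrib, ← mul_assoc, ← Finset.prod_mul_distrib]
  congr 1
  refine Finset.prod_congr rfl fun s hs => ?_
  have h : v ≠ s := fun e => hv (e ▸ hs)
  rcases lt_or_gt_of_ne h with h | h
  · simp [h, h.not_gt]
  · simp [h, h.not_gt, invSign_symm g v s]

lemma smul_insert (g : G) (v : α) (S : Finset α) : g • insert v S = insert (g • v) (g • S) :=
  Finset.image_insert _ _ _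

lemma setSign_mul (g h : G) (S : Finset α) :
    setSign (g * h) S = setSign g (h • S) * setSign h S := by
  induction S using Finset.induction_on with
  | empty => simp
  | insert v S hv ih =>
    have hv' : h • v ∉ h • S := by rwa [Finset.smul_mem_smul_finset_iff]
    rw [smul_insert, setSign_insert _ hv, setSign_insert _ hv', setSign_insert _ hv, ih]
    have : (∏ s ∈ h • S, invSign g (h • v) s) = ∏ s ∈ S, invSign g (h • v) (h • s) :=
      Finset.prod_image fun a _ b _ e => MulAction.injective h e
    rw [this, mul_mul_mul_comm, ← Finset.prod_mul_distrib]
    simp only [invSign_mul]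

@[simp] lemma setSign_one (S : Finset α) : setSign (1 : G) S = 1 := by
  have := setSign_mul (1 : G) 1 S
  rw [one_smul, mul_one] at this
  exact (left_eq_mul.mp this)

lemma insSign_smul (g : G) (v : α) (S : Finset α) :
    insSign (g • v) (g • S) = ∏ s ∈ S, ordSign (g • v) (g • s) :=
  Finset.prod_image fun _ _ _ _ e => MulAction.injective g e

lemma setSign_insert_mul (g : G) {v : α} {S : Finset α} (hv : v ∉ S) :
    setSign g (insert v S) * insSign v S = insSign (g • v) (g • S) * setSign g S := by
  rw [setSign_insert g hv, insSign_smul, insSign, mul_right_comm, ← Finset.prod_mul_distrib]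
  congr 1
  refine Finset.prod_congr rfl fun s _ => ?_
  rw [invSign, mul_right_comm]
  simp

end Sign

/-- The ambient group. -/
abbrev SL4 := Matrix.SpecialLinearGroup (Fin 4) ℤ

/-- Integral `4 × 4` matrices, on which `SL4` acts by congruence. -/
def Ray : Type := Matrix (Fin 4) (Fin 4) ℤ

instance : AddCommGroup Ray := inferInstanceAs (AddCommGroup (Matrix (Fin 4) (Fin 4) ℤ))

/-- The list of entries. -/
def Ray.key (X : Ray) : List ℤ :=
  [X 0 0, X 0 1, X 0 2, X 0 3, X 1 0, X 1 1, X 1 2, X 1 3,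
   X 2 0, X 2 1, X 2 2, X 2 3, X 3 0, X 3 1, X 3 2, X 3 3]

lemma Ray.ext' {X Y : Ray} (h : ∀ i j, X i j = Y i j) : X = Y := funext fun i => funext fun j => h i j

lemma Ray.key_injective : Function.Injective Ray.key := by
  intro X Y h
  simp only [Ray.key, List.cons.injEq, and_true] at h
  refine Ray.ext' fun i j => ?_
  fin_cases i <;> fin_cases j <;> simp only [Fin.zero_eta, Fin.mk_one, Fin.reduceFinMk] <;> tauto

instance : LinearOrder Ray := LinearOrder.lift' Ray.key Ray.key_injective

/-- Congruence of matrices. -/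
def congruence (g X : Matrix (Fin 4) (Fin 4) ℤ) : Matrix (Fin 4) (Fin 4) ℤ := g * X * gᵀ

lemma congruence_one (X : Matrix (Fin 4) (Fin 4) ℤ) : congruence 1 X = X := by
  rw [congruence, Matrix.transpose_one, Matrix.one_mul, Matrix.mul_one]

lemma congruence_mul (g h X : Matrix (Fin 4) (Fin 4) ℤ) :
    congruence (g * h) X = congruence g (congruence h X) := by
  simp only [congruence, Matrix.transpose_mul, Matrix.mul_assoc]

lemma congruence_add (g X Y : Matrix (Fin 4) (Fin 4) ℤ) :
    congruence g (X + Y) = congruence g X + congruence g Y := by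
  simp only [congruence, Matrix.mul_add, Matrix.add_mul]

lemma congruence_zero (g : Matrix (Fin 4) (Fin 4) ℤ) : congruence g 0 = 0 := by
  simp only [congruence, Matrix.mul_zero, Matrix.zero_mul]

lemma congruence_vecMulVec (g : Matrix (Fin 4) (Fin 4) ℤ) (v : Fin 4 → ℤ) :
    congruence g (Matrix.vecMulVec v v) = Matrix.vecMulVec (g *ᵥ v) (g *ᵥ v) := by
  rw [congruence, Matrix.mul_vecMulVec, Matrix.vecMulVec_mul, Matrix.vecMul_transpose]

instance : DistribMulAction SL4 Ray where
  smul g X := congruence g.1 X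
  one_smul X := congruence_one X
  mul_smul g h X := congruence_mul g.1 h.1 X
  smul_zero g := congruence_zero g.1
  smul_add g X Y := congruence_add g.1 X Y

/-- The rank one form attached to an integral vector. -/
def ray (v : Fin 4 → ℤ) : Ray := Matrix.vecMulVec v v

lemma ray_apply (v : Fin 4 → ℤ) (i j : Fin 4) : ray v i j = v i * v j := rfl

lemma smul_ray (g : SL4) (v : Fin 4 → ℤ) : g • ray v = ray (g.1 *ᵥ v) :=
  congruence_vecMulVec g.1 v

lemma mulVec_ne_zero (g : SL4) {v : Fin 4 → ℤ} (hv : v ≠ 0) : g.1 *ᵥ v ≠ 0 := by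
  intro h
  apply hv
  have : (g⁻¹).1 *ᵥ (g.1 *ᵥ v) = v := by
    rw [Matrix.mulVec_mulVec, ← Matrix.SpecialLinearGroup.coe_mul, inv_mul_cancel,
      Matrix.SpecialLinearGroup.coe_one, Matrix.one_mulVec]
  rw [← this, h, Matrix.mulVec_zero]

/-- Explicit integral vectors, for computation. -/
structure V4 where
  a : ℤ
  b : ℤ
  c : ℤ
  d : ℤ
deriving DecidableEq

/-- Explicit integral matrices, given by rows. -/
structure M4 where
  r0 : V4
  r1 : V4
  r2 : V4
  r3 : V4
deriving DecidableEq

namespace V4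

/-- The vector as a function. -/
def fn (v : V4) : Fin 4 → ℤ := ![v.a, v.b, v.c, v.d]

/-- Dot product. -/
def dot (v w : V4) : ℤ := v.a * w.a + v.b * w.b + v.c * w.c + v.d * w.d

/-- Negation. -/
def neg (v : V4) : V4 := ⟨-v.a, -v.b, -v.c, -v.d⟩

/-- The associated ray. -/
def ray (v : V4) : Ray := Voronoi.ray v.fn

lemma neg_fn (v : V4) : v.neg.fn = -v.fn := by
  ext i; fin_cases i <;> rfl

end V4

lemma ray_neg (v : Fin 4 → ℤ) : ray (-v) = ray v := by
  refine Ray.ext' fun i j => ?_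
  simp [ray_apply]

lemma V4.ray_neg (v : V4) : v.neg.ray = v.ray := by
  rw [V4.ray, V4.neg_fn, Voronoi.ray_neg, V4.ray]

lemma V4.exists_fn (v : Fin 4 → ℤ) : ∃ w : V4, w.fn = v :=
  ⟨⟨v 0, v 1, v 2, v 3⟩, by ext i; fin_cases i <;> rfl⟩

namespace M4

/-- The matrix as a function. -/
def mat (m : M4) : Matrix (Fin 4) (Fin 4) ℤ :=
  Matrix.of ![m.r0.fn, m.r1.fn, m.r2.fn, m.r3.fn]

/-- Matrix times vector. -/
def mulVec (m : M4) (v : V4) : V4 := ⟨m.r0.dot v, m.r1.dot v, m.r2.dot v, m.r3.dot v⟩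

/-- The determinant, by Laplace expansion along the first two rows. -/
def det (m : M4) : ℤ :=
  let x := m.r0; let y := m.r1; let z := m.r2; let w := m.r3
  (x.a * y.b - x.b * y.a) * (z.c * w.d - z.d * w.c)
  - (x.a * y.c - x.c * y.a) * (z.b * w.d - z.d * w.b)
  + (x.a * y.d - x.d * y.a) * (z.b * w.c - z.c * w.b)
  + (x.b * y.c - x.c * y.b) * (z.a * w.d - z.d * w.a)
  - (x.b * y.d - x.d * y.b) * (z.a * w.c - z.c * w.a)
  + (x.c * y.d - x.d * y.c) * (z.a * w.b - z.b * w.a)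

lemma mat_mulVec (m : M4) (v : V4) : m.mat *ᵥ v.fn = (m.mulVec v).fn := by
  ext i
  fin_cases i <;> simp [mat, mulVec, V4.fn, V4.dot, Matrix.mulVec, dotProduct, Fin.sum_univ_four]

lemma det_mat (m : M4) : m.mat.det = m.det := by
  simp only [Matrix.det_succ_row_zero (n := 3), Matrix.det_fin_three, Fin.sum_univ_four,
    Matrix.submatrix_apply, mat, V4.fn, det, Fin.succ_zero_eq_one, Fin.succ_one_eq_two]
  simp [Fin.succAbove]
  ring

/-- The group element with given matrix. -/
def sl (m : M4) (h : m.det = 1) : SL4 := ⟨m.mat, by rw [det_mat, h]⟩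

lemma sl_smul (m : M4) (h : m.det = 1) (v : V4) : m.sl h • v.ray = (m.mulVec v).ray := by
  rw [V4.ray, smul_ray, V4.ray, ← mat_mulVec]; rfl

lemma exists_sl (g : SL4) : ∃ (m : M4) (h : m.det = 1), m.sl h = g := by
  obtain ⟨r0, h0⟩ := V4.exists_fn (g.1 0)
  obtain ⟨r1, h1⟩ := V4.exists_fn (g.1 1)
  obtain ⟨r2, h2⟩ := V4.exists_fn (g.1 2)
  obtain ⟨r3, h3⟩ := V4.exists_fn (g.1 3)
  have e : (⟨r0, r1, r2, r3⟩ : M4).mat = g.1 := by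
    funext i
    fin_cases i <;> simp only [mat, h0, h1, h2, h3] <;> rfl
  refine ⟨⟨r0, r1, r2, r3⟩, ?_, Subtype.ext e⟩
  rw [← det_mat, e, g.2]

end M4

/-- The perfect form of type `A₄`, on vectors. -/
def qA (v : V4) : ℤ :=
  v.a * v.a + v.b * v.b + v.c * v.c + v.d * v.d + v.a * v.b + v.a * v.c + v.a * v.d + v.b * v.c
    + v.b * v.d + v.c * v.d

/-- The perfect form of type `D₄`, on vectors. -/
def qD (v : V4) : ℤ :=
  v.a * v.a + v.b * v.b + v.c * v.c + v.d * v.d - v.b * v.a - v.b * v.c - v.b * v.d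

/-- The minimal vectors of `qA` up to sign. -/
def minA : List V4 :=
  [⟨1,0,0,0⟩, ⟨0,1,0,0⟩, ⟨0,0,1,0⟩, ⟨0,0,0,1⟩, ⟨1,-1,0,0⟩, ⟨1,0,-1,0⟩, ⟨1,0,0,-1⟩, ⟨0,1,-1,0⟩,
   ⟨0,1,0,-1⟩, ⟨0,0,1,-1⟩]

/-- The minimal vectors of `qD` up to sign in one of the three orthogonal frames. -/
def frameD : ℕ → List V4
  | 0 => [⟨0,0,0,1⟩, ⟨0,0,1,0⟩, ⟨1,2,1,1⟩, ⟨1,0,0,0⟩]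
  | 1 => [⟨0,1,0,0⟩, ⟨1,1,0,1⟩, ⟨1,1,1,0⟩, ⟨0,1,1,1⟩]
  | _ => [⟨1,1,0,0⟩, ⟨0,1,0,1⟩, ⟨0,1,1,0⟩, ⟨1,1,1,1⟩]

/-- The minimal vectors of `qD` up to sign. -/
def minD : List V4 := frameD 0 ++ frameD 1 ++ frameD 2

/-- The rays of a list of vectors. -/
def rays (l : List V4) : Finset Ray := (l.map V4.ray).toFinset

lemma mem_rays {l : List V4} {X : Ray} : X ∈ rays l ↔ ∃ v ∈ l, v.ray = X := by
  simp [rays]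

/-- Vertices of the well-rounded retract, as sets of minimal vectors of perfect forms. -/
def IsVert (M : Finset Ray) : Prop := ∃ g : SL4, M = g • rays minA ∨ M = g • rays minD

/-- The structure carried by a vertex. -/
structure VertexData (M : Finset Ray) where
  /-- The perfect form. -/
  form : Ray →+ ℤ
  /-- The number of frames. -/
  n : ℕ
  /-- The frame containing a ray. -/
  lab : Ray → ℕ
  /-- The common sum of the frames. -/
  z : Ray
  isRay : ∀ X ∈ M, ∃ v : Fin 4 → ℤ, v ≠ 0 ∧ ray v = X
  form_eq_one : ∀ X ∈ M, form X = 1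
  one_le_form : ∀ v : Fin 4 → ℤ, v ≠ 0 → 1 ≤ form (ray v)
  mem_of_form : ∀ v : Fin 4 → ℤ, v ≠ 0 → form (ray v) = 1 → ray v ∈ M
  n_pos : 0 < n
  lab_lt : ∀ X ∈ M, lab X < n
  sum_frame : ∀ i < n, ∑ X ∈ M with lab X = i, X = z
  card_eq : M.card = 9 + n
  span : ∀ v : Fin 4 → ℤ, ∃ a : Ray → ℤ, ray v = ∑ X ∈ M, a X • X
  nbr : ∀ u : ℕ → Ray, (∀ i < n, u i ∈ M ∧ lab (u i) = i) →
    ∃ M', IsVert M' ∧ M' ≠ M ∧ ∀ X ∈ M, (∀ i < n, u i ≠ X) → X ∈ M'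

lemma IsVert.smul {M : Finset Ray} (h : IsVert M) (g : SL4) : IsVert (g • M) := by
  obtain ⟨k, h | h⟩ := h
  · exact ⟨g * k, Or.inl (by rw [h, mul_smul])⟩
  · exact ⟨g * k, Or.inr (by rw [h, mul_smul])⟩

lemma sum_smul_finset (g : SL4) (M : Finset Ray) (f : Ray → Ray) :
    ∑ X ∈ g • M, f X = ∑ X ∈ M, f (g • X) :=
  Finset.sum_image fun _ _ _ _ e => MulAction.injective g e

/-- Transport of vertex data. -/
def VertexData.smul {M : Finset Ray} (D : VertexData M) (g : SL4) : VertexData (g • M) where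
  form := D.form.comp (DistribSMul.toAddMonoidHom Ray g⁻¹)
  n := D.n
  lab X := D.lab (g⁻¹ • X)
  z := g • D.z
  isRay X hX := by
    obtain ⟨v, hv, e⟩ := D.isRay _ (Finset.inv_smul_mem_iff.mpr hX)
    exact ⟨g.1 *ᵥ v, mulVec_ne_zero g hv, by rw [← smul_ray, e, smul_inv_smul]⟩
  form_eq_one X hX := D.form_eq_one _ (Finset.inv_smul_mem_iff.mpr hX)
  one_le_form v hv := by
    have := D.one_le_form _ (mulVec_ne_zero g⁻¹ hv)
    rwa [← smul_ray] at this
  mem_of_form v hv h := by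
    have := D.mem_of_form _ (mulVec_ne_zero g⁻¹ hv)
    rw [← smul_ray] at this
    exact Finset.inv_smul_mem_iff.mp (this h)
  n_pos := D.n_pos
  lab_lt X hX := D.lab_lt _ (Finset.inv_smul_mem_iff.mpr hX)
  sum_frame i hi := by
    rw [← D.sum_frame i hi, Finset.smul_sum, Finset.sum_filter, Finset.sum_filter,
      sum_smul_finset g M fun X => if D.lab (g⁻¹ • X) = i then X else 0]
    simp only [inv_smul_smul]
  card_eq := by rw [Finset.card_smul_finset, D.card_eq]
  span v := by
    obtain ⟨a, ha⟩ := D.span ((g⁻¹).1 *ᵥ v)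
    refine ⟨fun X => a (g⁻¹ • X), ?_⟩
    rw [sum_smul_finset g M fun X => a (g⁻¹ • X) • X]
    rw [← smul_ray, inv_smul_eq_iff, Finset.smul_sum] at ha
    rw [ha]
    refine Finset.sum_congr rfl fun X _ => ?_
    rw [inv_smul_smul]
    exact (DistribSMul.toAddMonoidHom Ray g).map_zsmul _ _
  nbr u hu := by
    obtain ⟨M', h1, h2, h3⟩ := D.nbr (fun i => g⁻¹ • u i)
      fun i hi => ⟨Finset.inv_smul_mem_iff.mpr (hu i hi).1, (hu i hi).2⟩
    refine ⟨g • M', h1.smul g, fun e => h2 (MulAction.injective g e), fun X hX hX' => ?_⟩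
    rw [← Finset.inv_smul_mem_iff] at hX ⊢
    exact h3 _ hX fun i hi e => hX' i hi (MulAction.injective g⁻¹ e)

lemma Ray.add_apply (X Y : Ray) (i j : Fin 4) : (X + Y) i j = X i j + Y i j := rfl

/-- `qA` as a linear functional. -/
def formA : Ray →+ ℤ := AddMonoidHom.mk' (fun X => X 0 0 + X 1 1 + X 2 2 + X 3 3 + X 0 1 + X 0 2
  + X 0 3 + X 1 2 + X 1 3 + X 2 3) fun X Y => by simp only [Ray.add_apply]; ring

/-- `qD` as a linear functional. -/
def formD : Ray →+ ℤ := AddMonoidHom.mk' (fun X => X 0 0 + X 1 1 + X 2 2 + X 3 3 - X 1 0 - X 1 2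
  - X 1 3) fun X Y => by simp only [Ray.add_apply]; ring

lemma formA_ray (v : V4) : formA v.ray = qA v := rfl

lemma formD_ray (v : V4) : formD v.ray = qD v := rfl

lemma V4.fn_eq_zero {v : V4} (h : v.fn = 0) : v = ⟨0, 0, 0, 0⟩ := by
  have h0 := congrFun h 0
  have h1 := congrFun h 1
  have h2 := congrFun h 2
  have h3 := congrFun h 3
  obtain ⟨a, b, c, d⟩ := v
  simp only [V4.fn, Pi.zero_apply] at h0 h1 h2 h3
  simp at h0 h1 h2 h3
  simp [h0, h1, h2, h3]

lemma one_le_qA (v : V4) (hv : v.fn ≠ 0) : 1 ≤ qA v := by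
  by_contra! h
  apply hv
  obtain ⟨a, b, c, d⟩ := v
  simp only [qA] at h
  have h2 : a ^ 2 + b ^ 2 + c ^ 2 + d ^ 2 + (a + b + c + d) ^ 2 ≤ 0 := by nlinarith
  have ha : a = 0 := by nlinarith [sq_nonneg b, sq_nonneg c, sq_nonneg d, sq_nonneg (a + b + c + d)]
  have hb : b = 0 := by nlinarith [sq_nonneg a, sq_nonneg c, sq_nonneg d, sq_nonneg (a + b + c + d)]
  have hc : c = 0 := by nlinarith [sq_nonneg b, sq_nonneg a, sq_nonneg d, sq_nonneg (a + b + c + d)]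
  have hd : d = 0 := by nlinarith [sq_nonneg b, sq_nonneg c, sq_nonneg a, sq_nonneg (a + b + c + d)]
  subst ha hb hc hd
  ext i; fin_cases i <;> rfl

lemma one_le_qD (v : V4) (hv : v.fn ≠ 0) : 1 ≤ qD v := by
  by_contra! h
  apply hv
  obtain ⟨a, b, c, d⟩ := v
  simp only [qD] at h
  have h2 : (2 * a - b) ^ 2 + (2 * c - b) ^ 2 + (2 * d - b) ^ 2 + b ^ 2 ≤ 0 := by nlinarith
  have hb : b = 0 := by
    nlinarith [sq_nonneg (2 * a - b), sq_nonneg (2 * c - b), sq_nonneg (2 * d - b)]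
  subst hb
  have ha : a = 0 := by nlinarith [sq_nonneg c, sq_nonneg d]
  have hc : c = 0 := by nlinarith [sq_nonneg a, sq_nonneg d]
  have hd : d = 0 := by nlinarith [sq_nonneg a, sq_nonneg c]
  subst ha hc hd
  ext i; fin_cases i <;> rfl

lemma minA_box : ∀ a ∈ [-1, 0, (1 : ℤ)], ∀ b ∈ [-1, 0, (1 : ℤ)], ∀ c ∈ [-1, 0, (1 : ℤ)],
    ∀ d ∈ [-1, 0, (1 : ℤ)], qA ⟨a, b, c, d⟩ = 1 →
      (⟨a, b, c, d⟩ : V4) ∈ minA ∨ V4.neg ⟨a, b, c, d⟩ ∈ minA := by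
  decide +kernel

lemma minD_box : ∀ a ∈ [-2, -1, 0, 1, (2 : ℤ)], ∀ b ∈ [-2, -1, 0, 1, (2 : ℤ)],
    ∀ c ∈ [-2, -1, 0, 1, (2 : ℤ)], ∀ d ∈ [-2, -1, 0, 1, (2 : ℤ)], qD ⟨a, b, c, d⟩ = 1 →
      (⟨a, b, c, d⟩ : V4) ∈ minD ∨ V4.neg ⟨a, b, c, d⟩ ∈ minD := by
  decide +kernel

lemma mem_rays_of_pm {l : List V4} {v : V4} (h : v ∈ l ∨ v.neg ∈ l) : v.ray ∈ rays l := by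
  rw [mem_rays]
  rcases h with h | h
  · exact ⟨v, h, rfl⟩
  · exact ⟨_, h, v.ray_neg⟩

lemma mem_of_qA (v : V4) (h : qA v = 1) : v.ray ∈ rays minA := by
  apply mem_rays_of_pm
  obtain ⟨a, b, c, d⟩ := v
  have h2 : a ^ 2 + b ^ 2 + c ^ 2 + d ^ 2 + (a + b + c + d) ^ 2 = 2 := by
    simp only [qA] at h; nlinarith
  have key : ∀ x : ℤ, x ^ 2 ≤ 2 → x ∈ [-1, 0, (1 : ℤ)] := fun x hx => by
    have h1 : -2 < x := by nlinarith
    have h2 : x < 2 := by nlinarith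
    interval_cases x <;> simp
  exact minA_box a (key a (by nlinarith [sq_nonneg b, sq_nonneg c, sq_nonneg d, sq_nonneg (a + b + c + d)]))
    b (key b (by nlinarith [sq_nonneg a, sq_nonneg c, sq_nonneg d, sq_nonneg (a + b + c + d)]))
    c (key c (by nlinarith [sq_nonneg b, sq_nonneg a, sq_nonneg d, sq_nonneg (a + b + c + d)]))
    d (key d (by nlinarith [sq_nonneg b, sq_nonneg c, sq_nonneg a, sq_nonneg (a + b + c + d)])) h

lemma mem_of_qD (v : V4) (h : qD v = 1) : v.ray ∈ rays minD := by
  apply mem_rays_of_pm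
  obtain ⟨a, b, c, d⟩ := v
  have h2 : (2 * a - b) ^ 2 + (2 * c - b) ^ 2 + (2 * d - b) ^ 2 + b ^ 2 = 4 := by
    simp only [qD] at h; nlinarith
  have key : ∀ x : ℤ, x ^ 2 ≤ 4 → -2 ≤ x ∧ x ≤ 2 := fun x hx => by constructor <;> nlinarith
  have mem : ∀ x : ℤ, -2 ≤ x → x ≤ 2 → x ∈ [-2, -1, 0, 1, (2 : ℤ)] := fun x h1 h2 => by
    interval_cases x <;> simp
  have hb := key b (by nlinarith [sq_nonneg (2 * a - b), sq_nonneg (2 * c - b), sq_nonneg (2 * d - b)])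
  have ha := key (2 * a - b) (by nlinarith [sq_nonneg b, sq_nonneg (2 * c - b), sq_nonneg (2 * d - b)])
  have hc := key (2 * c - b) (by nlinarith [sq_nonneg b, sq_nonneg (2 * a - b), sq_nonneg (2 * d - b)])
  have hd := key (2 * d - b) (by nlinarith [sq_nonneg b, sq_nonneg (2 * c - b), sq_nonneg (2 * a - b)])
  exact minD_box a (mem a (by omega) (by omega)) b (mem b (by omega) (by omega))
    c (mem c (by omega) (by omega)) d (mem d (by omega) (by omega)) h

/-- Matrices carrying `minA` minus a vector into a vertex of type `D₄`. -/
def nbrA : List M4 :=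
  [⟨⟨-1,0,0,0⟩,⟨-1,1,0,0⟩,⟨0,1,1,1⟩,⟨-1,0,0,-1⟩⟩, ⟨⟨1,0,0,0⟩,⟨1,-1,0,0⟩,⟨0,-1,-1,0⟩,⟨1,0,0,1⟩⟩, ⟨⟨1,0,0,0⟩,⟨1,1,0,0⟩,⟨1,1,1,0⟩,⟨1,1,1,1⟩⟩,
   ⟨⟨1,0,0,0⟩,⟨1,-1,1,0⟩,⟨0,-1,0,0⟩,⟨1,0,1,1⟩⟩, ⟨⟨1,0,0,0⟩,⟨1,0,1,0⟩,⟨0,-1,0,0⟩,⟨1,0,1,1⟩⟩, ⟨⟨1,0,0,0⟩,⟨1,0,1,0⟩,⟨0,-1,0,0⟩,⟨1,1,1,1⟩⟩,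
   ⟨⟨-1,0,0,0⟩,⟨-1,1,1,0⟩,⟨-1,1,0,0⟩,⟨0,1,1,1⟩⟩, ⟨⟨-1,0,0,0⟩,⟨-1,1,1,0⟩,⟨0,1,0,0⟩,⟨0,1,1,1⟩⟩, ⟨⟨-1,0,0,0⟩,⟨0,1,1,0⟩,⟨0,1,0,0⟩,⟨0,1,1,1⟩⟩,
   ⟨⟨-1,0,0,0⟩,⟨0,1,1,0⟩,⟨0,1,0,0⟩,⟨1,1,1,1⟩⟩]

/-- Matrices carrying `minD` minus one vector from each frame into a vertex of type `D₄`. -/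
def nbrDD : List M4 :=
  [⟨⟨-1,0,0,1⟩,⟨-1,0,0,0⟩,⟨-1,1,0,-1⟩,⟨0,-1,1,0⟩⟩, ⟨⟨0,0,0,1⟩,⟨-1,1,0,0⟩,⟨0,1,0,-1⟩,⟨-1,0,1,0⟩⟩, ⟨⟨1,-1,0,1⟩,⟨1,0,0,0⟩,⟨1,0,0,-1⟩,⟨0,0,1,0⟩⟩,
   ⟨⟨0,-1,0,1⟩,⟨1,-1,0,0⟩,⟨0,0,0,-1⟩,⟨1,-1,1,0⟩⟩, ⟨⟨0,0,1,0⟩,⟨1,0,0,0⟩,⟨0,1,-1,0⟩,⟨1,-1,0,1⟩⟩, ⟨⟨1,-1,1,0⟩,⟨1,-1,0,0⟩,⟨1,0,-1,0⟩,⟨0,-1,0,1⟩⟩,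
   ⟨⟨0,-1,1,0⟩,⟨-1,0,0,0⟩,⟨0,0,-1,0⟩,⟨-1,0,0,1⟩⟩, ⟨⟨-1,0,1,0⟩,⟨-1,1,0,0⟩,⟨-1,1,-1,0⟩,⟨0,0,0,1⟩⟩, ⟨⟨0,1,0,-1⟩,⟨0,0,1,-1⟩,⟨1,-1,1,0⟩,⟨-1,0,1,0⟩⟩,
   ⟨⟨-1,1,-1,0⟩,⟨0,0,-1,1⟩,⟨0,-1,0,1⟩,⟨0,0,0,1⟩⟩, ⟨⟨0,1,-1,0⟩,⟨0,1,-1,-1⟩,⟨1,0,0,-1⟩,⟨-1,1,0,-1⟩⟩, ⟨⟨-1,0,0,1⟩,⟨0,-1,1,1⟩,⟨0,-1,1,0⟩,⟨0,0,1,0⟩⟩,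
   ⟨⟨0,0,1,0⟩,⟨0,-1,1,1⟩,⟨1,-1,0,1⟩,⟨-1,0,0,1⟩⟩, ⟨⟨-1,1,0,-1⟩,⟨0,1,-1,-1⟩,⟨0,0,-1,0⟩,⟨0,1,-1,0⟩⟩, ⟨⟨0,0,0,1⟩,⟨0,0,-1,1⟩,⟨1,0,-1,0⟩,⟨-1,1,-1,0⟩⟩,
   ⟨⟨-1,0,1,0⟩,⟨0,0,1,-1⟩,⟨0,0,0,-1⟩,⟨0,1,0,-1⟩⟩]

/-- Matrices carrying `minD` minus one vector from each frame into a vertex of type `A₄`. -/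
def nbrDA : List M4 :=
  [⟨⟨0,1,0,-1⟩,⟨1,-1,0,1⟩,⟨-1,0,0,1⟩,⟨0,-1,1,0⟩⟩, ⟨⟨1,0,0,-1⟩,⟨0,-1,0,1⟩,⟨0,0,0,1⟩,⟨-1,0,1,0⟩⟩, ⟨⟨0,0,0,-1⟩,⟨-1,0,0,1⟩,⟨1,-1,0,1⟩,⟨0,0,1,0⟩⟩,
   ⟨⟨-1,1,0,-1⟩,⟨0,0,0,1⟩,⟨0,-1,0,1⟩,⟨1,-1,1,0⟩⟩, ⟨⟨0,1,0,-1⟩,⟨0,0,-1,1⟩,⟨0,-1,1,1⟩,⟨1,-1,0,0⟩⟩, ⟨⟨0,0,1,-1⟩,⟨0,0,0,1⟩,⟨0,-1,0,1⟩,⟨1,0,-1,0⟩⟩,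
   ⟨⟨0,0,0,-1⟩,⟨0,-1,1,1⟩,⟨0,0,-1,1⟩,⟨1,0,0,0⟩⟩, ⟨⟨0,0,1,-1⟩,⟨-1,0,0,1⟩,⟨1,-1,0,1⟩,⟨0,1,-1,0⟩⟩, ⟨⟨1,0,0,-1⟩,⟨0,-1,1,1⟩,⟨0,0,-1,1⟩,⟨-1,1,0,0⟩⟩,
   ⟨⟨0,1,0,-1⟩,⟨-1,0,0,1⟩,⟨1,-1,0,1⟩,⟨0,0,-1,0⟩⟩, ⟨⟨1,0,0,-1⟩,⟨0,0,0,1⟩,⟨0,-1,0,1⟩,⟨-1,1,-1,0⟩⟩, ⟨⟨0,1,0,-1⟩,⟨0,-1,1,1⟩,⟨0,0,-1,1⟩,⟨-1,0,0,0⟩⟩,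
   ⟨⟨-1,1,-1,0⟩,⟨0,-1,1,0⟩,⟨0,0,1,0⟩,⟨1,-1,0,1⟩⟩, ⟨⟨0,1,-1,0⟩,⟨-1,0,1,0⟩,⟨1,-1,1,0⟩,⟨0,-1,0,1⟩⟩, ⟨⟨1,0,-1,0⟩,⟨0,0,1,0⟩,⟨0,-1,1,0⟩,⟨-1,0,0,1⟩⟩,
   ⟨⟨0,0,-1,0⟩,⟨1,-1,1,0⟩,⟨-1,0,1,0⟩,⟨0,0,0,1⟩⟩, ⟨⟨0,1,-1,0⟩,⟨0,-1,1,1⟩,⟨0,0,1,-1⟩,⟨1,-1,0,0⟩⟩, ⟨⟨0,0,-1,1⟩,⟨0,-1,1,0⟩,⟨0,0,1,0⟩,⟨1,0,0,-1⟩⟩,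
   ⟨⟨0,0,-1,0⟩,⟨0,0,1,-1⟩,⟨0,-1,1,1⟩,⟨1,0,0,0⟩⟩, ⟨⟨1,0,-1,0⟩,⟨0,0,1,-1⟩,⟨0,-1,1,1⟩,⟨-1,1,0,0⟩⟩, ⟨⟨0,0,-1,1⟩,⟨1,-1,1,0⟩,⟨-1,0,1,0⟩,⟨0,1,0,-1⟩⟩,
   ⟨⟨0,1,-1,0⟩,⟨1,-1,1,0⟩,⟨-1,0,1,0⟩,⟨0,0,0,-1⟩⟩, ⟨⟨1,0,-1,0⟩,⟨0,-1,1,0⟩,⟨0,0,1,0⟩,⟨-1,1,0,-1⟩⟩, ⟨⟨0,1,-1,0⟩,⟨0,0,1,-1⟩,⟨0,-1,1,1⟩,⟨-1,0,0,0⟩⟩,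
   ⟨⟨1,-1,0,1⟩,⟨-1,1,-1,0⟩,⟨0,1,0,-1⟩,⟨-1,0,1,0⟩⟩, ⟨⟨1,-1,1,0⟩,⟨0,1,-1,0⟩,⟨-1,1,0,-1⟩,⟨-1,0,0,1⟩⟩, ⟨⟨0,-1,0,1⟩,⟨-1,1,0,-1⟩,⟨0,1,-1,0⟩,⟨0,0,1,0⟩⟩,
   ⟨⟨0,-1,1,0⟩,⟨0,1,0,-1⟩,⟨-1,1,-1,0⟩,⟨0,0,0,1⟩⟩, ⟨⟨0,-1,0,1⟩,⟨-1,1,0,0⟩,⟨0,1,-1,-1⟩,⟨1,0,0,0⟩⟩, ⟨⟨1,-1,1,0⟩,⟨-1,1,0,0⟩,⟨0,1,-1,-1⟩,⟨-1,0,0,0⟩⟩,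
   ⟨⟨1,0,0,-1⟩,⟨0,0,0,1⟩,⟨-1,1,-1,0⟩,⟨-1,0,1,0⟩⟩, ⟨⟨0,0,0,-1⟩,⟨0,1,-1,0⟩,⟨-1,0,0,1⟩,⟨0,0,1,0⟩⟩, ⟨⟨0,0,0,-1⟩,⟨0,0,-1,1⟩,⟨-1,1,0,0⟩,⟨1,0,0,0⟩⟩,
   ⟨⟨1,-1,1,0⟩,⟨0,0,-1,1⟩,⟨-1,1,0,0⟩,⟨-1,0,0,0⟩⟩, ⟨⟨1,0,-1,0⟩,⟨-1,1,0,-1⟩,⟨0,0,1,0⟩,⟨-1,0,0,1⟩⟩, ⟨⟨0,0,-1,0⟩,⟨-1,0,1,0⟩,⟨0,1,0,-1⟩,⟨0,0,0,1⟩⟩,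
   ⟨⟨0,0,-1,0⟩,⟨-1,1,0,0⟩,⟨0,0,1,-1⟩,⟨1,0,0,0⟩⟩, ⟨⟨1,-1,0,1⟩,⟨-1,1,0,0⟩,⟨0,0,1,-1⟩,⟨-1,0,0,0⟩⟩, ⟨⟨0,0,-1,0⟩,⟨0,-1,1,1⟩,⟨-1,1,0,0⟩,⟨1,0,0,0⟩⟩,
   ⟨⟨1,0,0,-1⟩,⟨0,-1,1,1⟩,⟨-1,1,0,0⟩,⟨-1,0,0,0⟩⟩, ⟨⟨-1,0,0,0⟩,⟨1,0,-1,0⟩,⟨1,-1,1,0⟩,⟨0,0,0,1⟩⟩, ⟨⟨-1,0,0,0⟩,⟨1,-1,0,1⟩,⟨1,0,0,-1⟩,⟨0,0,1,0⟩⟩,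
   ⟨⟨-1,0,0,1⟩,⟨1,0,-1,0⟩,⟨1,-1,1,0⟩,⟨0,1,0,-1⟩⟩, ⟨⟨-1,0,1,0⟩,⟨1,-1,0,1⟩,⟨1,0,0,-1⟩,⟨0,1,-1,0⟩⟩, ⟨⟨-1,0,0,0⟩,⟨0,1,0,-1⟩,⟨1,0,-1,0⟩,⟨0,0,0,1⟩⟩,
   ⟨⟨-1,0,0,0⟩,⟨1,0,0,-1⟩,⟨0,1,-1,0⟩,⟨0,0,1,0⟩⟩, ⟨⟨-1,0,0,0⟩,⟨0,1,-1,0⟩,⟨1,-1,0,1⟩,⟨0,0,1,0⟩⟩, ⟨⟨-1,0,0,0⟩,⟨1,-1,1,0⟩,⟨0,1,0,-1⟩,⟨0,0,0,1⟩⟩]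

lemma nbrA_spec : ∀ u ∈ minA, ∃ m ∈ nbrA, m.det = 1 ∧ qD (m.mulVec u) ≠ 1 ∧
    ∀ v ∈ minA, v = u ∨ qD (m.mulVec v) = 1 := by
  decide +kernel

lemma nbrD_spec : ∀ u ∈ frameD 0, ∀ u' ∈ frameD 1, ∀ u'' ∈ frameD 2,
    (∃ m ∈ nbrDD, m.det = 1 ∧ qD (m.mulVec u) ≠ 1 ∧
      ∀ v ∈ minD, v = u ∨ v = u' ∨ v = u'' ∨ qD (m.mulVec v) = 1) ∨
    (∃ m ∈ nbrDA, m.det = 1 ∧ qA (m.mulVec u) ≠ 1 ∧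
      ∀ v ∈ minD, v = u ∨ v = u' ∨ v = u'' ∨ qA (m.mulVec v) = 1) := by
  decide +kernel

lemma form_of_mem {l : List V4} {f : Ray →+ ℤ} {q : V4 → ℤ} (hf : ∀ v, f v.ray = q v)
    (hq : ∀ v ∈ l, q v = 1) {X : Ray} (hX : X ∈ rays l) : f X = 1 := by
  obtain ⟨v, hv, rfl⟩ := mem_rays.mp hX
  rw [hf, hq v hv]

lemma qA_minA : ∀ v ∈ minA, qA v = 1 := by decide

lemma qD_minD : ∀ v ∈ minD, qD v = 1 := by decide

lemma inv_smul_ne_of_form {M N : Finset Ray} {f : Ray →+ ℤ} (hf : ∀ X ∈ N, f X = 1) {u : V4}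
    {m : M4} (hm : m.det = 1) (hu : u.ray ∈ M) (h : f (m.mulVec u).ray ≠ 1) :
    (m.sl hm)⁻¹ • N ≠ M := by
  rintro rfl
  rw [Finset.mem_inv_smul_finset_iff, M4.sl_smul] at hu
  exact h (hf _ hu)

/-- The coefficients expressing a ray in terms of `minA`. -/
def coeffA (v : V4) : List ℤ :=
  [v.a * (v.a + v.b + v.c + v.d), v.b * (v.a + v.b + v.c + v.d), v.c * (v.a + v.b + v.c + v.d),
   v.d * (v.a + v.b + v.c + v.d), -(v.a * v.b), -(v.a * v.c), -(v.a * v.d), -(v.b * v.c),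
   -(v.b * v.d), -(v.c * v.d)]

/-- The coefficients expressing a ray in terms of `minD`. -/
def coeffD (v : V4) : List ℤ :=
  [v.d * v.d - v.b * v.d, v.c * v.c - v.b * v.c, 0, v.a * v.a - v.a * v.b,
   v.a * v.c + v.a * v.d + v.b * v.b + v.c * v.d - v.a * v.b - v.b * v.c - v.b * v.d,
   v.a * v.d, v.a * v.c, v.c * v.d, v.a * v.b - v.a * v.c - v.a * v.d,
   v.b * v.d - v.a * v.d - v.c * v.d, v.b * v.c - v.a * v.c - v.c * v.d, 0]

lemma exists_sum_of_eq {l : List V4} {v : V4} (c : List ℤ)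
    (h : v.ray = (List.zipWith (fun (x : ℤ) w => x • w.ray) c l).sum) :
    ∃ a : Ray → ℤ, v.ray = ∑ X ∈ rays l, a X • X := by
  have : v.ray ∈ Submodule.span ℤ (rays l : Set Ray) := by
    rw [h]
    refine list_sum_mem fun x hx => ?_
    obtain ⟨i, hi, rfl⟩ := List.mem_iff_getElem.mp hx
    rw [List.getElem_zipWith]
    exact Submodule.smul_mem _ _ (Submodule.subset_span (mem_rays.mpr ⟨_, List.getElem_mem _, rfl⟩))
  obtain ⟨a, -, ha⟩ := Submodule.mem_span_finset.mp this
  exact ⟨a, ha.symm⟩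

lemma Ray.zsmul_apply (n : ℤ) (X : Ray) (i j : Fin 4) : (n • X) i j = n * X i j := rfl

lemma V4.ray_apply (v : V4) (i j : Fin 4) : v.ray i j = v.fn i * v.fn j := rfl

lemma Ray.zero_apply (i j : Fin 4) : (0 : Ray) i j = 0 := rfl

lemma ray_eq_coeffA (v : V4) :
    v.ray = (List.zipWith (fun (x : ℤ) w => x • w.ray) (coeffA v) minA).sum := by
  refine Ray.ext' fun i j => ?_
  simp only [coeffA, minA, List.zipWith_cons_cons, List.zipWith_nil_left, List.sum_cons,
    List.sum_nil, Ray.add_apply, Ray.zsmul_apply, V4.ray_apply, Ray.zero_apply]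
  fin_cases i <;> fin_cases j <;> simp [V4.fn] <;> ring

lemma ray_eq_coeffD (v : V4) :
    v.ray = (List.zipWith (fun (x : ℤ) w => x • w.ray) (coeffD v) minD).sum := by
  refine Ray.ext' fun i j => ?_
  simp only [coeffD, minD, frameD, List.cons_append, List.nil_append, List.zipWith_cons_cons,
    List.zipWith_nil_left, List.sum_cons,
    List.sum_nil, Ray.add_apply, Ray.zsmul_apply, V4.ray_apply, Ray.zero_apply]
  fin_cases i <;> fin_cases j <;> simp [V4.fn] <;> ring

lemma ray_ne_of_list {l : List V4} (h : ∀ v ∈ l, v ≠ ⟨0, 0, 0, 0⟩) (X : Ray) (hX : X ∈ rays l) :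
    ∃ v : Fin 4 → ℤ, v ≠ 0 ∧ ray v = X := by
  obtain ⟨v, hv, rfl⟩ := mem_rays.mp hX
  exact ⟨v.fn, fun e => h v hv (V4.fn_eq_zero e), rfl⟩

/-- The vertex of type `A₄`. -/
def vertexA : VertexData (rays minA) where
  form := formA
  n := 1
  lab _ := 0
  z := ∑ X ∈ rays minA, X
  isRay := ray_ne_of_list (by decide)
  form_eq_one _ hX := form_of_mem formA_ray qA_minA hX
  one_le_form v hv := by
    obtain ⟨w, rfl⟩ := V4.exists_fn v
    exact one_le_qA w hv
  mem_of_form v hv h := by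
    obtain ⟨w, rfl⟩ := V4.exists_fn v
    exact mem_of_qA w h
  n_pos := one_pos
  lab_lt _ _ := one_pos
  sum_frame i hi := by
    obtain rfl : i = 0 := by omega
    simp
  card_eq := by decide +kernel
  span v := by
    obtain ⟨w, rfl⟩ := V4.exists_fn v
    exact exists_sum_of_eq _ (ray_eq_coeffA w)
  nbr u hu := by
    obtain ⟨v, hv, e⟩ := mem_rays.mp (hu 0 one_pos).1
    obtain ⟨m, -, hm, h1, h2⟩ := nbrA_spec v hv
    refine ⟨(m.sl hm)⁻¹ • rays minD, ⟨_, Or.inr rfl⟩,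
      inv_smul_ne_of_form (fun _ hX => form_of_mem formD_ray qD_minD hX) hm
        (mem_rays.mpr ⟨v, hv, rfl⟩) h1, fun X hX hX' => ?_⟩
    obtain ⟨w, hw, rfl⟩ := mem_rays.mp hX
    rw [Finset.mem_inv_smul_finset_iff, M4.sl_smul]
    refine mem_of_qD _ ((h2 w hw).resolve_left ?_)
    rintro rfl
    exact hX' 0 one_pos e.symm

/-- The index of the frame of `minD` containing a ray. -/
def labD (X : Ray) : ℕ := if 2 ∣ X 1 1 then 0 else if 2 ∣ X 0 0 + X 2 2 + X 3 3 then 1 else 2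

lemma mem_frameD : ∀ v ∈ minD, ∀ i < 3, labD v.ray = i → v ∈ frameD i := by decide +kernel

lemma frameD_sub : ∀ i < 3, ∀ v ∈ frameD i, v ∈ minD := by decide

/-- The vertex of type `D₄`. -/
def vertexD : VertexData (rays minD) where
  form := formD
  n := 3
  lab := labD
  z := ∑ X ∈ rays (frameD 0), X
  isRay := ray_ne_of_list (by decide)
  form_eq_one _ hX := form_of_mem formD_ray qD_minD hX
  one_le_form v hv := by
    obtain ⟨w, rfl⟩ := V4.exists_fn v
    exact one_le_qD w hv
  mem_of_form v hv h := by
    obtain ⟨w, rfl⟩ := V4.exists_fn v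
    exact mem_of_qD w h
  n_pos := by decide
  lab_lt X _ := by unfold labD; split_ifs <;> decide
  sum_frame := by decide +kernel
  card_eq := by decide +kernel
  span v := by
    obtain ⟨w, rfl⟩ := V4.exists_fn v
    exact exists_sum_of_eq _ (ray_eq_coeffD w)
  nbr u hu := by
    have key : ∀ i < 3, ∃ v ∈ frameD i, v.ray = u i := fun i hi => by
      obtain ⟨v, hv, e⟩ := mem_rays.mp (hu i hi).1
      exact ⟨v, mem_frameD v hv i hi (by rw [e, (hu i hi).2]), e⟩
    obtain ⟨v, hv, e⟩ := key 0 (by decide)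
    obtain ⟨v', hv', e'⟩ := key 1 (by decide)
    obtain ⟨v'', hv'', e''⟩ := key 2 (by decide)
    have hvM := mem_rays.mpr ⟨v, frameD_sub 0 (by decide) v hv, rfl⟩
    rcases nbrD_spec v hv v' hv' v'' hv'' with ⟨m, -, hm, h1, h2⟩ | ⟨m, -, hm, h1, h2⟩
    · refine ⟨(m.sl hm)⁻¹ • rays minD, ⟨_, Or.inr rfl⟩,
        inv_smul_ne_of_form (fun _ hX => form_of_mem formD_ray qD_minD hX) hm hvM h1,
        fun X hX hX' => ?_⟩
      obtain ⟨w, hw, rfl⟩ := mem_rays.mp hX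
      rw [Finset.mem_inv_smul_finset_iff, M4.sl_smul]
      rcases h2 w hw with rfl | rfl | rfl | h
      · exact (hX' 0 (by decide) e.symm).elim
      · exact (hX' 1 (by decide) e'.symm).elim
      · exact (hX' 2 (by decide) e''.symm).elim
      · exact mem_of_qD _ h
    · refine ⟨(m.sl hm)⁻¹ • rays minA, ⟨_, Or.inl rfl⟩,
        inv_smul_ne_of_form (fun _ hX => form_of_mem formA_ray qA_minA hX) hm hvM h1,
        fun X hX hX' => ?_⟩
      obtain ⟨w, hw, rfl⟩ := mem_rays.mp hX
      rw [Finset.mem_inv_smul_finset_iff, M4.sl_smul]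
      rcases h2 w hw with rfl | rfl | rfl | h
      · exact (hX' 0 (by decide) e.symm).elim
      · exact (hX' 1 (by decide) e'.symm).elim
      · exact (hX' 2 (by decide) e''.symm).elim
      · exact mem_of_qA _ h

lemma IsVert.exists_data {M : Finset Ray} (h : IsVert M) : Nonempty (VertexData M) := by
  obtain ⟨g, rfl | rfl⟩ := h
  · exact ⟨vertexA.smul g⟩
  · exact ⟨vertexD.smul g⟩

/-- A choice of vertex data. -/
noncomputable def IsVert.data {M : Finset Ray} (h : IsVert M) : VertexData M := h.exists_data.some

/-- The vertices of a face. -/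
def Vset (S : Finset Ray) : Set (Finset Ray) := {M | IsVert M ∧ S ⊆ M}

lemma Vset_anti {S T : Finset Ray} (h : S ⊆ T) : Vset T ⊆ Vset S :=
  fun _ hM => ⟨hM.1, h.trans hM.2⟩

namespace VertexData

variable {M : Finset Ray} (D : VertexData M)

/-- The rays of a frame. -/
def frame (i : ℕ) : Finset Ray := {X ∈ M | D.lab X = i}

lemma mem_frame {i : ℕ} {X : Ray} : X ∈ D.frame i ↔ X ∈ M ∧ D.lab X = i := Finset.mem_filter

lemma sum_eq {β : Type*} [AddCommMonoid β] (f : Ray → β) :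
    ∑ X ∈ M, f X = ∑ i ∈ Finset.range D.n, ∑ X ∈ D.frame i, f X :=
  (Finset.sum_fiberwise_of_maps_to (fun X hX => Finset.mem_range.mpr (D.lab_lt X hX)) f).symm

lemma map_z {i : ℕ} (hi : i < D.n) (X : Ray →+ ℤ) : X D.z = ∑ Y ∈ D.frame i, X Y := by
  rw [← D.sum_frame i hi, map_sum]; rfl

lemma form_z {i : ℕ} (hi : i < D.n) : D.form D.z = (D.frame i).card := by
  rw [D.map_z hi, Finset.sum_congr rfl fun X hX => D.form_eq_one X (D.mem_frame.mp hX).1]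
  simp

lemma card_sum : ∑ i ∈ Finset.range D.n, (D.frame i).card = 9 + D.n := by
  rw [← D.card_eq, Finset.card_eq_sum_ones M, D.sum_eq]
  simp

lemma frame_nonempty {i : ℕ} (hi : i < D.n) : (D.frame i).Nonempty := by
  rw [← Finset.card_pos]
  by_contra h
  have h0 : (D.frame i).card = 0 := by omega
  have := D.card_sum
  rw [Finset.sum_eq_zero] at this
  · omega
  · intro j hj
    have h1 := D.form_z (Finset.mem_range.mp hj)
    rw [D.form_z hi, h0] at h1
    exact_mod_cast h1.symm

lemma map_eq_zero_of {X : Ray →+ ℤ} (h0 : ∀ Y ∈ M, 0 ≤ X Y) (hz : X D.z ≤ 0) :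
    ∀ Y ∈ M, X Y = 0 := by
  intro Y hY
  have h := D.map_z (D.lab_lt Y hY) X
  have hn : ∀ Z ∈ D.frame (D.lab Y), 0 ≤ X Z := fun Z hZ => h0 Z (D.mem_frame.mp hZ).1
  have h1 : ∑ Y ∈ D.frame (D.lab Y), X Y = 0 := le_antisymm (h ▸ hz) (Finset.sum_nonneg hn)
  exact (Finset.sum_eq_zero_iff_of_nonneg hn).mp h1 Y (D.mem_frame.mpr ⟨hY, rfl⟩)

lemma map_ray_eq_zero (D : VertexData M) {X : Ray →+ ℤ} (h : ∀ Y ∈ M, X Y = 0) (v : Fin 4 → ℤ) : X (ray v) = 0 := by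
  obtain ⟨a, ha⟩ := D.span v
  rw [ha, map_sum]
  refine Finset.sum_eq_zero fun Y hY => ?_
  rw [map_zsmul, h Y hY, smul_zero]

lemma subset_of_form {N : Finset Ray} (E : VertexData N) (h : ∀ v, D.form (ray v) = E.form (ray v)) :
    M ⊆ N := by
  intro X hX
  obtain ⟨v, hv, rfl⟩ := D.isRay X hX
  exact E.mem_of_form v hv (by rw [← h, D.form_eq_one _ hX])

lemma eq_of_form {N : Finset Ray} (E : VertexData N) (h : ∀ v, D.form (ray v) = E.form (ray v)) :
    M = N :=
  (D.subset_of_form E h).antisymm (E.subset_of_form D fun v => (h v).symm)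

/-- The difference of the forms of two vertices. -/
def diff {N : Finset Ray} (E : VertexData N) : Ray →+ ℤ := E.form - D.form

lemma diff_apply {N : Finset Ray} (E : VertexData N) (X : Ray) :
    D.diff E X = E.form X - D.form X := rfl

lemma diff_nonneg {N : Finset Ray} (E : VertexData N) : ∀ Y ∈ M, 0 ≤ D.diff E Y := by
  intro Y hY
  obtain ⟨v, hv, rfl⟩ := D.isRay Y hY
  have := E.one_le_form v hv
  rw [diff_apply, D.form_eq_one _ hY]
  omega

lemma diff_eq_zero {N : Finset Ray} (E : VertexData N) {Y : Ray} (h : Y ∈ M) (h' : Y ∈ N) :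
    D.diff E Y = 0 := by
  rw [diff_apply, D.form_eq_one _ h, E.form_eq_one _ h', sub_self]

lemma diff_z_pos {N : Finset Ray} (E : VertexData N) (hne : N ≠ M) : 0 < D.diff E D.z := by
  by_contra! h
  apply hne
  have := D.map_ray_eq_zero (D.map_eq_zero_of (D.diff_nonneg E) h)
  refine (D.eq_of_form E fun v => ?_).symm
  have := this v
  rw [diff_apply] at this
  omega

/-- A proper face of a vertex contains no full frame. -/
lemma exists_not_mem {N : Finset Ray} (E : VertexData N) (hne : N ≠ M) {S : Finset Ray} (hS : S ⊆ N)
    {i : ℕ} (hi : i < D.n) : ∃ Y ∈ D.frame i, Y ∉ S := by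
  by_contra! h
  have h1 := D.diff_z_pos E hne
  rw [D.map_z hi, Finset.sum_eq_zero] at h1
  · exact h1.false
  · intro Y hY
    exact D.diff_eq_zero E (D.mem_frame.mp hY).1 (hS (h Y hY))

/-- A subset of a vertex without full frames is contained in another vertex, avoiding a given
choice of missing rays. -/
lemma exists_nbr (u : ℕ → Ray) (hu : ∀ i < D.n, u i ∈ D.frame i) {S : Finset Ray} (hS : S ⊆ M)
    (hu' : ∀ i < D.n, u i ∉ S) : ∃ N, N ∈ Vset S ∧ N ≠ M ∧ ∀ X ∈ M, (∀ i < D.n, u i ≠ X) → X ∈ N := by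
  obtain ⟨N, h1, h2, h3⟩ := D.nbr u fun i hi => D.mem_frame.mp (hu i hi)
  exact ⟨N, ⟨h1, fun X hX => h3 X (hS hX) fun i hi e => hu' i hi (e ▸ hX)⟩, h2, h3⟩

end VertexData

lemma exists_generic : ∃ β : Ray → ℝ, (∀ b, 0 < β b) ∧
    ∀ c : Ray → ℤ, ∑ b ∈ rays minA, β b * c b = 0 → ∀ b ∈ rays minA, c b = 0 := by
  obtain ⟨t, ht⟩ : ∃ t : ℝ, Transcendental ℤ t :=
    ⟨_, transcendental_liouvilleNumber (m := 2) le_rfl⟩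
  have : Countable Ray := inferInstanceAs (Countable (Fin 4 → Fin 4 → ℤ))
  obtain ⟨e, he⟩ := exists_injective_nat Ray
  have ht0 : t ≠ 0 := by
    rintro rfl
    exact ht isAlgebraic_zero
  have ht2 := ht.pow (n := 2) two_pos
  refine ⟨fun b => (t ^ 2) ^ e b, fun b => by positivity, fun c hc b hb => ?_⟩
  have hp : ∑ b ∈ rays minA, Polynomial.monomial (e b) (c b) = 0 := by
    apply (transcendental_iff.mp ht2)
    rw [map_sum, ← hc]
    refine Finset.sum_congr rfl fun b _ => ?_
    rw [Polynomial.aeval_monomial, mul_comm]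
    rfl
  have := congrArg (fun p => Polynomial.coeff p (e b)) hp
  simp only [Polynomial.finsetSum_coeff, Polynomial.coeff_monomial, Polynomial.coeff_zero] at this
  rw [Finset.sum_eq_single_of_mem b hb] at this
  · simpa using this
  · intro b' _ hne
    rw [if_neg fun h => hne (he h)]

/-- A generic choice of weights. -/
noncomputable def genericWeight : Ray → ℝ := exists_generic.choose

lemma genericWeight_pos (b : Ray) : 0 < genericWeight b := exists_generic.choose_spec.1 b

/-- The height functional. -/
noncomputable def height (X : Ray →+ ℤ) : ℝ := ∑ b ∈ rays minA, genericWeight b * X b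

lemma height_sub (X Y : Ray →+ ℤ) : height (X - Y) = height X - height Y := by
  simp [height, mul_sub]

lemma height_nonneg {X : Ray →+ ℤ} (h : ∀ v, 0 ≤ X (ray v)) : 0 ≤ height X :=
  Finset.sum_nonneg fun b hb => by
    obtain ⟨v, -, rfl⟩ := vertexA.isRay b hb
    exact mul_nonneg (genericWeight_pos _).le (by exact_mod_cast h v)

lemma height_eq_zero {X : Ray →+ ℤ} (h : height X = 0) (v : Fin 4 → ℤ) : X (ray v) = 0 :=
  vertexA.map_ray_eq_zero (fun Y hY => exists_generic.choose_spec.2 (fun b => X b) h Y hY) v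

lemma VertexData.exists_weight {M : Finset Ray} (D : VertexData M) :
    ∃ w : Ray → ℝ, ∀ X : Ray →+ ℤ, height X = ∑ Y ∈ M, w Y * X Y := by
  have : ∀ b : Ray, ∃ a : Ray → ℤ, b ∈ rays minA → b = ∑ Y ∈ M, a Y • Y := fun b => by
    by_cases hb : b ∈ rays minA
    · obtain ⟨v, -, rfl⟩ := vertexA.isRay b hb
      obtain ⟨a, ha⟩ := D.span v
      exact ⟨a, fun _ => ha⟩
    · exact ⟨0, fun h => absurd h hb⟩
  choose a ha using this
  refine ⟨fun Y => ∑ b ∈ rays minA, genericWeight b * a b Y, fun X => ?_⟩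
  simp only [Finset.sum_mul]
  rw [Finset.sum_comm, height]
  refine Finset.sum_congr rfl fun b hb => ?_
  have hX : X b = ∑ Y ∈ M, a b Y * X Y := by
    conv_lhs => rw [ha b hb]
    rw [map_sum]
    exact Finset.sum_congr rfl fun Y _ => by rw [map_zsmul, smul_eq_mul]
  rw [hX]
  push_cast
  rw [Finset.mul_sum]
  refine Finset.sum_congr rfl fun Y _ => by ring

open Classical in
/-- The height of a vertex. -/
noncomputable def vheight (M : Finset Ray) : ℝ := if h : IsVert M then height h.data.form else 0

lemma vheight_eq {M : Finset Ray} (h : IsVert M) : vheight M = height h.data.form := dif_pos h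

lemma vheight_injOn {M N : Finset Ray} (hM : IsVert M) (hN : IsVert N) (h : vheight M = vheight N) :
    M = N := by
  rw [vheight_eq hM, vheight_eq hN] at h
  refine hM.data.eq_of_form hN.data fun v => ?_
  have := height_eq_zero (X := hM.data.form - hN.data.form) (by rw [height_sub, h, sub_self]) v
  exact sub_eq_zero.mp this

lemma height_diff {M N : Finset Ray} (hM : IsVert M) (hN : IsVert N) :
    height (hM.data.diff hN.data) = vheight N - vheight M := by
  rw [VertexData.diff, height_sub, vheight_eq hM, vheight_eq hN]

lemma finite_vheight_le (c : ℝ) : {M | IsVert M ∧ vheight M ≤ c}.Finite := by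
  have key : ∀ M (h : IsVert M), vheight M ≤ c → ∀ b ∈ rays minA,
      h.data.form b ∈ Set.Icc 1 ⌊c / genericWeight b⌋ := by
    intro M h hc b hb
    have h1 : ∀ b ∈ rays minA, 1 ≤ h.data.form b := fun b hb => by
      obtain ⟨v, hv, rfl⟩ := vertexA.isRay b hb
      exact h.data.one_le_form v hv
    refine ⟨h1 b hb, Int.le_floor.mpr ?_⟩
    rw [le_div_iff₀ (genericWeight_pos b), mul_comm]
    rw [vheight_eq h] at hc
    refine le_trans ?_ hc
    refine Finset.single_le_sum (f := fun b => genericWeight b * (h.data.form b : ℝ))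
      (fun b hb => ?_) hb
    exact mul_nonneg (genericWeight_pos b).le (by exact_mod_cast zero_le_one.trans (h1 b hb))
  classical
  refine Set.Finite.of_injOn
    (f := fun M (b : rays minA) => if h : IsVert M then h.data.form b else 0)
    (t := Set.pi Set.univ fun b : rays minA => Set.Icc 1 ⌊c / genericWeight b⌋) ?_ ?_
    (Set.Finite.pi fun b => Set.finite_Icc _ _)
  · rintro M ⟨h, hc⟩ b -
    simp only [dif_pos h]
    exact key M h hc b b.2
  · rintro M ⟨hM, -⟩ N ⟨hN, -⟩ e
    simp only [dif_pos hM, dif_pos hN] at e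
    refine hM.data.eq_of_form hN.data fun v => ?_
    have := vertexA.map_ray_eq_zero (X := hM.data.form - hN.data.form)
      (fun Y hY => sub_eq_zero.mpr (congrFun e ⟨Y, hY⟩)) v
    exact sub_eq_zero.mp this

/-- The square of a linear functional, as a functional on forms. -/
def sqForm (x : Fin 4 → ℤ) : Ray →+ ℤ :=
  AddMonoidHom.mk' (fun X => ∑ i, ∑ j, x i * X i j * x j) fun X Y => by
    simp only [Ray.add_apply, mul_add, add_mul, Finset.sum_add_distrib]

lemma sqForm_ray (x v : Fin 4 → ℤ) : sqForm x (ray v) = (x ⬝ᵥ v) ^ 2 := by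
  change ∑ i, ∑ j, x i * ray v i j * x j = _
  simp only [ray_apply, dotProduct, Fin.sum_univ_four]
  ring

/-- A set of rays spans if no nonzero linear functional vanishes on it. -/
def Spans (S : Finset Ray) : Prop := ∀ x, (∀ X ∈ S, sqForm x X = 0) → x = 0

lemma Spans.mono {S T : Finset Ray} (h : Spans S) (hST : S ⊆ T) : Spans T :=
  fun x hx => h x fun X hX => hx X (hST hX)

lemma sqForm_eq_zero {x : Fin 4 → ℤ} (h : ∀ v, sqForm x (ray v) = 0) : x = 0 := by
  have := h x
  rw [sqForm_ray, sq_eq_zero_iff, dotProduct_self_eq_zero] at this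
  exact this

/-- Cells of positive dimension of the well-rounded retract. -/
structure IsCell (S : Finset Ray) : Prop where
  spans : Spans S
  finite : (Vset S).Finite
  nontrivial : (Vset S).Nontrivial

lemma IsCell.of_subset {S U T : Finset Ray} (h : IsCell S) (h1 : S ⊆ U) (h2 : U ⊆ T)
    (hT : (Vset T).Nontrivial) : IsCell U :=
  ⟨h.spans.mono h1, h.finite.subset (Vset_anti h1), hT.mono (Vset_anti h2)⟩

namespace VertexData

variable {M : Finset Ray} (D : VertexData M)

/-- Weights on the rays of a vertex expressing the height. -/
noncomputable def weight : Ray → ℝ := D.exists_weight.choose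

lemma height_eq_sum (X : Ray →+ ℤ) :
    height X = ∑ i ∈ Finset.range D.n, ∑ Y ∈ D.frame i, D.weight Y * X Y := by
  rw [D.exists_weight.choose_spec X, D.sum_eq]; rfl

open Classical in
/-- The lightest ray of a frame. -/
noncomputable def light (i : ℕ) : Ray :=
  if h : i < D.n then (Finset.exists_min_image (D.frame i) D.weight (D.frame_nonempty h)).choose
  else 0

lemma light_mem {i : ℕ} (h : i < D.n) : D.light i ∈ D.frame i := by
  rw [light, dif_pos h]
  exact (Finset.exists_min_image (D.frame i) D.weight (D.frame_nonempty h)).choose_spec.1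

lemma weight_light_le {i : ℕ} (h : i < D.n) {Y : Ray} (hY : Y ∈ D.frame i) :
    D.weight (D.light i) ≤ D.weight Y := by
  rw [light, dif_pos h]
  exact (Finset.exists_min_image (D.frame i) D.weight (D.frame_nonempty h)).choose_spec.2 Y hY

lemma height_le (u : ℕ → Ray) (X : Ray →+ ℤ) (h0 : ∀ Y ∈ M, 0 ≤ X Y)
    (h : ∀ i < D.n, ∀ Y ∈ D.frame i, X Y ≠ 0 → D.weight Y ≤ D.weight (u i)) :
    height X ≤ (∑ i ∈ Finset.range D.n, D.weight (u i)) * X D.z := by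
  rw [D.height_eq_sum, Finset.sum_mul]
  refine Finset.sum_le_sum fun i hi => ?_
  have hi' := Finset.mem_range.mp hi
  rw [D.map_z hi' X]
  push_cast
  rw [Finset.mul_sum]
  refine Finset.sum_le_sum fun Y hY => ?_
  by_cases hX : X Y = 0
  · simp [hX]
  · exact mul_le_mul_of_nonneg_right (h i hi' Y hY hX)
      (by exact_mod_cast h0 Y (D.mem_frame.mp hY).1)

lemma le_height (X : Ray →+ ℤ) (h0 : ∀ Y ∈ M, 0 ≤ X Y) :
    (∑ i ∈ Finset.range D.n, D.weight (D.light i)) * X D.z ≤ height X := by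
  rw [D.height_eq_sum, Finset.sum_mul]
  refine Finset.sum_le_sum fun i hi => ?_
  have hi' := Finset.mem_range.mp hi
  rw [D.map_z hi' X]
  push_cast
  rw [Finset.mul_sum]
  exact Finset.sum_le_sum fun Y hY => mul_le_mul_of_nonneg_right (D.weight_light_le hi' hY)
      (by exact_mod_cast h0 Y (D.mem_frame.mp hY).1)

lemma height_eq_of (u : ℕ → Ray) (hu : ∀ i < D.n, u i ∈ D.frame i) (X : Ray →+ ℤ)
    (h : ∀ i < D.n, ∀ Y ∈ D.frame i, Y ≠ u i → X Y = 0) :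
    height X = (∑ i ∈ Finset.range D.n, D.weight (u i)) * X D.z := by
  rw [D.height_eq_sum, Finset.sum_mul]
  refine Finset.sum_congr rfl fun i hi => ?_
  have hi' := Finset.mem_range.mp hi
  rw [D.map_z hi' X, Finset.sum_eq_single_of_mem _ (hu i hi') fun Y hY hne => by
    rw [h i hi' Y hY hne, Int.cast_zero, mul_zero],
    Finset.sum_eq_single_of_mem _ (hu i hi') fun Y hY hne => h i hi' Y hY hne]

lemma height_neg (u : ℕ → Ray) (hs : ∑ i ∈ Finset.range D.n, D.weight (u i) < 0)
    (X : Ray →+ ℤ) (h0 : ∀ Y ∈ M, 0 ≤ X Y) (hz : 0 < X D.z)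
    (h : ∀ i < D.n, ∀ Y ∈ D.frame i, X Y ≠ 0 → D.weight Y ≤ D.weight (u i)) :
    height X < 0 :=
  (D.height_le u X h0 h).trans_lt (mul_neg_of_neg_of_pos hs (by exact_mod_cast hz))

end VertexData

/-- The highest vertex of a face. -/
structure IsTop (M S : Finset Ray) : Prop where
  vert : IsVert M
  sub : S ⊆ M
  lt : ∀ N ∈ Vset S, N ≠ M → vheight N < vheight M

lemma IsTop.unique {M N S : Finset Ray} (h : IsTop M S) (h' : IsTop N S) : M = N := by
  by_contra hne
  exact (h.lt N ⟨h'.vert, h'.sub⟩ (Ne.symm hne)).asymm (h'.lt M ⟨h.vert, h.sub⟩ hne)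

lemma IsTop.mono {M S T : Finset Ray} (h : IsTop M S) (hST : S ⊆ T) (hT : T ⊆ M) : IsTop M T :=
  ⟨h.vert, hT, fun N hN => h.lt N (Vset_anti hST hN)⟩

lemma IsCell.exists_top {S : Finset Ray} (h : IsCell S) : ∃ M, IsTop M S := by
  obtain ⟨M, hM, hmax⟩ := Set.exists_max_image (Vset S) vheight h.finite h.nontrivial.nonempty
  exact ⟨M, hM.1, hM.2, fun N hN hne =>
    lt_of_le_of_ne (hmax N hN) fun e => hne (vheight_injOn hN.1 hM.1 e)⟩

lemma IsTop.vset_finite {M S : Finset Ray} (h : IsTop M S) : (Vset S).Finite :=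
  (finite_vheight_le (vheight M)).subset fun N hN => ⟨hN.1, by
    by_cases e : N = M
    · rw [e]
    · exact (h.lt N hN e).le⟩

/-- If all functionals nonnegative on `M` and supported like `S` have negative height, then
`S` is a cell with top `M`. -/
lemma isTop_and_spans {M S : Finset Ray} (hM : IsVert M) (hS : S ⊆ M)
    (h : ∀ X : Ray →+ ℤ, (∀ Y ∈ M, 0 ≤ X Y) → (∀ Y ∈ S, X Y = 0) → 0 < X hM.data.z → height X < 0) :
    IsTop M S ∧ Spans S := by
  refine ⟨⟨hM, hS, fun N hN hne => ?_⟩, fun x hx => ?_⟩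
  · have := h (hM.data.diff hN.1.data) (hM.data.diff_nonneg _)
      (fun Y hY => hM.data.diff_eq_zero _ (hS hY) (hN.2 hY)) (hM.data.diff_z_pos _ hne)
    rw [height_diff] at this
    linarith
  · by_contra hne
    have h0 : ∀ v, 0 ≤ sqForm x (ray v) := fun v => by rw [sqForm_ray]; positivity
    have hM0 : ∀ Y ∈ M, 0 ≤ sqForm x Y := fun Y hY => by
      obtain ⟨v, -, rfl⟩ := hM.data.isRay Y hY
      exact h0 v
    refine (h (sqForm x) hM0 hx ?_).not_ge (height_nonneg h0)
    by_contra! hz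
    exact hne (sqForm_eq_zero fun v =>
      hM.data.map_ray_eq_zero (hM.data.map_eq_zero_of hM0 hz) v)

lemma IsTop.weight_neg {M S : Finset Ray} (h : IsTop M S) (u : ℕ → Ray)
    (hu : ∀ i < h.vert.data.n, u i ∈ h.vert.data.frame i) (hu' : ∀ i < h.vert.data.n, u i ∉ S) :
    ∑ i ∈ Finset.range h.vert.data.n, h.vert.data.weight (u i) < 0 := by
  obtain ⟨N, hN, hne, hsub⟩ := h.vert.data.exists_nbr u hu h.sub hu'
  have h1 := h.vert.data.height_eq_of u hu (h.vert.data.diff hN.1.data) fun i hi Y hY hYu => by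
    refine h.vert.data.diff_eq_zero _ (h.vert.data.mem_frame.mp hY).1
      (hsub Y (h.vert.data.mem_frame.mp hY).1 fun j hj e => hYu ?_)
    rw [← e] at hY ⊢
    have := (h.vert.data.mem_frame.mp (hu j hj)).2
    rw [(h.vert.data.mem_frame.mp hY).2] at this
    rw [this]
  have h2 := h.lt N hN hne
  have h3 : (0 : ℝ) < h.vert.data.diff hN.1.data h.vert.data.z := by
    exact_mod_cast h.vert.data.diff_z_pos hN.1.data hne
  rw [height_diff] at h1
  by_contra! hc
  nlinarith [mul_nonneg hc h3.le]

/-- No full frame of `M` is contained in `S`. -/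
def NoFrame {M : Finset Ray} (D : VertexData M) (S : Finset Ray) : Prop :=
  ∀ i < D.n, ∃ Y ∈ D.frame i, Y ∉ S

lemma noFrame_of_nontrivial {M S : Finset Ray} (D : VertexData M) (h : (Vset S).Nontrivial) :
    NoFrame D S := by
  obtain ⟨N, hN, hne⟩ := h.exists_ne M
  exact fun i hi => D.exists_not_mem hN.1.data hne hN.2 hi

lemma NoFrame.nontrivial {M S : Finset Ray} (hM : IsVert M) (hS : S ⊆ M)
    (h : NoFrame hM.data S) : (Vset S).Nontrivial := by
  have : ∀ i, ∃ Y, i < hM.data.n → Y ∈ hM.data.frame i ∧ Y ∉ S := fun i => by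
    by_cases hi : i < hM.data.n
    · obtain ⟨Y, h1, h2⟩ := h i hi
      exact ⟨Y, fun _ => ⟨h1, h2⟩⟩
    · exact ⟨0, fun h => absurd h hi⟩
  choose u hu using this
  obtain ⟨N, hN, hne, -⟩ := hM.data.exists_nbr u (fun i hi => (hu i hi).1) hS fun i hi => (hu i hi).2
  exact ⟨M, ⟨hM, hS⟩, N, hN, hne.symm⟩

/-- Removing light rays does not change the top. -/
lemma IsTop.erase {M S : Finset Ray} (h : IsTop M S) (hn : NoFrame h.vert.data S) (i : ℕ)
    (hi : i < h.vert.data.n) :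
    IsTop M (S.erase (h.vert.data.light i)) ∧ Spans (S.erase (h.vert.data.light i)) := by
  set D := h.vert.data with hD
  have : ∀ j, ∃ Y, j < D.n → Y ∈ D.frame j ∧ Y ∉ S ∧
      ∀ Z ∈ D.frame j, Z ∉ S → D.weight Z ≤ D.weight Y := fun j => by
    by_cases hj : j < D.n
    · obtain ⟨Y, h1, h2⟩ := Finset.exists_max_image (D.frame j \ S) D.weight (by
        obtain ⟨Y, h1, h2⟩ := hn j hj
        exact ⟨Y, Finset.mem_sdiff.mpr ⟨h1, h2⟩⟩)
      rw [Finset.mem_sdiff] at h1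
      exact ⟨Y, fun _ => ⟨h1.1, h1.2, fun Z hZ hZS => h2 Z (Finset.mem_sdiff.mpr ⟨hZ, hZS⟩)⟩⟩
    · exact ⟨0, fun h => absurd h hj⟩
  choose u hu using this
  have hw := h.weight_neg u (fun j hj => (hu j hj).1) fun j hj => (hu j hj).2.1
  refine isTop_and_spans h.vert ((Finset.erase_subset _ _).trans h.sub) fun X h0 hX hz => ?_
  refine D.height_neg u hw X h0 hz fun j hj Y hY hXY => ?_
  by_cases hYS : Y ∈ S
  · have : Y = D.light i := by
      by_contra hne
      exact hXY (hX Y (Finset.mem_erase.mpr ⟨hne, hYS⟩))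
    have hij : i = j := by
      rw [← (D.mem_frame.mp hY).2, this, (D.mem_frame.mp (D.light_mem hi)).2]
    rw [this, hij]
    exact D.weight_light_le hj (hu j hj).1
  · exact (hu j hj).2.2 Y hY hYS

/-- The set of light rays of a vertex. -/
noncomputable def VertexData.lights {M : Finset Ray} (D : VertexData M) : Finset Ray :=
  (Finset.range D.n).image D.light

lemma VertexData.mem_lights {M : Finset Ray} (D : VertexData M) {X : Ray} :
    X ∈ D.lights ↔ ∃ i < D.n, D.light i = X := by
  simp [VertexData.lights]

lemma VertexData.card_lights {M : Finset Ray} (D : VertexData M) : D.lights.card = D.n := by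
  rw [lights, Finset.card_image_of_injOn, Finset.card_range]
  intro i hi j hj e
  rw [Finset.mem_coe, Finset.mem_range] at hi hj
  rw [← (D.mem_frame.mp (D.light_mem hi)).2, ← (D.mem_frame.mp (D.light_mem hj)).2]
  exact congrArg _ e

lemma VertexData.lights_subset {M : Finset Ray} (D : VertexData M) : D.lights ⊆ M := by
  intro X hX
  obtain ⟨i, hi, rfl⟩ := D.mem_lights.mp hX
  exact (D.mem_frame.mp (D.light_mem hi)).1

lemma VertexData.noFrame_lights {M : Finset Ray} (D : VertexData M) : NoFrame D (M \ D.lights) :=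
  fun i hi => ⟨_, D.light_mem hi, fun h => (Finset.mem_sdiff.mp h).2
    (D.mem_lights.mpr ⟨i, hi, rfl⟩)⟩

/-- The descending edge at a vertex which is not lowest. -/
lemma isTop_lights {M N : Finset Ray} (hM : IsVert M) (hN : IsVert N) (hlt : vheight N < vheight M) :
    IsTop M (M \ hM.data.lights) ∧ Spans (M \ hM.data.lights) := by
  set D := hM.data with hD
  have hne : N ≠ M := by rintro rfl; exact hlt.false
  have hw : ∑ i ∈ Finset.range D.n, D.weight (D.light i) < 0 := by
    have h1 := D.le_height _ (D.diff_nonneg hN.data)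
    have h3 : (0 : ℝ) < D.diff hN.data D.z := by exact_mod_cast D.diff_z_pos hN.data hne
    rw [hD, height_diff, ← hD] at h1
    by_contra! hc
    nlinarith [mul_nonneg hc h3.le]
  refine isTop_and_spans hM Finset.sdiff_subset fun X h0 hX hz => ?_
  refine D.height_neg D.light hw X h0 hz fun j hj Y hY hXY => ?_
  by_cases hYL : Y ∈ D.lights
  · obtain ⟨i, hi, rfl⟩ := D.mem_lights.mp hYL
    have hij : i = j := by
      rw [← (D.mem_frame.mp hY).2, (D.mem_frame.mp (D.light_mem hi)).2]
    rw [hij]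
  · exact absurd (hX Y (Finset.mem_sdiff.mpr ⟨(D.mem_frame.mp hY).1, hYL⟩)) hXY

namespace VertexData

variable {M : Finset Ray} (D : VertexData M)

open Classical in
lemma stage_aux (S : Finset Ray) : ∃ i, D.n ≤ i ∨ D.frame i \ S ≠ {D.light i} := ⟨D.n, Or.inl le_rfl⟩

open Classical in
/-- The first frame in which a face differs from the descending edge. -/
noncomputable def stage (S : Finset Ray) : ℕ := Nat.find (D.stage_aux S)

lemma stage_le (S : Finset Ray) : D.stage S ≤ D.n := by
  classical
  exact Nat.find_min' (D.stage_aux S) (Or.inl le_rfl)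

lemma frame_stage {S : Finset Ray} (h : D.stage S < D.n) :
    D.frame (D.stage S) \ S ≠ {D.light (D.stage S)} := by
  classical
  exact (Nat.find_spec (D.stage_aux S)).resolve_left h.not_ge

lemma frame_of_lt_stage {S : Finset Ray} {i : ℕ} (h : i < D.stage S) :
    D.frame i \ S = {D.light i} := by
  classical
  have := Nat.find_min (D.stage_aux S) h
  push Not at this
  exact this.2

lemma stage_eq {S : Finset Ray} {i : ℕ} (hi : i < D.n) (h : D.frame i \ S ≠ {D.light i})
    (h' : ∀ j < i, D.frame j \ S = {D.light j}) : D.stage S = i := by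
  classical
  refine le_antisymm (Nat.find_min' (D.stage_aux S) (Or.inr h)) ?_
  by_contra! hlt
  exact D.frame_stage (hlt.trans hi) (h' _ hlt)

lemma light_not_mem_frame {i j : ℕ} (hi : i < D.n) (hij : j ≠ i) : D.light i ∉ D.frame j :=
  fun h => hij ((D.mem_frame.mp h).2.symm.trans (D.mem_frame.mp (D.light_mem hi)).2)

lemma frame_sdiff_congr {S T : Finset Ray} {i j : ℕ} (hi : i < D.n) (hij : j ≠ i)
    (h : ∀ X, X ≠ D.light i → (X ∈ S ↔ X ∈ T)) : D.frame j \ S = D.frame j \ T := by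
  ext X
  simp only [Finset.mem_sdiff]
  refine and_congr_right fun hX => not_congr (h X ?_)
  rintro rfl
  exact D.light_not_mem_frame hi hij hX

lemma stage_erase {S : Finset Ray} (hn : NoFrame D S) (h : D.stage S < D.n)
    (hS : D.light (D.stage S) ∈ S) : D.stage (S.erase (D.light (D.stage S))) = D.stage S := by
  refine D.stage_eq h (fun e => ?_) fun j hj => ?_
  · obtain ⟨Y, h1, h2⟩ := hn _ h
    have : Y ∈ D.frame (D.stage S) \ S.erase (D.light (D.stage S)) :=
      Finset.mem_sdiff.mpr ⟨h1, fun h => h2 (Finset.mem_of_mem_erase h)⟩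
    rw [e, Finset.mem_singleton] at this
    exact h2 (this ▸ hS)
  · rw [← D.frame_of_lt_stage hj]
    exact D.frame_sdiff_congr h hj.ne fun X hX => by simp [hX]

lemma stage_insert {U : Finset Ray} (h : D.stage U < D.n) :
    D.stage (insert (D.light (D.stage U)) U) = D.stage U := by
  refine D.stage_eq h (fun e => ?_) fun j hj => ?_
  · have := e ▸ Finset.mem_singleton_self (D.light (D.stage U))
    exact (Finset.mem_sdiff.mp this).2 (Finset.mem_insert_self _ _)
  · rw [← D.frame_of_lt_stage hj]
    exact D.frame_sdiff_congr h hj.ne fun X hX => by simp [hX]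

lemma noFrame_insert {U : Finset Ray} (hn : NoFrame D U) (h : D.stage U < D.n)
    (hU : D.light (D.stage U) ∉ U) : NoFrame D (insert (D.light (D.stage U)) U) := by
  intro i hi
  obtain ⟨Y, h1, h2⟩ := hn i hi
  by_cases e : Y = D.light (D.stage U)
  · have hi' : i = D.stage U := by
      by_contra hne
      exact D.light_not_mem_frame h hne (e ▸ h1)
    subst hi'
    by_contra! hc
    apply D.frame_stage h
    refine Finset.eq_singleton_iff_unique_mem.mpr
      ⟨Finset.mem_sdiff.mpr ⟨D.light_mem h, hU⟩, fun Z hZ => ?_⟩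
    rw [Finset.mem_sdiff] at hZ
    exact (Finset.mem_insert.mp (hc Z hZ.1)).resolve_right hZ.2
  · exact ⟨Y, h1, by simp [e, h2]⟩

/-- A face of cardinality nine without frames misses exactly one ray from each frame. -/
lemma card_frame_sdiff {S : Finset Ray} (hS : S ⊆ M) (hn : NoFrame D S) (hc : S.card = 9) {i : ℕ}
    (hi : i < D.n) : (D.frame i \ S).card = 1 := by
  have h1 : ∀ i ∈ Finset.range D.n, 1 ≤ (D.frame i \ S).card := fun i hi => by
    obtain ⟨Y, h1, h2⟩ := hn i (Finset.mem_range.mp hi)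
    exact Finset.card_pos.mpr ⟨Y, Finset.mem_sdiff.mpr ⟨h1, h2⟩⟩
  have h2 : ∑ i ∈ Finset.range D.n, (D.frame i \ S).card = D.n := by
    have e : (M \ S).card = D.n := by
      rw [Finset.card_sdiff_of_subset hS, D.card_eq, hc]
      omega
    refine Eq.trans ?_ e
    conv_rhs => rw [Finset.card_eq_sum_card_fiberwise
      (t := Finset.range D.n) (f := D.lab) fun X hX => by
        rw [Finset.mem_coe, Finset.mem_range]
        exact D.lab_lt X (Finset.mem_sdiff.mp hX).1]
    refine Finset.sum_congr rfl fun i _ => congrArg _ ?_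
    ext X
    simp only [Finset.mem_sdiff, D.mem_frame, Finset.mem_filter]
    tauto
  have h3 : ∑ i ∈ Finset.range D.n, 1 = ∑ i ∈ Finset.range D.n, (D.frame i \ S).card := by
    rw [h2]; simp
  exact ((Finset.sum_eq_sum_iff_of_le h1).mp h3 i (Finset.mem_range.mpr hi)).symm

lemma subset_iff_frames {S : Finset Ray} (hS : S ⊆ M)
    (h : ∀ i < D.n, D.frame i \ S = {D.light i}) : S = M \ D.lights := by
  ext X
  rw [Finset.mem_sdiff]
  constructor
  · refine fun hX => ⟨hS hX, fun hL => ?_⟩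
    obtain ⟨i, hi, rfl⟩ := D.mem_lights.mp hL
    have := (h i hi).symm ▸ Finset.mem_singleton_self (D.light i)
    exact (Finset.mem_sdiff.mp this).2 hX
  · rintro ⟨hX, hL⟩
    by_contra hXS
    have : X ∈ D.frame (D.lab X) \ S := Finset.mem_sdiff.mpr ⟨D.mem_frame.mpr ⟨hX, rfl⟩, hXS⟩
    rw [h _ (D.lab_lt X hX), Finset.mem_singleton] at this
    exact hL (D.mem_lights.mpr ⟨_, D.lab_lt X hX, this.symm⟩)

lemma frame_sdiff_lights {i : ℕ} (hi : i < D.n) : D.frame i \ (M \ D.lights) = {D.light i} := by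
  refine Finset.eq_singleton_iff_unique_mem.mpr ⟨Finset.mem_sdiff.mpr ⟨D.light_mem hi, fun h =>
    (Finset.mem_sdiff.mp h).2 (D.mem_lights.mpr ⟨i, hi, rfl⟩)⟩, fun Y hY => ?_⟩
  simp only [Finset.mem_sdiff, not_and, not_not] at hY
  obtain ⟨j, hj, rfl⟩ := D.mem_lights.mp (hY.2 (D.mem_frame.mp hY.1).1)
  rw [← (D.mem_frame.mp hY.1).2, (D.mem_frame.mp (D.light_mem hj)).2]

lemma stage_lights : D.stage (M \ D.lights) = D.n := by
  refine (D.stage_le _).antisymm ?_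
  by_contra! h
  exact D.frame_stage h (D.frame_sdiff_lights h)

lemma card_sdiff_lights : (M \ D.lights).card = 9 := by
  rw [Finset.card_sdiff_of_subset D.lights_subset, D.card_eq, D.card_lights]
  omega

end VertexData

/-- The number of lower vertices. -/
noncomputable def vrank (M : Finset Ray) : ℕ := {N | IsVert N ∧ vheight N < vheight M}.ncard

lemma vrank_lt {M N : Finset Ray} (hN : IsVert N) (h : vheight N < vheight M) :
    vrank N < vrank M := by
  refine Set.ncard_lt_ncard ⟨fun K hK => ⟨hK.1, hK.2.trans h⟩, fun hs => ?_⟩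
    ((finite_vheight_le (vheight M)).subset fun K hK => ⟨hK.1, hK.2.le⟩)
  exact (hs ⟨hN, h⟩ : IsVert N ∧ vheight N < vheight N).2.false

/-- The cells of dimension `k`. -/
def IsKCell (k : ℕ) (S : Finset Ray) : Prop :=
  if k = 0 then IsVert S else IsCell S ∧ S.card + k = 10

lemma isKCell_zero {S : Finset Ray} : IsKCell 0 S ↔ IsVert S := by simp [IsKCell]

lemma isKCell_succ {k : ℕ} {S : Finset Ray} : IsKCell (k + 1) S ↔ IsCell S ∧ S.card + k = 9 := by
  simp only [IsKCell, Nat.succ_ne_zero, if_false]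
  exact and_congr_right fun _ => by omega

/-- The discrete Morse matching. -/
inductive Match : ℕ → Finset Ray → Finset Ray → Prop
  | vertex (M N : Finset Ray) (hM : IsVert M) (hN : IsVert N) (h : vheight N < vheight M) :
      Match 0 M (M \ hM.data.lights)
  | cell (k : ℕ) (M S : Finset Ray) (hS : IsKCell (k + 1) S) (h : IsTop M S)
      (hs : h.vert.data.stage S < h.vert.data.n)
      (hl : h.vert.data.light (h.vert.data.stage S) ∈ S) :
      Match (k + 1) S (S.erase (h.vert.data.light (h.vert.data.stage S)))

/-- Critical or ascending cells are those which are not the lower cell of a matched pair. -/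
def IsDown (k : ℕ) (S : Finset Ray) : Prop := ∃ U, Match k S U

open Classical in
/-- The rank controlling the acyclicity of the matching. -/
noncomputable def cellRank (k : ℕ) (S : Finset Ray) : ℕ ×ₗ ℕ :=
  if h : k ≠ 0 ∧ ∃ M, IsTop M S then
    toLex (vrank h.2.choose, h.2.choose_spec.vert.data.n - h.2.choose_spec.vert.data.stage S)
  else toLex (vrank S, 0)

lemma cellRank_zero (S : Finset Ray) : cellRank 0 S = toLex (vrank S, 0) := by
  rw [cellRank, dif_neg (by simp)]

lemma cellRank_succ (k : ℕ) {M S : Finset Ray} (h : IsTop M S) :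
    cellRank (k + 1) S = toLex (vrank M, h.vert.data.n - h.vert.data.stage S) := by
  have hex : ∃ M, IsTop M S := ⟨M, h⟩
  rw [cellRank, dif_pos ⟨by simp, hex⟩]
  have e : M = hex.choose := h.unique hex.choose_spec
  subst e
  rfl

lemma Match.functional {k : ℕ} {S U U' : Finset Ray} (h : Match k S U) (h' : Match k S U') :
    U = U' := by
  cases h with
  | vertex M N hM hN h => cases h' with | vertex => rfl
  | cell k M S hS h hs hl =>
    cases h' with
    | cell _ M' _ hS' h' hs' hl' =>
      obtain rfl := h.unique h'
      rfl

lemma Match.isKCell_left {k : ℕ} {S U : Finset Ray} (h : Match k S U) : IsKCell k S := by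
  cases h with
  | vertex M N hM hN h => exact isKCell_zero.mpr hM
  | cell k M S hS h hs hl => exact hS

lemma Match.isKCell_right {k : ℕ} {S U : Finset Ray} (h : Match k S U) : IsKCell (k + 1) U := by
  cases h with
  | vertex M N hM hN h =>
    obtain ⟨h1, h2⟩ := isTop_lights hM hN h
    exact isKCell_succ.mpr ⟨⟨h2, h1.vset_finite, NoFrame.nontrivial hM Finset.sdiff_subset
      hM.data.noFrame_lights⟩, hM.data.card_sdiff_lights⟩
  | cell k M S hS h hs hl =>
    obtain ⟨hc, hk⟩ := isKCell_succ.mp hS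
    obtain ⟨h1, h2⟩ := h.erase (noFrame_of_nontrivial _ hc.nontrivial) _ hs
    refine isKCell_succ.mpr ⟨⟨h2, h1.vset_finite,
      hc.nontrivial.mono (Vset_anti (Finset.erase_subset _ _))⟩, ?_⟩
    rw [Finset.card_erase_of_mem hl]
    have := Finset.card_pos.mpr ⟨_, hl⟩
    omega

lemma Match.rank_eq {k : ℕ} {S U : Finset Ray} (h : Match k S U) :
    cellRank (k + 1) U = cellRank k S := by
  cases h with
  | vertex M N hM hN h =>
    obtain ⟨h1, h2⟩ := isTop_lights hM hN h
    rw [cellRank_succ _ h1, cellRank_zero, hM.data.stage_lights, Nat.sub_self]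
  | cell k M S hS h hs hl =>
    have hn := noFrame_of_nontrivial h.vert.data (isKCell_succ.mp hS).1.nontrivial
    rw [cellRank_succ _ (h.erase hn _ hs).1, cellRank_succ _ h, h.vert.data.stage_erase hn hs hl]

lemma Match.rank_lt {k : ℕ} {S U T : Finset Ray} (h : Match k S U) (hT : IsDown k T) (hUT : U ⊆ T)
    (hne : T ≠ S) : cellRank k T < cellRank k S := by
  obtain ⟨V, hT⟩ := hT
  cases h with
  | vertex M N hM hN h =>
    have h1 := (isTop_lights hM hN h).1
    have hTv := isKCell_zero.mp hT.isKCell_left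
    rw [cellRank_zero, cellRank_zero, Prod.Lex.toLex_lt_toLex]
    exact Or.inl (vrank_lt hTv (h1.lt T ⟨hTv, hUT⟩ hne))
  | cell k M S hS h hs hl =>
    cases hT with
    | cell _ M' _ hT h' hs' hl' =>
      obtain ⟨hc, hk⟩ := isKCell_succ.mp hS
      obtain ⟨hc', hk'⟩ := isKCell_succ.mp hT
      obtain ⟨h1, h2⟩ := h.erase (noFrame_of_nontrivial _ hc.nontrivial) _ hs
      rw [cellRank_succ _ h, cellRank_succ _ h', Prod.Lex.toLex_lt_toLex]
      by_cases e : M' = M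
      · subst e
        refine Or.inr ⟨rfl, ?_⟩
        change h'.vert.data.n - _ < h'.vert.data.n - _
        have hs2 : h'.vert.data.stage S < h'.vert.data.n := hs
        suffices h'.vert.data.stage S < h'.vert.data.stage T by omega
        by_contra! hle
        rcases hle.lt_or_eq with hlt | heq
        · have h3 := h'.vert.data.frame_of_lt_stage hlt
          obtain ⟨Y, h4, h5⟩ := noFrame_of_nontrivial h'.vert.data hc'.nontrivial _ hs'
          have h6 : Y ∉ S := fun hYS => h5 (hUT (Finset.mem_erase.mpr
            ⟨fun e => h'.vert.data.light_not_mem_frame hs2 hlt.ne (e ▸ h4), hYS⟩))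
          have h7 := Finset.mem_sdiff.mpr ⟨h4, h6⟩
          rw [h3, Finset.mem_singleton] at h7
          exact h5 (h7 ▸ hl')
        · apply hne
          symm
          refine Finset.eq_of_subset_of_card_le (fun X hX => ?_) (by omega)
          by_cases hXl : X = h'.vert.data.light (h'.vert.data.stage S)
          · rw [hXl, ← heq]
            exact hl'
          · exact hUT (Finset.mem_erase.mpr ⟨hXl, hX⟩)
      · exact Or.inl (vrank_lt h'.vert
          (h1.lt M' ⟨h'.vert, hUT.trans h'.sub⟩ e))

lemma exists_match {k : ℕ} {U : Finset Ray} (hU : IsKCell (k + 1) U) (hd : ¬ IsDown (k + 1) U) :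
    ∃ S, Match k S U := by
  obtain ⟨hc, hk⟩ := isKCell_succ.mp hU
  obtain ⟨M, h⟩ := hc.exists_top
  have hn := noFrame_of_nontrivial h.vert.data hc.nontrivial
  have hl : h.vert.data.stage U < h.vert.data.n →
      h.vert.data.light (h.vert.data.stage U) ∉ U := fun hs hl => hd ⟨_, .cell k M U hU h hs hl⟩
  rcases (h.vert.data.stage_le U).lt_or_eq with hs | hs
  · obtain - | k := k
    · exfalso
      have h1 := h.vert.data.card_frame_sdiff h.sub hn hk hs
      obtain ⟨Y, hY⟩ := Finset.card_eq_one.mp h1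
      have h2 := Finset.mem_sdiff.mpr ⟨h.vert.data.light_mem hs, hl hs⟩
      have h3 := h.vert.data.frame_stage hs
      rw [hY, Finset.mem_singleton] at h2
      rw [hY, h2] at h3
      exact h3 rfl
    · have hsub : insert (h.vert.data.light (h.vert.data.stage U)) U ⊆ M :=
        Finset.insert_subset (h.vert.data.mem_frame.mp (h.vert.data.light_mem hs)).1 h.sub
      have hn' := h.vert.data.noFrame_insert hn hs (hl hs)
      have ht := h.mono (Finset.subset_insert _ _) hsub
      refine ⟨insert (h.vert.data.light (h.vert.data.stage U)) U, ?_⟩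
      have hS : IsKCell (k + 1) (insert (h.vert.data.light (h.vert.data.stage U)) U) :=
        isKCell_succ.mpr ⟨hc.of_subset (Finset.subset_insert _ _) subset_rfl
          (NoFrame.nontrivial h.vert hsub hn'), by
            rw [Finset.card_insert_of_notMem (hl hs)]; omega⟩
      have e := h.vert.data.stage_insert hs
      have := Match.cell k M _ hS ht (by rw [e]; exact hs) (by
        rw [e]; exact Finset.mem_insert_self _ _)
      rw [e, Finset.erase_insert (hl hs)] at this
      exact this
  · have e := h.vert.data.subset_iff_frames h.sub
      fun i hi => h.vert.data.frame_of_lt_stage (hs.symm ▸ hi)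
    obtain rfl : k = 0 := by
      rw [e, h.vert.data.card_sdiff_lights] at hk
      omega
    obtain ⟨N, hN, hne⟩ := hc.nontrivial.exists_ne M
    refine ⟨M, ?_⟩
    conv => rw [e]
    exact Match.vertex M N h.vert hN.1 (h.lt N hN hne)

/-- Row index of a coordinate of a symmetric matrix. -/
def symRow : Fin 10 → Fin 4 := ![0, 0, 0, 0, 1, 1, 1, 2, 2, 3]

/-- Column index of a coordinate of a symmetric matrix. -/
def symCol : Fin 10 → Fin 4 := ![0, 1, 2, 3, 1, 2, 3, 2, 3, 3]

/-- The coordinate at a given position of a symmetric matrix. -/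
def symIdx : Fin 4 → Fin 4 → Fin 10 := ![![0, 1, 2, 3], ![1, 4, 5, 6], ![2, 5, 7, 8], ![3, 6, 8, 9]]

/-- Coordinates of a symmetric matrix. -/
def symCrd : Matrix (Fin 4) (Fin 4) ℚ →ₗ[ℚ] (Fin 10 → ℚ) where
  toFun Y k := Y (symRow k) (symCol k)
  map_add' _ _ := rfl
  map_smul' _ _ := rfl

/-- The symmetric matrix with given coordinates. -/
def symMat : (Fin 10 → ℚ) →ₗ[ℚ] Matrix (Fin 4) (Fin 4) ℚ where
  toFun y := Matrix.of fun i j => y (symIdx i j)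
  map_add' _ _ := rfl
  map_smul' _ _ := rfl

lemma symMat_symCrd {Y : Matrix (Fin 4) (Fin 4) ℚ} (h : Yᵀ = Y) : symMat (symCrd Y) = Y := by
  have h' : ∀ i j, Y j i = Y i j := fun i j => congrFun (congrFun h i) j
  ext i j
  change Y (symRow (symIdx i j)) (symCol (symIdx i j)) = Y i j
  fin_cases i <;> fin_cases j <;> first | rfl | exact h' _ _

lemma symMat_transpose (y : Fin 10 → ℚ) : (symMat y)ᵀ = symMat y := by
  ext i j
  change y (symIdx j i) = y (symIdx i j)
  fin_cases i <;> fin_cases j <;> rfl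

lemma symCrd_symMat (y : Fin 10 → ℚ) : symCrd (symMat y) = y := by
  ext k
  change y (symIdx (symRow k) (symCol k)) = y k
  fin_cases k <;> rfl

/-- Congruence on coordinates of symmetric matrices. -/
def symAct (g : Matrix (Fin 4) (Fin 4) ℚ) : (Fin 10 → ℚ) →ₗ[ℚ] (Fin 10 → ℚ) :=
  symCrd ∘ₗ (LinearMap.mulRight ℚ gᵀ ∘ₗ LinearMap.mulLeft ℚ g) ∘ₗ symMat

lemma symAct_apply (g : Matrix (Fin 4) (Fin 4) ℚ) (y : Fin 10 → ℚ) :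
    symAct g y = symCrd (g * symMat y * gᵀ) := rfl

lemma symAct_mul (g h : Matrix (Fin 4) (Fin 4) ℚ) : symAct (g * h) = symAct g ∘ₗ symAct h := by
  ext1 i
  ext1
  simp only [LinearMap.comp_apply, symAct_apply]
  rw [symMat_symCrd (by simp only [Matrix.transpose_mul, Matrix.transpose_transpose,
    symMat_transpose, Matrix.mul_assoc])]
  simp only [Matrix.transpose_mul, Matrix.mul_assoc]

lemma symAct_one : symAct 1 = LinearMap.id := by
  ext1 i
  ext1
  simp only [LinearMap.comp_apply, symAct_apply, Matrix.transpose_one, Matrix.one_mul,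
    Matrix.mul_one, symCrd_symMat, LinearMap.id_apply]

lemma symAct_diagonal (d : Fin 4 → ℚ) :
    symAct (Matrix.diagonal d) = Matrix.toLin' (Matrix.diagonal fun k => d (symRow k) * d (symCol k)) := by
  refine LinearMap.ext fun y => funext fun k => ?_
  rw [symAct_apply, Matrix.toLin'_apply, Matrix.mulVec_diagonal, Matrix.diagonal_transpose]
  change (Matrix.diagonal d * symMat y * Matrix.diagonal d) (symRow k) (symCol k) = _
  rw [Matrix.mul_diagonal, Matrix.diagonal_mul]
  change d _ * symMat y (symRow k) (symCol k) * d _ = _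
  rw [show symMat y (symRow k) (symCol k) = y k from congrFun (symCrd_symMat y) k]
  ring

lemma det_mul_det_symAct_nonneg (g : Matrix (Fin 4) (Fin 4) ℚ) :
    0 ≤ g.det * LinearMap.det (symAct g) := by
  refine Matrix.diagonal_transvection_induction
    (fun g => 0 ≤ g.det * LinearMap.det (symAct g)) g (fun d _ => ?_) (fun t => ?_)
    fun A B hA hB => ?_
  · rw [symAct_diagonal, LinearMap.det_toLin', Matrix.det_diagonal, Matrix.det_diagonal]
    have : (∏ i, d i) * ∏ k, d (symRow k) * d (symCol k) = ((∏ i, d i) ^ 3) ^ 2 := by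
      simp only [Fin.prod_univ_succ, Fin.prod_univ_zero, symRow, symCol]
      simp
      ring
    rw [this]
    positivity
  · have : t.toMatrix = Matrix.transvection t.i t.j (t.c / 2) * Matrix.transvection t.i t.j (t.c / 2) := by
      rw [Matrix.transvection_mul_transvection_same _ _ t.hij, add_halves]; rfl
    rw [this, Matrix.det_mul, symAct_mul, LinearMap.det_comp]
    exact mul_nonneg (mul_self_nonneg _) (mul_self_nonneg _)
  · rw [Matrix.det_mul, symAct_mul, LinearMap.det_comp, mul_mul_mul_comm]
    exact mul_nonneg hA hB

/-- Rational coordinates of the symmetrization. -/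
def sym : Ray →+ (Fin 10 → ℚ) where
  toFun X k := X (symRow k) (symCol k) + X (symCol k) (symRow k)
  map_zero' := by ext k; simp [Ray.zero_apply]
  map_add' X Y := by ext k; simp [Ray.add_apply]; ring

/-- Rational matrix of a group element. -/
def ratMat (g : SL4) : Matrix (Fin 4) (Fin 4) ℚ := g.1.map (Int.castRingHom ℚ)

lemma ratMat_mul (g h : SL4) : ratMat (g * h) = ratMat g * ratMat h := by
  rw [ratMat, Matrix.SpecialLinearGroup.coe_mul, Matrix.map_mul]; rfl

lemma det_ratMat (g : SL4) : (ratMat g).det = 1 := by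
  rw [ratMat, ← RingHom.mapMatrix_apply, ← RingHom.map_det, g.2, map_one]

lemma det_symAct_pos (g : SL4) : 0 < LinearMap.det (symAct (ratMat g)) := by
  have h1 := det_mul_det_symAct_nonneg (ratMat g)
  rw [det_ratMat, one_mul] at h1
  refine lt_of_le_of_ne h1 fun h0 => ?_
  have h2 : symAct (ratMat g) ∘ₗ symAct (ratMat g⁻¹) = LinearMap.id := by
    rw [← symAct_mul, ← ratMat_mul, mul_inv_cancel, ← symAct_one]
    congr 1
    rw [ratMat, Matrix.SpecialLinearGroup.coe_one, Matrix.map_one _ (map_zero _) (map_one _)]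
  have := congrArg LinearMap.det h2
  rw [LinearMap.det_comp, ← h0, zero_mul, LinearMap.det_id] at this
  exact zero_ne_one this

lemma sym_smul (g : SL4) (X : Ray) : sym (g • X) = symAct (ratMat g) (sym X) := by
  let Y : Matrix (Fin 4) (Fin 4) ℤ := X
  let YQ : Matrix (Fin 4) (Fin 4) ℚ := Y.map (Int.castRingHom ℚ)
  have h1 : ∀ Z : Matrix (Fin 4) (Fin 4) ℤ, sym (show Ray from Z) =
      symCrd (Z.map (Int.castRingHom ℚ) + (Z.map (Int.castRingHom ℚ))ᵀ) := fun Z => rfl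
  have h2 : sym (g • X) = sym (show Ray from (g.1 * Y * g.1ᵀ : Matrix (Fin 4) (Fin 4) ℤ)) := rfl
  have h3 : sym X = symCrd (YQ + YQᵀ) := h1 Y
  rw [h2, h1, h3, symAct_apply, symMat_symCrd (by
    rw [Matrix.transpose_add, Matrix.transpose_transpose, add_comm])]
  congr 1
  simp only [Matrix.map_mul, Matrix.transpose_map, ratMat, Matrix.transpose_mul,
    Matrix.transpose_transpose, Matrix.mul_add, Matrix.add_mul, Matrix.mul_assoc, YQ]

/-- The exterior algebra in which cells are oriented. -/
abbrev Ext := ExteriorAlgebra ℚ (Fin 10 → ℚ)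

/-- The vector of the exterior algebra attached to a ray. -/
def extRay : Ray →+ Ext := (ExteriorAlgebra.ι ℚ).toAddMonoidHom.comp sym

lemma extRay_sq (X : Ray) : extRay X * extRay X = 0 := ExteriorAlgebra.ι_sq_zero _

lemma extRay_comm (X Y : Ray) : extRay X * extRay Y = -(extRay Y * extRay X) :=
  eq_neg_of_add_eq_zero_left (ExteriorAlgebra.ι_add_mul_swap _ _)

/-- The determinant, as an alternating map in degree ten. -/
noncomputable def volAux (i : ℕ) : (Fin 10 → ℚ) [⋀^Fin i]→ₗ[ℚ] ℚ :=
  if h : i = 10 then h ▸ (Pi.basisFun ℚ (Fin 10)).det else 0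

lemma volAux_ten : volAux 10 = (Pi.basisFun ℚ (Fin 10)).det := dif_pos rfl

lemma volAux_of_ne {i : ℕ} (h : i ≠ 10) : volAux i = 0 := dif_neg h

/-- The volume form. -/
noncomputable def vol : Ext →ₗ[ℚ] ℚ := ExteriorAlgebra.liftAlternating volAux

lemma vol_ιMulti {i : ℕ} (v : Fin i → Fin 10 → ℚ) : vol (ExteriorAlgebra.ιMulti ℚ i v) = volAux i v :=
  ExteriorAlgebra.liftAlternating_apply_ιMulti _ v

lemma vol_map (f : (Fin 10 → ℚ) →ₗ[ℚ] (Fin 10 → ℚ)) (x : Ext) :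
    vol (ExteriorAlgebra.map f x) = LinearMap.det f * vol x := by
  have : vol ∘ₗ (ExteriorAlgebra.map f).toLinearMap = LinearMap.det f • vol := by
    refine ExteriorAlgebra.lhom_ext fun i => AlternatingMap.ext fun v => ?_
    simp only [LinearMap.compAlternatingMap_apply, LinearMap.comp_apply, AlgHom.toLinearMap_apply,
      ExteriorAlgebra.map_apply_ιMulti, LinearMap.smul_apply, vol_ιMulti]
    by_cases h : i = 10
    · subst h
      rw [volAux_ten, (Pi.basisFun ℚ (Fin 10)).det_comp f v, smul_eq_mul]
    · rw [volAux_of_ne h, AlternatingMap.zero_apply, AlternatingMap.zero_apply, smul_zero]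
  exact congrArg (fun F => F x) this

/-- The wedge of the rays of a finite set in increasing order. -/
noncomputable def wedge (S : Finset Ray) : Ext := ((S.sort (· ≤ ·)).map extRay).prod

lemma wedge_empty : wedge ∅ = 1 := by simp [wedge]

lemma wedge_insert_lt {a : Ray} {S : Finset Ray} (h : ∀ b ∈ S, a < b) :
    wedge (insert a S) = extRay a * wedge S := by
  rw [wedge, Finset.sort_insert _ (fun b hb => (h b hb).le) (fun ha => (h a ha).false),
    List.map_cons, List.prod_cons, wedge]

lemma wedge_insert {v : Ray} {S : Finset Ray} (hv : v ∉ S) :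
    wedge (insert v S) = insSign v S • (extRay v * wedge S) := by
  induction S using Finset.induction_on_min with
  | empty => rw [wedge_insert_lt (by simp), insSign, Finset.prod_empty, one_smul]
  | insert a S ha ih =>
    have haS : a ∉ S := fun h => (ha a h).false
    rw [Finset.mem_insert, not_or] at hv
    rcases lt_or_gt_of_ne hv.1 with hlt | hgt
    · rw [wedge_insert_lt (a := v)]
      · rw [insSign, Finset.prod_eq_one, one_smul]
        intro s hs
        rw [ordSign, if_neg]
        rcases Finset.mem_insert.mp hs with rfl | hs
        · exact hlt.not_gt
        · exact (hlt.trans (ha s hs)).not_gt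
      · intro b hb
        rcases Finset.mem_insert.mp hb with rfl | hb
        · exact hlt
        · exact hlt.trans (ha b hb)
    · rw [Finset.insert_comm, wedge_insert_lt (a := a), ih hv.2, wedge_insert_lt ha,
        insSign_insert haS, ordSign, if_pos hgt, neg_one_mul, Units.neg_smul, mul_smul_comm,
        ← mul_assoc, ← mul_assoc, extRay_comm a v, neg_mul, smul_neg]
      intro b hb
      rcases Finset.mem_insert.mp hb with rfl | hb
      · exact hgt
      · exact ha b hb

lemma extRay_mul_wedge {v : Ray} {S : Finset Ray} (hv : v ∈ S) : extRay v * wedge S = 0 := by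
  rw [← Finset.insert_erase hv, wedge_insert (Finset.notMem_erase v S), mul_smul_comm, ← mul_assoc,
    extRay_sq, zero_mul, smul_zero]

lemma map_extRay (g : SL4) (X : Ray) :
    ExteriorAlgebra.map (symAct (ratMat g)) (extRay X) = extRay (g • X) := by
  change ExteriorAlgebra.map _ (ExteriorAlgebra.ι ℚ (sym X)) = ExteriorAlgebra.ι ℚ (sym (g • X))
  rw [ExteriorAlgebra.map_apply_ι, sym_smul]

lemma wedge_smul (g : SL4) (S : Finset Ray) :
    wedge (g • S) = setSign g S • ExteriorAlgebra.map (symAct (ratMat g)) (wedge S) := by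
  induction S using Finset.induction_on with
  | empty => simp [wedge_empty]
  | insert v S hv ih =>
    have hv' : g • v ∉ g • S := by rwa [Finset.smul_mem_smul_finset_iff]
    have h2 := setSign_insert_mul g hv
    rw [smul_insert, wedge_insert hv', ih, wedge_insert hv, Units.smul_def, Units.smul_def,
      Units.smul_def, Units.smul_def, map_zsmul,
      map_mul, map_extRay, mul_smul_comm, smul_smul, smul_smul]
    congr 1
    rw [← Units.val_mul, ← Units.val_mul, h2]

/-- The functional measuring the position of a form relative to the span of a cell. -/
noncomputable def side (S : Finset Ray) : Ray →+ ℚ :=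
  (vol.toAddMonoidHom.comp (AddMonoidHom.mulRight (wedge S))).comp extRay

lemma side_apply (S : Finset Ray) (X : Ray) : side S X = vol (extRay X * wedge S) := rfl

lemma side_of_mem {S : Finset Ray} {X : Ray} (h : X ∈ S) : side S X = 0 := by
  rw [side_apply, extRay_mul_wedge h, map_zero]

lemma side_smul (g : SL4) (S : Finset Ray) (X : Ray) :
    side (g • S) (g • X) = (setSign g S : ℤ) * LinearMap.det (symAct (ratMat g)) * side S X := by
  rw [side_apply, side_apply, wedge_smul, Units.smul_def, mul_smul_comm, map_zsmul, ← map_extRay,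
    ← map_mul, vol_map, zsmul_eq_mul, mul_assoc]

lemma side_insert {v : Ray} {S : Finset Ray} (hv : v ∉ S) (X : Ray) :
    side (insert v S) X = (insSign v S : ℤ) * vol (extRay X * extRay v * wedge S) := by
  rw [side_apply, wedge_insert hv, Units.smul_def, mul_smul_comm, map_zsmul, zsmul_eq_mul, mul_assoc]

/-- The sign of a vertex relative to an edge. -/
noncomputable def orient (S M : Finset Ray) : ℤ := SignType.sign (side S (∑ X ∈ M, X))

lemma orient_smul (g : SL4) (S M : Finset Ray) :
    orient (g • S) (g • M) = setSign g S * orient S M := by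
  have h : ∑ X ∈ g • M, X = g • ∑ X ∈ M, X := by
    rw [sum_smul_finset g M fun X => X, Finset.smul_sum]
  rw [orient, orient, h, side_smul, sign_mul, sign_mul, sign_pos (det_symAct_pos g), mul_one]
  rcases Int.units_eq_one_or (setSign g S) with e | e <;> simp [e]

lemma VertexData.sum_eq_nsmul {M : Finset Ray} (D : VertexData M) : ∑ X ∈ M, X = D.n • D.z := by
  rw [D.sum_eq, Finset.sum_congr rfl fun i hi =>
    (show ∑ X ∈ D.frame i, X = D.z from D.sum_frame i (Finset.mem_range.mp hi)),
    Finset.sum_const, Finset.card_range]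

lemma orient_eq {S M : Finset Ray} (D : VertexData M) : orient S M = SignType.sign (side S D.z) := by
  rw [orient, D.sum_eq_nsmul, map_nsmul, nsmul_eq_mul, sign_mul,
    sign_pos (Nat.cast_pos.mpr D.n_pos), one_mul]

lemma exists_ofFn {α : Type*} (l : List α) {n : ℕ} (h : l.length = n) :
    ∃ w : Fin n → α, l = List.ofFn w := by
  subst h
  exact ⟨l.get, (List.ofFn_get l).symm⟩

/-- A standard integral vector. -/
def stdVec (i : Fin 4) : Fin 4 → ℤ := fun j => if j = i then 1 else 0

lemma polarization : ∀ k l : Fin 10,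
    (stdVec (symRow k) + stdVec (symCol k)) (symRow l) * (stdVec (symRow k) + stdVec (symCol k)) (symCol l)
      - stdVec (symRow k) (symRow l) * stdVec (symRow k) (symCol l)
      - stdVec (symCol k) (symRow l) * stdVec (symCol k) (symCol l) =
    if l = k then (if symRow k = symCol k then 2 else 1) else 0 := by
  decide +kernel

lemma sym_ray (v : Fin 4 → ℤ) (k : Fin 10) : sym (ray v) k = 2 * (v (symRow k) * v (symCol k) : ℤ) := by
  change ((ray v (symRow k) (symCol k) : ℤ) : ℚ) + ((ray v (symCol k) (symRow k) : ℤ) : ℚ) = _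
  rw [ray_apply, ray_apply]
  push_cast
  ring

lemma span_rays {W : Submodule ℚ (Fin 10 → ℚ)} (h : ∀ v, sym (ray v) ∈ W) : W = ⊤ := by
  have h1 : ∀ k, (fun l => if l = k then (1 : ℚ) else 0) ∈ W := fun k => by
    have h2 : (fun l => if l = k then (1 : ℚ) else 0) =
        (if symRow k = symCol k then (1 / 4 : ℚ) else 1 / 2) •
        (sym (ray (stdVec (symRow k) + stdVec (symCol k))) -
        sym (ray (stdVec (symRow k))) - sym (ray (stdVec (symCol k)))) := by
      ext l
      have h3 := congrArg (Int.cast : ℤ → ℚ) (polarization k l)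
      rw [Pi.smul_apply, Pi.sub_apply, Pi.sub_apply, sym_ray, sym_ray, sym_ray, ← mul_sub, ← mul_sub,
        ← Int.cast_sub, ← Int.cast_sub, h3, smul_eq_mul]
      split_ifs <;> norm_num
    rw [h2]
    have a := h (stdVec (symRow k) + stdVec (symCol k))
    have b := h (stdVec (symRow k))
    have c := h (stdVec (symCol k))
    exact Submodule.smul_mem W _ (Submodule.sub_mem W (Submodule.sub_mem W a b) c)
  refine eq_top_iff.mpr fun y _ => ?_
  have : y = ∑ k, y k • (fun l => if l = k then (1 : ℚ) else 0) := by
    ext l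
    simp [Finset.sum_apply]
  rw [this]
  exact Submodule.sum_mem W fun k _ => Submodule.smul_mem W _ (h1 k)

namespace VertexData

variable {M : Finset Ray} (D : VertexData M)

lemma sum_card_frame_sdiff (S : Finset Ray) :
    ∑ i ∈ Finset.range D.n, (D.frame i \ S).card = (M \ S).card := by
  rw [Finset.card_eq_sum_card_fiberwise (t := Finset.range D.n) (f := D.lab) fun X hX => by
        rw [Finset.mem_coe, Finset.mem_range]
        exact D.lab_lt X (Finset.mem_sdiff.mp hX).1]
  refine Finset.sum_congr rfl fun i _ => congrArg _ ?_
  ext X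
  simp only [Finset.mem_sdiff, D.mem_frame, Finset.mem_filter]
  tauto

lemma map_z_sdiff {β : Type*} [AddCommGroup β] (f : Ray →+ β) {S : Finset Ray}
    (hf : ∀ Y ∈ S, f Y = 0) {i : ℕ} (hi : i < D.n) : f D.z = ∑ Y ∈ D.frame i \ S, f Y := by
  have h : ∑ Y ∈ D.frame i, Y = D.z := D.sum_frame i hi
  rw [← h, map_sum]
  refine (Finset.sum_subset Finset.sdiff_subset fun Y hY hY' => hf Y ?_).symm
  by_contra h
  exact hY' (Finset.mem_sdiff.mpr ⟨hY, h⟩)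

lemma side_z_ne_zero {S : Finset Ray} (hS : S ⊆ M) (hn : NoFrame D S) (hc : S.card = 9) :
    side S D.z ≠ 0 := by
  obtain ⟨w, hw⟩ := exists_ofFn (S.sort (· ≤ ·)) (n := 9) (by rw [Finset.length_sort, hc])
  have hwS : ∀ X ∈ S, ∃ i, w i = X := fun X hX => by
    rw [← Finset.mem_sort (· ≤ ·), hw, List.mem_ofFn] at hX
    exact hX
  let v : Fin 10 → Fin 10 → ℚ := Fin.cons (sym D.z) fun i => sym (w i)
  have h1 : extRay D.z * wedge S = ExteriorAlgebra.ιMulti ℚ 10 v := by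
    rw [ExteriorAlgebra.ιMulti_apply, List.ofFn_succ, List.prod_cons, wedge, hw, List.map_ofFn]
    rfl
  have hz : sym D.z ∈ Submodule.span ℚ (Set.range v) := Submodule.subset_span ⟨0, rfl⟩
  have hX : ∀ X ∈ S, sym X ∈ Submodule.span ℚ (Set.range v) := fun X hX => by
    obtain ⟨i, rfl⟩ := hwS X hX
    exact Submodule.subset_span ⟨i.succ, rfl⟩
  have hM : ∀ X ∈ M, sym X ∈ Submodule.span ℚ (Set.range v) := fun X hXM => by
    by_cases hXS : X ∈ S
    · exact hX X hXS
    · let f := (Submodule.mkQ (Submodule.span ℚ (Set.range v))).toAddMonoidHom.comp sym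
      have hf : ∀ Y, f Y = 0 ↔ sym Y ∈ Submodule.span ℚ (Set.range v) := fun Y =>
        Submodule.Quotient.mk_eq_zero _
      have h2 := D.map_z_sdiff f (fun Y hY => (hf Y).mpr (hX Y hY)) (D.lab_lt X hXM)
      obtain ⟨Y, hY⟩ := Finset.card_eq_one.mp (D.card_frame_sdiff hS hn hc (D.lab_lt X hXM))
      have h3 := Finset.mem_sdiff.mpr ⟨D.mem_frame.mpr ⟨hXM, rfl⟩, hXS⟩
      rw [hY, Finset.mem_singleton] at h3
      rw [hY, Finset.sum_singleton, (hf _).mpr hz, ← h3] at h2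
      exact (hf X).mp h2.symm
  have htop : Submodule.span ℚ (Set.range v) = ⊤ := span_rays fun x => by
    obtain ⟨a, ha⟩ := D.span x
    rw [ha, map_sum]
    refine Submodule.sum_mem _ fun Y hY => ?_
    rw [map_zsmul]
    exact zsmul_mem (hM Y hY) _
  have hli : LinearIndependent ℚ v :=
    linearIndependent_of_top_le_span_of_card_eq_finrank htop.ge (by simp)
  have := ((Pi.basisFun ℚ (Fin 10)).is_basis_iff_det).mp ⟨hli, htop⟩
  rw [side_apply, h1, vol_ιMulti, volAux_ten]
  exact this.ne_zero

end VertexData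

lemma orient_ne_zero {S M : Finset Ray} (hM : IsVert M) (hS : S ⊆ M) (hn : NoFrame hM.data S)
    (hc : S.card = 9) : orient S M ≠ 0 := by
  rw [orient_eq hM.data]
  have := hM.data.side_z_ne_zero hS hn hc
  rcases lt_or_gt_of_ne this with h | h
  · rw [sign_neg h]; decide
  · rw [sign_pos h]; decide

/-- On an edge, functionals vanishing on the edge are proportional. -/
lemma map_proportional {S M : Finset Ray} (hM : IsVert M) (hS : S ⊆ M) (hn : NoFrame hM.data S)
    (hc : S.card = 9) (f g : Ray →+ ℚ) (hf : ∀ Y ∈ S, f Y = 0) (hg : ∀ Y ∈ S, g Y = 0)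
    (v : Fin 4 → ℤ) : f (ray v) * g hM.data.z = g (ray v) * f hM.data.z := by
  have key : ∀ Y ∈ M, f Y * g hM.data.z = g Y * f hM.data.z := fun Y hY => by
    by_cases hYS : Y ∈ S
    · rw [hf Y hYS, hg Y hYS, zero_mul, zero_mul]
    · obtain ⟨Z, hZ⟩ := Finset.card_eq_one.mp
        (hM.data.card_frame_sdiff hS hn hc (hM.data.lab_lt Y hY))
      have h3 := Finset.mem_sdiff.mpr ⟨hM.data.mem_frame.mpr ⟨hY, rfl⟩, hYS⟩
      rw [hZ, Finset.mem_singleton] at h3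
      rw [hM.data.map_z_sdiff f hf (hM.data.lab_lt Y hY),
        hM.data.map_z_sdiff g hg (hM.data.lab_lt Y hY), hZ, Finset.sum_singleton,
        Finset.sum_singleton, h3, mul_comm]
  obtain ⟨a, ha⟩ := hM.data.span v
  rw [ha, map_sum, map_sum, Finset.sum_mul, Finset.sum_mul]
  refine Finset.sum_congr rfl fun Y hY => ?_
  rw [map_zsmul, map_zsmul, smul_mul_assoc, smul_mul_assoc, key Y hY]

/-- Extension of scalars of a functional. -/
def toRat (X : Ray →+ ℤ) : Ray →+ ℚ := (Int.castAddHom ℚ).comp X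

lemma toRat_apply (X : Ray →+ ℤ) (Y : Ray) : toRat X Y = X Y := rfl

/-- The two ends of an edge have opposite signs. -/
lemma orient_add_orient {S M N : Finset Ray} (hM : IsVert M) (hN : IsVert N) (hSM : S ⊆ M)
    (hSN : S ⊆ N) (hn : NoFrame hM.data S) (hc : S.card = 9) (hne : N ≠ M) :
    orient S M + orient S N = 0 := by
  rw [orient_eq hM.data, orient_eq hN.data]
  have h0 := hM.data.side_z_ne_zero hSM hn hc
  have h1 : (0 : ℚ) < hM.data.diff hN.data hM.data.z := by
    exact_mod_cast hM.data.diff_z_pos hN.data hne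
  have h2 : (hM.data.diff hN.data hN.data.z : ℚ) < 0 := by
    have := hN.data.diff_z_pos hM.data hne.symm
    rw [VertexData.diff_apply] at this ⊢
    exact_mod_cast (by omega : hN.data.form hN.data.z - hM.data.form hN.data.z < 0)
  have key : ∀ Y ∈ N, side S Y * hM.data.diff hN.data hM.data.z =
      hM.data.diff hN.data Y * side S hM.data.z := fun Y hY => by
    obtain ⟨v, -, rfl⟩ := hN.data.isRay Y hY
    exact map_proportional hM hSM hn hc (side S) (toRat (hM.data.diff hN.data))
      (fun Y hY => side_of_mem hY) (fun Y hY => by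
        rw [toRat_apply, hM.data.diff_eq_zero _ (hSM hY) (hSN hY), Int.cast_zero]) v
  have h3 : side S hN.data.z * hM.data.diff hN.data hM.data.z =
      hM.data.diff hN.data hN.data.z * side S hM.data.z := by
    have h4 := hN.data.sum_frame 0 hN.data.n_pos
    rw [← h4, map_sum, map_sum, Finset.sum_mul, Int.cast_sum, Finset.sum_mul]
    exact Finset.sum_congr rfl fun Y hY => key Y (Finset.mem_filter.mp hY).1
  rcases lt_or_gt_of_ne h0 with h | h
  · have : 0 < side S hN.data.z := by
      by_contra! hc
      nlinarith [mul_nonneg (neg_nonneg.mpr hc) h1.le, mul_pos_of_neg_of_neg h2 h]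
    rw [sign_neg h, sign_pos this]; decide
  · have : side S hN.data.z < 0 := by
      by_contra! hc
      nlinarith [mul_nonneg hc h1.le, mul_neg_of_neg_of_pos h2 h]
    rw [sign_pos h, sign_neg this]; decide

/-- An edge has only two ends. -/
lemma ends_unique {S M N N' : Finset Ray} (hM : IsVert M) (hN : IsVert N) (hN' : IsVert N')
    (hSM : S ⊆ M) (hSN : S ⊆ N) (hSN' : S ⊆ N') (hn : NoFrame hM.data S) (hc : S.card = 9)
    (hne : N ≠ M) (hne' : N' ≠ M) : N = N' := by
  have key : ∀ v, toRat (hM.data.diff hN.data) (ray v) * toRat (hM.data.diff hN'.data) hM.data.z =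
      toRat (hM.data.diff hN'.data) (ray v) * toRat (hM.data.diff hN.data) hM.data.z :=
    map_proportional hM hSM hn hc (toRat (hM.data.diff hN.data)) (toRat (hM.data.diff hN'.data))
      (fun Y hY => by rw [toRat_apply, hM.data.diff_eq_zero _ (hSM hY) (hSN hY), Int.cast_zero])
      (fun Y hY => by rw [toRat_apply, hM.data.diff_eq_zero _ (hSM hY) (hSN' hY), Int.cast_zero])
  simp only [toRat_apply] at key
  have key' : ∀ v, hM.data.diff hN.data (ray v) * hM.data.diff hN'.data hM.data.z =
      hM.data.diff hN'.data (ray v) * hM.data.diff hN.data hM.data.z := fun v => by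
    exact_mod_cast key v
  have h1 := hM.data.diff_z_pos hN.data hne
  have h1' := hM.data.diff_z_pos hN'.data hne'
  have main : ∀ {A B : Finset Ray} (hA : IsVert A) (hB : IsVert B), A ≠ M →
      0 < hM.data.diff hA.data hM.data.z →
      (∀ v, hM.data.diff hA.data (ray v) * hM.data.diff hB.data hM.data.z =
        hM.data.diff hB.data (ray v) * hM.data.diff hA.data hM.data.z) →
      hM.data.diff hB.data hM.data.z ≤ hM.data.diff hA.data hM.data.z := by
    intro A B hA hB hne h1 key
    obtain ⟨Y, hY, hY0⟩ : ∃ Y ∈ A, hM.data.diff hA.data Y < 0 := by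
      by_contra! h
      have := hA.data.diff_z_pos hM.data hne.symm
      rw [VertexData.diff_apply, hA.data.map_z hA.data.n_pos, hA.data.map_z hA.data.n_pos,
        ← Finset.sum_sub_distrib] at this
      refine this.not_ge (Finset.sum_nonpos fun Y hY => ?_)
      have := h Y (hA.data.mem_frame.mp hY).1
      rw [VertexData.diff_apply] at this
      omega
    obtain ⟨v, hv, rfl⟩ := hA.data.isRay Y hY
    have h2 := key v
    have h3 := hB.data.one_le_form v hv
    have h4 := hA.data.form_eq_one _ hY
    have h5 : hM.data.diff hA.data (ray v) ≤ hM.data.diff hB.data (ray v) := by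
      rw [VertexData.diff_apply, VertexData.diff_apply]; omega
    nlinarith [mul_le_mul_of_nonneg_right h5 h1.le]
  have e : hM.data.diff hN.data hM.data.z = hM.data.diff hN'.data hM.data.z :=
    le_antisymm (main hN' hN hne' h1' fun v => (key' v).symm) (main hN hN' hne h1 key')
  refine hN.data.eq_of_form hN'.data fun v => ?_
  have := key' v
  rw [e] at this
  have := mul_right_cancel₀ h1'.ne' this
  rw [VertexData.diff_apply, VertexData.diff_apply] at this
  omega

/-- The incidence numbers of cells. -/
noncomputable def inc (k : ℕ) (S T : Finset Ray) : ℤ :=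
  if S ⊆ T then (if k = 0 then orient S T else ∑ v ∈ T \ S, (insSign v S : ℤ)) else 0

lemma inc_of_not_subset {k : ℕ} {S T : Finset Ray} (h : ¬S ⊆ T) : inc k S T = 0 := if_neg h

lemma inc_zero {S T : Finset Ray} (h : S ⊆ T) : inc 0 S T = orient S T := by
  rw [inc, if_pos h, if_pos rfl]

lemma inc_insert {k : ℕ} {v : Ray} {S : Finset Ray} (hv : v ∉ S) :
    inc (k + 1) S (insert v S) = insSign v S := by
  rw [inc, if_pos (Finset.subset_insert _ _), if_neg k.succ_ne_zero, Finset.insert_sdiff_cancel hv,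
    Finset.sum_singleton]

/-- The sign by which a group element changes the orientation of a cell. -/
noncomputable def cellSign (k : ℕ) (g : SL4) (S : Finset Ray) : ℤˣ := if k = 0 then 1 else setSign g S

lemma cellSign_zero (g : SL4) (S : Finset Ray) : cellSign 0 g S = 1 := if_pos rfl

lemma cellSign_succ (k : ℕ) (g : SL4) (S : Finset Ray) : cellSign (k + 1) g S = setSign g S :=
  if_neg k.succ_ne_zero

lemma cellSign_mul (k : ℕ) (g h : SL4) (S : Finset Ray) :
    cellSign k (g * h) S = cellSign k g (h • S) * cellSign k h S := by
  unfold cellSign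
  split_ifs
  · rfl
  · exact setSign_mul g h S

lemma cellSign_one (k : ℕ) (S : Finset Ray) : cellSign k 1 S = 1 := by
  unfold cellSign
  split_ifs
  · rfl
  · exact setSign_one S

lemma IsKCell.exists_insert {k : ℕ} {S T : Finset Ray} (hS : IsKCell (k + 2) S)
    (hT : IsKCell (k + 1) T) (h : S ⊆ T) : ∃ v ∉ S, T = insert v S := by
  have h1 := (isKCell_succ.mp hS).2
  have h2 := (isKCell_succ.mp hT).2
  have h3 : (T \ S).card = 1 := by
    rw [Finset.card_sdiff_of_subset h]; omega
  obtain ⟨v, hv⟩ := Finset.card_eq_one.mp h3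
  refine ⟨v, (Finset.mem_sdiff.mp (hv ▸ Finset.mem_singleton_self v)).2, ?_⟩
  rw [← Finset.sdiff_union_of_subset h, hv]; rfl

lemma inc_smul {k : ℕ} {S T : Finset Ray} (hS : IsKCell (k + 1) S) (hT : IsKCell k T) (g : SL4) :
    inc k (g • S) (g • T) * cellSign k g T = cellSign (k + 1) g S * inc k S T := by
  by_cases h : S ⊆ T
  · cases k with
    | zero =>
      rw [inc_zero h, inc_zero (Finset.smul_finset_subset_smul_finset_iff.mpr h), cellSign_zero,
        cellSign_succ, orient_smul, Units.val_one, mul_one]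
    | succ k =>
      obtain ⟨v, hv, rfl⟩ := hS.exists_insert hT h
      have hv' : g • v ∉ g • S := by rwa [Finset.smul_mem_smul_finset_iff]
      have h2 := setSign_insert_mul g hv
      have h3 : ∀ a b c d : ℤˣ, a * b = c * d → c * a = d * b := by decide
      rw [smul_insert, inc_insert hv', inc_insert hv, cellSign_succ, cellSign_succ,
        ← Units.val_mul, ← Units.val_mul, h3 _ _ _ _ h2]
  · rw [inc_of_not_subset h, inc_of_not_subset fun h' => h
      (Finset.smul_finset_subset_smul_finset_iff.mp h'), zero_mul, mul_zero]

lemma VertexData.two_missing {M S : Finset Ray} (D : VertexData M) (hS : S ⊆ M) (hn : NoFrame D S)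
    (hc : S.card = 8) : ∃ i < D.n, ∃ a b, a ≠ b ∧ D.frame i \ S = {a, b} ∧
      ∀ j < D.n, j ≠ i → (D.frame j \ S).card = 1 := by
  have h0 : ∑ i ∈ Finset.range D.n, (D.frame i \ S).card = D.n + 1 := by
    rw [D.sum_card_frame_sdiff, Finset.card_sdiff_of_subset hS, D.card_eq, hc]; omega
  have h1 : ∀ i ∈ Finset.range D.n, 1 ≤ (D.frame i \ S).card := fun i hi => by
    obtain ⟨Y, h1, h2⟩ := hn i (Finset.mem_range.mp hi)
    exact Finset.card_pos.mpr ⟨Y, Finset.mem_sdiff.mpr ⟨h1, h2⟩⟩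
  have hex : ∃ i ∈ Finset.range D.n, 1 < (D.frame i \ S).card := by
    by_contra! h
    have := Finset.sum_le_sum h
    rw [h0, Finset.sum_const, Finset.card_range, smul_eq_mul, mul_one] at this
    omega
  obtain ⟨i, hi, hlt⟩ := hex
  have h2 := Finset.add_sum_erase _ (fun i => (D.frame i \ S).card) hi
  have h3 : ∀ j ∈ (Finset.range D.n).erase i, 1 ≤ (D.frame j \ S).card := fun j hj =>
    h1 j (Finset.mem_of_mem_erase hj)
  have h4 : ((Finset.range D.n).erase i).card + 1 = D.n := by
    rw [Finset.card_erase_add_one hi, Finset.card_range]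
  have h5 := Finset.sum_le_sum h3
  rw [Finset.sum_const, smul_eq_mul, mul_one] at h5
  have h2' : (D.frame i \ S).card + ∑ x ∈ (Finset.range D.n).erase i, (D.frame x \ S).card = D.n + 1 :=
    h2.trans h0
  have hcard : (D.frame i \ S).card = 2 := by omega
  obtain ⟨a, b, hab, e⟩ := Finset.card_eq_two.mp hcard
  refine ⟨i, Finset.mem_range.mp hi, a, b, hab, e, fun j hj hji => ?_⟩
  have hj' : j ∈ (Finset.range D.n).erase i := Finset.mem_erase.mpr ⟨hji, Finset.mem_range.mpr hj⟩
  have h6 := Finset.add_sum_erase _ (fun i => (D.frame i \ S).card) hj'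
  have h7 := Finset.sum_le_sum fun x hx => h3 x (Finset.mem_of_mem_erase (a := j) hx)
  rw [Finset.sum_const, smul_eq_mul, mul_one] at h7
  have h8 := Finset.card_erase_add_one hj'
  have h9 := h3 j hj'
  have h6' : (D.frame j \ S).card + ∑ x ∈ ((Finset.range D.n).erase i).erase j, (D.frame x \ S).card =
    ∑ x ∈ (Finset.range D.n).erase i, (D.frame x \ S).card := h6
  omega

lemma sign_add_sign {x y : ℚ} (h : x + y = 0) : (SignType.sign x : ℤ) + SignType.sign y = 0 := by
  rw [eq_neg_of_add_eq_zero_right h, Left.sign_neg]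
  cases SignType.sign x <;> rfl

/-- Between two cells of codimension two there are exactly two cells. -/
lemma two_step {k : ℕ} {S U : Finset Ray} (hS : IsKCell (k + 2) S) (hU : IsKCell k U) (h : S ⊆ U) :
    ∃ T T', T ≠ T' ∧ IsKCell (k + 1) T ∧ IsKCell (k + 1) T' ∧
      (∀ R, IsKCell (k + 1) R → S ⊆ R → R ⊆ U → R = T ∨ R = T') ∧
      inc (k + 1) S T * inc k T U + inc (k + 1) S T' * inc k T' U = 0 := by
  obtain ⟨hc, hcard⟩ := isKCell_succ.mp hS
  suffices H : ∃ a b, a ≠ b ∧ a ∉ S ∧ b ∉ S ∧ a ∈ U ∧ b ∈ U ∧ (Vset (insert a S)).Nontrivial ∧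
      (Vset (insert b S)).Nontrivial ∧ (∀ v ∉ S, v ∈ U → (Vset (insert v S)).Nontrivial → v = a ∨ v = b) ∧
      insSign a S * inc k (insert a S) U + insSign b S * inc k (insert b S) U = 0 by
    obtain ⟨a, b, hab, ha, hb, haU, hbU, ha', hb', huniq, hsum⟩ := H
    have hcell : ∀ v ∉ S, (Vset (insert v S)).Nontrivial → IsKCell (k + 1) (insert v S) :=
      fun v hv h' => isKCell_succ.mpr ⟨hc.of_subset (Finset.subset_insert _ _) subset_rfl h', by
        rw [Finset.card_insert_of_notMem hv]; omega⟩
    refine ⟨insert a S, insert b S, fun e => ?_, hcell a ha ha', hcell b hb hb', ?_, ?_⟩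
    · have := e ▸ Finset.mem_insert_self a S
      rcases Finset.mem_insert.mp this with h | h
      · exact hab h
      · exact ha h
    · intro R hR hSR hRU
      obtain ⟨v, hv, rfl⟩ := hS.exists_insert hR hSR
      rcases huniq v hv (hRU (Finset.mem_insert_self _ _)) (isKCell_succ.mp hR).1.nontrivial with rfl | rfl
      · exact Or.inl rfl
      · exact Or.inr rfl
    · rwa [inc_insert ha, inc_insert hb]
  cases k with
  | zero =>
    have hM := isKCell_zero.mp hU
    set D := hM.data with hD
    have hn := noFrame_of_nontrivial D hc.nontrivial
    obtain ⟨i, hi, a, b, hab, e, hone⟩ := D.two_missing h hn (by omega)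
    have ha : a ∈ D.frame i \ S := by rw [e]; simp
    have hb : b ∈ D.frame i \ S := by rw [e]; simp
    obtain ⟨haF, haS⟩ := Finset.mem_sdiff.mp ha
    obtain ⟨hbF, hbS⟩ := Finset.mem_sdiff.mp hb
    have haU := (D.mem_frame.mp haF).1
    have hbU := (D.mem_frame.mp hbF).1
    have hnt : ∀ x y, x ≠ y → x ∈ D.frame i → y ∈ D.frame i → y ∉ S →
        (Vset (insert x S)).Nontrivial := fun x y hxy hx hy hyS => by
      refine NoFrame.nontrivial hM (Finset.insert_subset (D.mem_frame.mp hx).1 h) fun j hj => ?_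
      by_cases hji : j = i
      · subst hji
        exact ⟨y, hy, fun h' => (Finset.mem_insert.mp h').elim (fun e => hxy e.symm) hyS⟩
      · obtain ⟨Y, h1, h2⟩ := hn j hj
        refine ⟨Y, h1, fun h' => (Finset.mem_insert.mp h').elim (fun e => hji ?_) h2⟩
        rw [← (D.mem_frame.mp h1).2, e, (D.mem_frame.mp hx).2]
    refine ⟨a, b, hab, haS, hbS, haU, hbU, hnt a b hab haF hbF hbS, hnt b a hab.symm hbF haF haS,
      fun v hv hvU hvn => ?_, ?_⟩
    · have hvl := D.lab_lt v hvU
      by_cases hvi : D.lab v = i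
      · have : v ∈ D.frame i \ S := Finset.mem_sdiff.mpr ⟨D.mem_frame.mpr ⟨hvU, hvi⟩, hv⟩
        rw [e] at this
        simpa using this
      · exfalso
        obtain ⟨Y, hY⟩ := Finset.card_eq_one.mp (hone _ hvl hvi)
        have h1 : v ∈ D.frame (D.lab v) \ S :=
          Finset.mem_sdiff.mpr ⟨D.mem_frame.mpr ⟨hvU, rfl⟩, hv⟩
        obtain ⟨Z, hZ1, hZ2⟩ := noFrame_of_nontrivial D hvn _ hvl
        have h2 : Z ∈ D.frame (D.lab v) \ S :=
          Finset.mem_sdiff.mpr ⟨hZ1, fun h' => hZ2 (Finset.mem_insert_of_mem h')⟩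
        rw [hY, Finset.mem_singleton] at h1 h2
        exact hZ2 (Finset.mem_insert.mpr (Or.inl (h2.trans h1.symm)))
    · have hx : ∀ x ∉ S, x ∈ U → (insSign x S : ℤ) * inc 0 (insert x S) U =
          SignType.sign (vol (extRay D.z * extRay x * wedge S)) := fun x hx hxU => by
        rw [inc_zero (Finset.insert_subset hxU h), orient_eq D, side_insert hx, sign_mul]
        rcases Int.units_eq_one_or (insSign x S) with e | e <;> simp [e]
      rw [hx a haS haU, hx b hbS hbU]
      refine sign_add_sign ?_
      have hz : extRay a * wedge S + extRay b * wedge S = extRay D.z * wedge S := by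
        let f : Ray →+ Ext := (AddMonoidHom.mulRight (wedge S)).comp extRay
        have := D.map_z_sdiff f (S := S) (fun Y hY => extRay_mul_wedge hY) hi
        rw [e, Finset.sum_pair hab] at this
        exact this.symm
      rw [← map_add, mul_assoc, mul_assoc, ← mul_add, hz, ← mul_assoc, extRay_sq, zero_mul, map_zero]
  | succ k =>
    obtain ⟨hcU, hcardU⟩ := isKCell_succ.mp hU
    have h3 : (U \ S).card = 2 := by
      rw [Finset.card_sdiff_of_subset h]; omega
    obtain ⟨a, b, hab, e⟩ := Finset.card_eq_two.mp h3
    have ha : a ∈ U \ S := by rw [e]; simp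
    have hb : b ∈ U \ S := by rw [e]; simp
    obtain ⟨haU, haS⟩ := Finset.mem_sdiff.mp ha
    obtain ⟨hbU, hbS⟩ := Finset.mem_sdiff.mp hb
    have hU1 : U = insert b (insert a S) := by
      rw [← Finset.sdiff_union_of_subset h, e, Finset.insert_comm, Finset.insert_union,
        Finset.singleton_union]
    have hU2 : U = insert a (insert b S) := by rw [hU1, Finset.insert_comm]
    refine ⟨a, b, hab, haS, hbS, haU, hbU,
      hcU.nontrivial.mono (Vset_anti (Finset.insert_subset haU h)),
      hcU.nontrivial.mono (Vset_anti (Finset.insert_subset hbU h)), fun v hv hvU _ => ?_, ?_⟩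
    · have : v ∈ U \ S := Finset.mem_sdiff.mpr ⟨hvU, hv⟩
      rw [e] at this
      simpa using this
    · have h1 : inc (k + 1) (insert a S) U = insSign b (insert a S) := by
        rw [hU1, inc_insert]
        simp [hab.symm, hbS]
      have h2 : inc (k + 1) (insert b S) U = insSign a (insert b S) := by
        rw [hU2, inc_insert]
        simp [hab, haS]
      have h4 := congrArg (Units.val) (insSign_anti hab haS hbS)
      rw [h1, h2, mul_comm, mul_comm (insSign b S : ℤ)]
      push_cast at h4
      linarith

section Morse

variable {R I J K W : Type*} [Field R] [LinearOrder W] [WellFoundedLT W]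

/-- Exactness of a complex of based vector spaces with an acyclic matching. -/
lemma exact_of_matching (c : K → I →₀ R) (b : I → J →₀ R) (down : I → Prop) (rank : I → W)
    (hdown : ∀ i, down i → ∃ k, c k i ≠ 0 ∧ ∀ i', down i' → i' ≠ i → c k i' ≠ 0 → rank i' < rank i)
    (hup : ∀ u, ¬down u → ∃ j, b u j ≠ 0 ∧ ∀ u', ¬down u' → u' ≠ u → b u' j ≠ 0 → rank u < rank u')
    (hbc : ∀ k, Finsupp.linearCombination R b (c k) = 0) (x : I →₀ R)
    (hx : Finsupp.linearCombination R b x = 0) :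
    x ∈ LinearMap.range (Finsupp.linearCombination R c) := by
  classical
  set V := LinearMap.range (Finsupp.linearCombination R c) ⊔ Finsupp.supported R R {i | ¬down i}
    with hV
  have h1 : ∀ w i, rank i = w → Finsupp.single i (1 : R) ∈ V := by
    intro w
    induction w using WellFoundedLT.induction with
    | ind w ih =>
      intro i hi
      by_cases hd : down i
      · obtain ⟨k, hk, hk'⟩ := hdown i hd
        have h2 : c k ∈ V := Submodule.mem_sup_left ⟨Finsupp.single k 1, by simp⟩
        have h3 : c k - Finsupp.single i (c k i) ∈ V := by
          rw [← Finsupp.erase_eq_sub_single, ← Finsupp.sum_single (Finsupp.erase i (c k))]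
          refine Submodule.sum_mem _ fun i' hi' => ?_
          rw [Finsupp.support_erase, Finset.mem_erase, Finsupp.mem_support_iff] at hi'
          rw [← mul_one (Finsupp.erase i (c k) i'), ← smul_eq_mul, ← Finsupp.smul_single]
          refine Submodule.smul_mem _ _ ?_
          by_cases hd' : down i'
          · exact ih _ (hi ▸ hk' i' hd' hi'.1 hi'.2) i' rfl
          · exact Submodule.mem_sup_right (Finsupp.single_mem_supported R 1 hd')
        have h4 := Submodule.sub_mem _ h2 h3
        rw [sub_sub_cancel] at h4
        have h5 := Submodule.smul_mem _ (c k i)⁻¹ h4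
        rwa [Finsupp.smul_single, smul_eq_mul, inv_mul_cancel₀ hk] at h5
      · exact Submodule.mem_sup_right (Finsupp.single_mem_supported R 1 hd)
  have h2 : x ∈ V := by
    rw [← Finsupp.sum_single x]
    refine Submodule.sum_mem _ fun i _ => ?_
    rw [← mul_one (x i), ← smul_eq_mul, ← Finsupp.smul_single]
    exact Submodule.smul_mem _ _ (h1 _ i rfl)
  obtain ⟨y, ⟨z, rfl⟩, u, hu, rfl⟩ := Submodule.mem_sup.mp h2
  have h3 : ∀ z, Finsupp.linearCombination R b (Finsupp.linearCombination R c z) = 0 := fun z => by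
    rw [Finsupp.linearCombination_apply R (v := c), map_finsuppSum]
    refine Finset.sum_eq_zero fun k _ => ?_
    change Finsupp.linearCombination R b (z k • c k) = 0
    rw [map_smul, hbc, smul_zero]
  rw [map_add, h3, zero_add] at hx
  suffices u = 0 by rw [this, add_zero]; exact ⟨z, rfl⟩
  by_contra hne
  obtain ⟨i, hi, hmax⟩ := Finset.exists_max_image u.support rank (Finsupp.support_nonempty_iff.mpr hne)
  have hu' : ∀ i ∈ u.support, ¬down i := fun i hi => (Finsupp.mem_supported R u).mp hu hi
  obtain ⟨j, hj, hj'⟩ := hup i (hu' i hi)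
  have h4 := DFunLike.congr_fun hx j
  rw [Finsupp.linearCombination_apply, Finsupp.sum, Finsupp.finsetSum_apply,
    Finset.sum_eq_single_of_mem i hi] at h4
  · exact mul_ne_zero (Finsupp.mem_support_iff.mp hi) hj h4
  · intro i' hi' hne'
    by_contra h5
    rw [Finsupp.smul_apply, smul_eq_mul] at h5
    exact (hmax i' hi').not_gt (hj' i' (hu' i' hi') hne' (right_ne_zero_of_mul h5))

end Morse

/-- The type of cells of dimension `k`. -/
abbrev Cell (k : ℕ) : Type := {S : Finset Ray // IsKCell k S}

lemma IsKCell.finite_vset {k : ℕ} {S : Finset Ray} (h : IsKCell (k + 1) S) : (Vset S).Finite :=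
  (isKCell_succ.mp h).1.finite

lemma IsKCell.exists_vert {k : ℕ} {S : Finset Ray} (h : IsKCell k S) : ∃ M, IsVert M ∧ S ⊆ M := by
  cases k with
  | zero => exact ⟨S, isKCell_zero.mp h, subset_rfl⟩
  | succ k =>
    obtain ⟨M, hM⟩ := (isKCell_succ.mp h).1.nontrivial.nonempty
    exact ⟨M, hM⟩

lemma finite_facets {k : ℕ} (S : Cell (k + 1)) : {T : Cell k | S.1 ⊆ T.1}.Finite := by
  refine Set.Finite.of_finite_image (f := Subtype.val) ?_ Subtype.val_injective.injOn
  refine (S.2.finite_vset.biUnion fun M _ => M.powerset.finite_toSet).subset ?_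
  rintro _ ⟨T, hT, rfl⟩
  obtain ⟨M, hM, hTM⟩ := T.2.exists_vert
  exact Set.mem_biUnion (x := M) ⟨hM, Finset.Subset.trans hT hTM⟩
    (Finset.mem_coe.mpr (Finset.mem_powerset.mpr hTM))

/-- The boundary of a cell. -/
noncomputable def bdry (k : ℕ) (S : Cell (k + 1)) : Cell k →₀ ℂ :=
  Finsupp.ofSupportFinite (fun T => (inc k S.1 T.1 : ℂ)) <| (finite_facets S).subset fun T hT => by
    by_contra h
    exact hT (by simp only [inc_of_not_subset h, Int.cast_zero])

lemma bdry_apply {k : ℕ} (S : Cell (k + 1)) (T : Cell k) : bdry k S T = (inc k S.1 T.1 : ℂ) := rfl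

lemma subset_of_bdry_ne_zero {k : ℕ} {S : Cell (k + 1)} {T : Cell k} (h : bdry k S T ≠ 0) :
    S.1 ⊆ T.1 := by
  by_contra h'
  exact h (by rw [bdry_apply, inc_of_not_subset h', Int.cast_zero])

lemma Match.inc_ne_zero {k : ℕ} {S U : Finset Ray} (h : Match k S U) : inc k U S ≠ 0 := by
  cases h with
  | vertex M N hM hN h =>
    rw [inc_zero Finset.sdiff_subset]
    exact orient_ne_zero hM Finset.sdiff_subset hM.data.noFrame_lights hM.data.card_sdiff_lights
  | cell k M S hS h hs hl =>
    have := inc_insert (k := k) (Finset.notMem_erase (h.vert.data.light (h.vert.data.stage S)) S)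
    rw [Finset.insert_erase hl] at this
    rw [this]
    exact Units.ne_zero _

lemma exists_down {k : ℕ} (i : Cell k) (h : IsDown k i.1) : ∃ j : Cell (k + 1), bdry k j i ≠ 0 ∧
    ∀ i' : Cell k, IsDown k i'.1 → i' ≠ i → bdry k j i' ≠ 0 → cellRank k i'.1 < cellRank k i.1 := by
  obtain ⟨U, hU⟩ := h
  exact ⟨⟨U, hU.isKCell_right⟩, Int.cast_ne_zero.mpr hU.inc_ne_zero, fun i' h1 h2 h3 =>
    hU.rank_lt h1 (subset_of_bdry_ne_zero h3) fun e => h2 (Subtype.ext e)⟩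

lemma exists_up {k : ℕ} (u : Cell (k + 1)) (h : ¬IsDown (k + 1) u.1) : ∃ j : Cell k, bdry k u j ≠ 0 ∧
    ∀ u' : Cell (k + 1), ¬IsDown (k + 1) u'.1 → u' ≠ u → bdry k u' j ≠ 0 →
      cellRank (k + 1) u.1 < cellRank (k + 1) u'.1 := by
  obtain ⟨S, hS⟩ := exists_match u.2 h
  refine ⟨⟨S, hS.isKCell_left⟩, Int.cast_ne_zero.mpr hS.inc_ne_zero, fun u' h1 h2 h3 => ?_⟩
  obtain ⟨S', hS'⟩ := exists_match u'.2 h1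
  rw [hS.rank_eq, hS'.rank_eq]
  refine hS'.rank_lt ⟨_, hS⟩ (subset_of_bdry_ne_zero h3) ?_
  rintro rfl
  exact h2 (Subtype.ext (hS'.functional hS))

lemma bdry_bdry {k : ℕ} (S : Cell (k + 2)) :
    Finsupp.linearCombination ℂ (bdry k) (bdry (k + 1) S) = 0 := by
  classical
  ext U
  rw [Finsupp.linearCombination_apply, Finsupp.sum, Finsupp.finsetSum_apply, Finsupp.zero_apply]
  by_cases hSU : S.1 ⊆ U.1
  · obtain ⟨T, T', hne, hT, hT', huniq, hsum⟩ := two_step S.2 U.2 hSU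
    have hne' : (⟨T, hT⟩ : Cell (k + 1)) ≠ ⟨T', hT'⟩ := fun e => hne (congrArg Subtype.val e)
    have h1 : ∀ R : Cell (k + 1), bdry (k + 1) S R * bdry k R U ≠ 0 →
        R ∈ ({⟨T, hT⟩, ⟨T', hT'⟩} : Finset (Cell (k + 1))) := fun R hR => by
      rw [Finset.mem_insert, Finset.mem_singleton]
      exact (huniq R.1 R.2 (subset_of_bdry_ne_zero (left_ne_zero_of_mul hR))
        (subset_of_bdry_ne_zero (right_ne_zero_of_mul hR))).imp Subtype.ext Subtype.ext
    have h2 : ∑ R ∈ (bdry (k + 1) S).support, (bdry (k + 1) S R • bdry k R) U =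
        ∑ R ∈ {⟨T, hT⟩, ⟨T', hT'⟩}, bdry (k + 1) S R * bdry k R U := by
      refine Finset.sum_bij_ne_zero (fun R _ _ => R) (fun R _ hR => h1 R hR) (fun _ _ _ _ _ _ e => e)
        (fun R _ hR => ⟨R, Finsupp.mem_support_iff.mpr (left_ne_zero_of_mul hR), hR, rfl⟩)
        fun _ _ _ => rfl
    rw [h2, Finset.sum_pair hne']
    simp only [bdry_apply]
    exact_mod_cast hsum
  · refine Finset.sum_eq_zero fun R _ => ?_
    by_contra h
    rw [Finsupp.smul_apply, smul_eq_mul] at h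
    exact hSU (Finset.Subset.trans (subset_of_bdry_ne_zero (left_ne_zero_of_mul h))
      (subset_of_bdry_ne_zero (right_ne_zero_of_mul h)))

/-- The augmentation on basis elements. -/
noncomputable def augBasis (_ : Cell 0) : Unit →₀ ℂ := Finsupp.single () 1

lemma aug_bdry (S : Cell 1) : Finsupp.linearCombination ℂ augBasis (bdry 0 S) = 0 := by
  classical
  ext
  obtain ⟨hc, hcard⟩ := isKCell_succ.mp S.2
  obtain ⟨M, hM, N, hN, hne⟩ := hc.nontrivial
  have hn := noFrame_of_nontrivial hM.1.data hc.nontrivial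
  let M' : Cell 0 := ⟨M, isKCell_zero.mpr hM.1⟩
  let N' : Cell 0 := ⟨N, isKCell_zero.mpr hN.1⟩
  have hne' : M' ≠ N' := fun e => hne (congrArg Subtype.val e)
  have h1 : ∀ R : Cell 0, bdry 0 S R * 1 ≠ 0 → R ∈ ({M', N'} : Finset (Cell 0)) := fun R hR => by
    rw [Finset.mem_insert, Finset.mem_singleton]
    have hSR := subset_of_bdry_ne_zero (left_ne_zero_of_mul hR)
    by_cases e : R = M'
    · exact Or.inl e
    · exact Or.inr (Subtype.ext (ends_unique hM.1 (isKCell_zero.mp R.2) hN.1 hM.2 hSR hN.2 hn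
        (by omega) (fun h => e (Subtype.ext h)) hne.symm))
  rw [Finsupp.linearCombination_apply, Finsupp.sum, Finsupp.finsetSum_apply, Finsupp.zero_apply]
  have h2 : ∑ R ∈ (bdry 0 S).support, (bdry 0 S R • augBasis R) () = ∑ R ∈ {M', N'}, bdry 0 S R * 1 := by
    refine Finset.sum_bij_ne_zero (fun R _ _ => R) (fun R _ hR => h1 R ?_) (fun _ _ _ _ _ _ e => e)
      (fun R _ hR => ⟨R, Finsupp.mem_support_iff.mpr (left_ne_zero_of_mul hR), ?_, rfl⟩)
      fun R _ _ => ?_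
    · simpa [augBasis] using hR
    · simpa [augBasis] using hR
    · simp [augBasis]
  rw [h2, Finset.sum_pair hne', mul_one, mul_one, bdry_apply, bdry_apply, ← Int.cast_add,
    inc_zero hM.2, inc_zero hN.2, orient_add_orient hM.1 hN.1 hM.2 hN.2 hn (by omega) hne.symm,
    Int.cast_zero]

lemma exact_bdry {k : ℕ} (x : Cell (k + 1) →₀ ℂ)
    (hx : Finsupp.linearCombination ℂ (bdry k) x = 0) :
    x ∈ LinearMap.range (Finsupp.linearCombination ℂ (bdry (k + 1))) :=
  exact_of_matching (bdry (k + 1)) (bdry k) (fun S => IsDown (k + 1) S.1)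
    (fun S => cellRank (k + 1) S.1) (fun i hi => exists_down i hi) (fun u hu => exists_up u hu)
    bdry_bdry x hx

lemma isDown_zero {M N : Finset Ray} (hM : IsVert M) (hN : IsVert N) (h : vheight N < vheight M) :
    IsDown 0 M := ⟨_, Match.vertex M N hM hN h⟩

lemma exact_aug (x : Cell 0 →₀ ℂ) (hx : Finsupp.linearCombination ℂ augBasis x = 0) :
    x ∈ LinearMap.range (Finsupp.linearCombination ℂ (bdry 0)) :=
  exact_of_matching (bdry 0) augBasis (fun S => IsDown 0 S.1)
    (fun S => cellRank 0 S.1) (fun i hi => exists_down i hi) (fun u hu => ⟨(), by simp [augBasis],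
      fun u' hu' hne _ => by
        exfalso
        have h1 := isKCell_zero.mp u.2
        have h2 := isKCell_zero.mp u'.2
        refine hne (Subtype.ext (vheight_injOn h2 h1 (le_antisymm ?_ ?_)))
        · by_contra! h
          exact hu' (isDown_zero h2 h1 h)
        · by_contra! h
          exact hu (isDown_zero h1 h2 h)⟩)
    aug_bdry x hx

section

open CategoryTheory

section Monomial

variable {G X : Type} [Group G] [MulAction G X]

/-- Monomial representations, given by a sign cocycle for an action. -/
noncomputable def monomial (s : G → X → ℤˣ) (h1 : ∀ x, s 1 x = 1)
    (hmul : ∀ g h x, s (g * h) x = s g (h • x) * s h x) : Representation ℂ G (X →₀ ℂ) where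
  toFun g := Finsupp.linearCombination ℂ fun x => Finsupp.single (g • x) ((s g x : ℤ) : ℂ)
  map_one' := by
    ext x : 1
    simp only [h1, one_smul]
    exact LinearMap.ext fun a => by simp
  map_mul' g h := by
    ext x : 2
    simp [hmul, mul_smul, mul_comm]

variable (s : G → X → ℤˣ) (h1 : ∀ x, s 1 x = 1)
  (hmul : ∀ g h x, s (g * h) x = s g (h • x) * s h x)

lemma monomial_single (g : G) (x : X) (a : ℂ) :
    monomial s h1 hmul g (Finsupp.single x a) = Finsupp.single (g • x) (a * ((s g x : ℤ) : ℂ)) := by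
  change Finsupp.linearCombination ℂ _ _ = _
  rw [Finsupp.linearCombination_single, Finsupp.smul_single, smul_eq_mul]

lemma intCast_sq (u : ℤˣ) : ((u : ℤ) : ℂ) * ((u : ℤ) : ℂ) = 1 := by
  rcases Int.units_eq_one_or u with rfl | rfl <;> norm_num

/-- Transitive parts of a monomial representation with finite stabilizers are projective. -/
lemma projective_monomial (hfin : ∀ x y : X, {g : G | g • x = y}.Finite) :
    Projective (Rep.of (monomial s h1 hmul)) where
  factors {E F} f e he := by
    classical
    have hsurj := (Rep.epi_iff_surjective e).mp he
    let ρ := monomial s h1 hmul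
    choose a ha using fun x : X => hsurj (f.hom (Finsupp.single x 1))
    let r : X → X := fun x => (Quotient.mk (MulAction.orbitRel G X) x).out
    have hr : ∀ g x, r (g • x) = r x := fun g x => by
      change (Quotient.mk _ _).out = (Quotient.mk _ _).out
      congr 1
      exact Quotient.sound ⟨g, rfl⟩
    let A : X → Finset G := fun x => (hfin (r x) x).toFinset
    have hA : ∀ x g, g ∈ A x ↔ g • r x = x := fun x g => (hfin (r x) x).mem_toFinset
    have hne : ∀ x, ((A x).card : ℂ) ≠ 0 := fun x => by
      obtain ⟨g, hg⟩ : ∃ g : G, g • r x = x := by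
        obtain ⟨g, hg⟩ := Quotient.exact (s := MulAction.orbitRel G X) (Quotient.mk _ x).out_eq
        exact ⟨g⁻¹, inv_smul_eq_iff.mpr hg.symm⟩
      exact Nat.cast_ne_zero.mpr (Finset.card_ne_zero_of_mem ((hA x g).mpr hg))
    have hcov : ∀ g x, A (g • x) = (A x).image (g * ·) := fun g x => by
      ext h
      rw [Finset.mem_image, hA, hr]
      constructor
      · intro e
        exact ⟨g⁻¹ * h, (hA _ _).mpr (by rw [mul_smul, e, inv_smul_smul]), mul_inv_cancel_left g h⟩
      · rintro ⟨k, hk, rfl⟩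
        rw [mul_smul, (hA _ _).mp hk]
    let φ : X → E := fun x => ((A x).card : ℂ)⁻¹ • ∑ h ∈ A x, ((s h (r x) : ℤ) : ℂ) • E.ρ h (a (r x))
    have hφ : ∀ g x, E.ρ g (φ x) = ((s g x : ℤ) : ℂ) • φ (g • x) := fun g x => by
      simp only [φ]
      rw [hcov, Finset.card_image_of_injective _ (mul_right_injective g),
        Finset.sum_image (fun _ _ _ _ e => mul_right_injective g e), hr, map_smul, map_sum,
        smul_comm, Finset.smul_sum (N := E) (r := ((s g x : ℤ) : ℂ))]
      congr 1
      refine Finset.sum_congr rfl fun h hh => ?_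
      rw [map_smul, hmul, (hA x h).mp hh, map_mul, smul_smul, Units.val_mul, Int.cast_mul, ← mul_assoc,
        intCast_sq, one_mul]
      rfl
    have hφ' : ∀ x, e.hom (φ x) = f.hom (Finsupp.single x 1) := fun x => by
      simp only [φ]
      rw [map_smul, map_sum, inv_smul_eq_iff₀ (hne x), Nat.cast_smul_eq_nsmul, ← Finset.sum_const]
      refine Finset.sum_congr rfl fun h hh => ?_
      rw [map_smul, Rep.hom_comm_apply]
      erw [ha]
      rw [← Rep.hom_comm_apply, ← map_smul]
      congr 1
      change _ • monomial s h1 hmul h _ = _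
      rw [monomial_single, (hA x h).mp hh, Finsupp.smul_single, smul_eq_mul, one_mul, intCast_sq]
    refine ⟨Rep.ofHom ⟨Finsupp.linearCombination ℂ φ, fun g => ?_⟩, ?_⟩
    · ext x : 2
      simp only [LinearMap.comp_apply, Finsupp.lsingle_apply]
      rw [monomial_single, Finsupp.linearCombination_single, Finsupp.linearCombination_single, one_smul, hφ,
        one_mul]
    · apply Rep.hom_injective
      apply Representation.IntertwiningMap.toLinearMap_injective
      ext x : 2
      change e.hom (Finsupp.linearCombination ℂ φ (Finsupp.single x 1)) = _
      rw [Finsupp.linearCombination_single, one_smul, hφ']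
      rfl

end Monomial

end

section

open CategoryTheory

lemma subset_smul {g : SL4} {S T : Finset Ray} (h : S ⊆ T) : g • S ⊆ g • T :=
  Finset.smul_finset_subset_smul_finset h

lemma Vset.smul {S M : Finset Ray} (h : M ∈ Vset S) (g : SL4) : g • M ∈ Vset (g • S) :=
  ⟨h.1.smul g, subset_smul h.2⟩

lemma IsCell.exists_vert {S : Finset Ray} (h : IsCell S) : ∃ M, IsVert M ∧ S ⊆ M :=
  h.nontrivial.nonempty

lemma IsVert.spans {M : Finset Ray} (h : IsVert M) : Spans M := fun _ hx =>
  sqForm_eq_zero fun v => h.data.map_ray_eq_zero hx v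

lemma IsKCell.spans {k : ℕ} {S : Finset Ray} (h : IsKCell k S) : Spans S := by
  cases k with
  | zero => exact (isKCell_zero.mp h).spans
  | succ k => exact (isKCell_succ.mp h).1.spans

lemma IsKCell.isRay {k : ℕ} {S : Finset Ray} (h : IsKCell k S) {X : Ray} (hX : X ∈ S) :
    ∃ v, ray v = X := by
  obtain ⟨M, hM, hS⟩ := h.exists_vert
  obtain ⟨v, -, hv⟩ := hM.data.isRay X (hS hX)
  exact ⟨v, hv⟩

lemma Spans.smul {S : Finset Ray} (h : Spans S) (hS : ∀ X ∈ S, ∃ v, ray v = X) (g : SL4) :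
    Spans (g • S) := by
  intro x hx
  have h1 : x ᵥ* g.1 = 0 := h _ fun X hX => by
    obtain ⟨v, rfl⟩ := hS X hX
    have := hx _ (Finset.smul_mem_smul_finset hX)
    rwa [smul_ray, sqForm_ray, Matrix.dotProduct_mulVec, ← sqForm_ray] at this
  have h2 : x ᵥ* g.1 ᵥ* (g⁻¹).1 = x := by
    rw [Matrix.vecMul_vecMul, ← Matrix.SpecialLinearGroup.coe_mul, mul_inv_cancel,
      Matrix.SpecialLinearGroup.coe_one, Matrix.vecMul_one]
  rw [← h2, h1, Matrix.zero_vecMul]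

lemma IsKCell.smul {k : ℕ} {S : Finset Ray} (h : IsKCell k S) (g : SL4) : IsKCell k (g • S) := by
  cases k with
  | zero => exact isKCell_zero.mpr ((isKCell_zero.mp h).smul g)
  | succ k =>
    obtain ⟨hc, hcard⟩ := isKCell_succ.mp h
    refine isKCell_succ.mpr ⟨⟨h.spans.smul (fun X hX => h.isRay hX) g, ?_, ?_⟩, ?_⟩
    · refine (hc.finite.image (g • ·)).subset fun M hM => ⟨g⁻¹ • M, ?_, smul_inv_smul g M⟩
      have := Vset.smul hM g⁻¹
      rwa [inv_smul_smul] at this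
    · obtain ⟨M, hM, N, hN, hne⟩ := hc.nontrivial
      exact ⟨_, Vset.smul hM g, _, Vset.smul hN g, fun e => hne (MulAction.injective g e)⟩
    · rwa [Finset.card_smul_finset]

instance (k : ℕ) : MulAction SL4 (Cell k) where
  smul g S := ⟨g • S.1, S.2.smul g⟩
  one_smul S := Subtype.ext (one_smul SL4 S.1)
  mul_smul g h S := Subtype.ext (mul_smul g h S.1)

lemma Cell.smul_val {k : ℕ} (g : SL4) (S : Cell k) : (g • S).1 = g • S.1 := rfl

lemma finite_ray_preimage (X : Ray) : {v | ray v = X}.Finite := by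
  refine (Set.Finite.pi' (t := fun i => Set.Icc (-X i i) (X i i))
    fun i => Set.finite_Icc _ _).subset fun v hv i => ?_
  have h : v i * v i = X i i := by rw [← hv]; rfl
  constructor <;> nlinarith [sq_nonneg (v i - 1), sq_nonneg (v i + 1), Int.le_self_sq (v i),
    Int.le_self_sq (-v i)]

lemma finite_transporter {k : ℕ} (S T : Cell k) : {g : SL4 | g • S = T}.Finite := by
  choose! v hv using fun X (hX : X ∈ S.1) => S.2.isRay hX
  have hT : {w | ray w ∈ T.1}.Finite :=
    (T.1.finite_toSet.biUnion fun X _ => finite_ray_preimage X).subset fun w hw =>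
      Set.mem_biUnion (x := ray w) hw rfl
  refine Set.Finite.of_finite_image (f := fun (g : SL4) (X : S.1) => g.1 *ᵥ v X.1)
    ((Set.Finite.pi' (t := fun _ : S.1 => {w | ray w ∈ T.1}) fun _ => hT).subset ?_) ?_
  · rintro _ ⟨g, rfl, rfl⟩ X
    change ray _ ∈ g • S.1
    rw [← smul_ray, hv _ X.2]
    exact Finset.smul_mem_smul_finset X.2
  · intro g _ h _ e
    refine Subtype.ext (funext fun i => sub_eq_zero.mp (S.2.spans _ fun X hX => ?_))
    rw [← hv X hX, sqForm_ray, sub_dotProduct, sq_eq_zero_iff, sub_eq_zero]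
    exact congrFun (congrFun e ⟨X, hX⟩) i

section Resolution

variable (Γ : Subgroup SL4)

/-- Chains on cells. -/
noncomputable abbrev chainRep (k : ℕ) : Rep ℂ Γ :=
  Rep.of (monomial (X := Cell k) (fun (g : Γ) S => cellSign k g.1 S.1) (fun S => cellSign_one k S.1)
    fun g h S => cellSign_mul k g.1 h.1 S.1)

instance (k : ℕ) : Projective (chainRep Γ k) := by
  refine projective_monomial _ _ _ fun S T => ?_
  exact Set.Finite.of_finite_image (f := Subtype.val)
    ((finite_transporter S T).subset (by rintro _ ⟨g, hg, rfl⟩; exact hg)) Subtype.val_injective.injOn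

lemma bdry_smul {k : ℕ} (g : SL4) (S : Cell (k + 1)) (T : Cell k) :
    bdry k (g • S) (g • T) * ((cellSign k g T.1 : ℤ) : ℂ) =
      ((cellSign (k + 1) g S.1 : ℤ) : ℂ) * bdry k S T := by
  simp only [bdry_apply, Cell.smul_val]
  exact_mod_cast inc_smul S.2 T.2 g

/-- The boundary map. -/
noncomputable def bdryHom (k : ℕ) : chainRep Γ (k + 1) ⟶ chainRep Γ k :=
  Rep.ofHom ⟨Finsupp.linearCombination ℂ (bdry k), fun g => by
    ext S T
    simp only [LinearMap.comp_apply, Finsupp.lsingle_apply]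
    rw [monomial_single, Finsupp.linearCombination_single, Finsupp.linearCombination_single, one_smul,
      one_mul, Finsupp.smul_apply, smul_eq_mul]
    have h1 : ∀ x : Cell k →₀ ℂ, monomial (fun (g : Γ) (S : Cell k) => cellSign k g.1 S.1)
        (fun S => cellSign_one k S.1) (fun g h S => cellSign_mul k g.1 h.1 S.1) g x T =
        x (g⁻¹ • T) * ((cellSign k g.1 (g⁻¹ • T).1 : ℤ) : ℂ) := fun x => by
      induction x using Finsupp.induction_linear with
      | zero => simp
      | add x y hx hy => rw [map_add, Finsupp.add_apply, hx, hy, Finsupp.add_apply, add_mul]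
      | single U a =>
        classical
        rw [monomial_single, Finsupp.single_apply, Finsupp.single_apply]
        by_cases h : g • U = T
        · rw [if_pos h, if_pos (eq_inv_smul_iff.mpr h), ← h, inv_smul_smul]
        · rw [if_neg h, if_neg fun e => h (eq_inv_smul_iff.mp e), zero_mul]
    rw [h1]
    have h2 := bdry_smul g.1 S (g⁻¹ • T)
    have h3 : g.1 • (g⁻¹ • T) = T := smul_inv_smul g T
    rw [h3] at h2
    have h4 := intCast_sq (cellSign k g.1 (g⁻¹ • T).1)
    change _ * bdry k (g.1 • S) T = _
    have h5 := intCast_sq (cellSign (k + 1) g.1 S.1)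
    linear_combination (-((cellSign (k + 1) g.1 S.1 : ℤ) : ℂ) * bdry k (g.1 • S) T) * h4 +
      ((cellSign (k + 1) g.1 S.1 : ℤ) : ℂ) * ((cellSign k g.1 (g⁻¹ • T).1 : ℤ) : ℂ) * h2 +
      bdry k S (g⁻¹ • T) * ((cellSign k g.1 (g⁻¹ • T).1 : ℤ) : ℂ) * h5⟩

lemma bdryHom_comp (k : ℕ) : bdryHom Γ (k + 1) ≫ bdryHom Γ k = 0 := by
  apply Rep.hom_injective
  apply Representation.IntertwiningMap.toLinearMap_injective
  refine Finsupp.lhom_ext' fun S => LinearMap.ext_ring ?_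
  change Finsupp.linearCombination ℂ (bdry k) (Finsupp.linearCombination ℂ (bdry (k + 1))
    (Finsupp.single S 1)) = 0
  rw [Finsupp.linearCombination_single, one_smul, bdry_bdry]

/-- The augmentation. -/
noncomputable def augHom : chainRep Γ 0 ⟶ Rep.trivial ℂ Γ ℂ :=
  Rep.ofHom ⟨Finsupp.linearCombination ℂ fun _ => (1 : ℂ), fun g => by
    refine Finsupp.lhom_ext' fun S => LinearMap.ext_ring ?_
    simp only [LinearMap.comp_apply, Finsupp.lsingle_apply]
    rw [monomial_single, cellSign_zero]
    simp⟩

lemma linearCombination_augBasis (x : Cell 0 →₀ ℂ) :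
    Finsupp.linearCombination ℂ augBasis x =
      Finsupp.single () (Finsupp.linearCombination ℂ (fun _ => (1 : ℂ)) x) := by
  induction x using Finsupp.induction_linear with
  | zero => simp
  | add x y hx hy => rw [map_add, hx, hy, map_add, Finsupp.single_add]
  | single U a => simp [augBasis]

lemma mem_range_bdry_zero (x : Cell 0 →₀ ℂ)
    (hx : Finsupp.linearCombination ℂ (fun _ => (1 : ℂ)) x = 0) :
    x ∈ LinearMap.range (Finsupp.linearCombination ℂ (bdry 0)) :=
  exact_aug x (by rw [linearCombination_augBasis, hx, Finsupp.single_zero])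

lemma linearCombination_single_one {X : Type*} (M : X) (x : ℂ) :
    Finsupp.linearCombination ℂ (fun _ => (1 : ℂ)) (Finsupp.single M x) = x := by
  rw [Finsupp.linearCombination_single, smul_eq_mul, mul_one]

lemma bdryHom_comp_aug : bdryHom Γ 0 ≫ augHom Γ = 0 := by
  apply Rep.hom_injective
  apply Representation.IntertwiningMap.toLinearMap_injective
  refine Finsupp.lhom_ext' fun S => LinearMap.ext_ring ?_
  change Finsupp.linearCombination ℂ (fun _ => (1 : ℂ)) (Finsupp.linearCombination ℂ (bdry 0)
    (Finsupp.single S 1)) = 0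
  have := aug_bdry S
  rw [linearCombination_augBasis] at this
  rw [Finsupp.linearCombination_single, one_smul]
  exact Finsupp.single_eq_zero.mp this

/-- The complex of cells. -/
noncomputable def cellComplex : ChainComplex (Rep ℂ Γ) ℕ :=
  ChainComplex.of (chainRep Γ) (bdryHom Γ) (bdryHom_comp Γ)

lemma cellComplex_d (k : ℕ) : (cellComplex Γ).d (k + 1) k = bdryHom Γ k :=
  ChainComplex.of_d _ _ _

/-- The augmentation of the complex of cells. -/
noncomputable def cellπ : cellComplex Γ ⟶ (ChainComplex.single₀ (Rep ℂ Γ)).obj (Rep.trivial ℂ Γ ℂ) :=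
  ((cellComplex Γ).toSingle₀Equiv _).symm ⟨augHom Γ, by
    rw [cellComplex_d]; exact bdryHom_comp_aug Γ⟩

instance : QuasiIso (cellπ Γ) where
  quasiIsoAt m := by
    cases m with
    | zero =>
      rw [ChainComplex.quasiIsoAt₀_iff, ShortComplex.quasiIso_iff_of_zeros' _ rfl rfl rfl]
      constructor
      · apply (forget₂ _ (ModuleCat ℂ)).reflects_exact_of_faithful
        rw [ShortComplex.moduleCat_exact_iff]
        intro x hx
        have hx' : Finsupp.linearCombination ℂ (fun _ => (1 : ℂ)) (x : Cell 0 →₀ ℂ) = 0 := hx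
        obtain ⟨y, hy⟩ := mem_range_bdry_zero x hx'
        refine ⟨y, ?_⟩
        change ((cellComplex Γ).d 1 0).hom y = _
        rw [cellComplex_d]
        exact hy
      · rw [Rep.epi_iff_surjective]
        intro x
        let M : Cell 0 := ⟨rays minA, isKCell_zero.mpr ⟨1, Or.inl (one_smul SL4 _).symm⟩⟩
        refine ⟨Finsupp.single M x, ?_⟩
        change Finsupp.linearCombination ℂ (fun _ => (1 : ℂ)) (Finsupp.single M x) = x
        exact linearCombination_single_one M x
    | succ m =>
      rw [quasiIsoAt_iff_exactAt' (hL := ChainComplex.exactAt_succ_single_obj ..),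
        HomologicalComplex.exactAt_iff' _ (m + 2) (m + 1) m (by simp) (by simp)]
      apply (forget₂ _ (ModuleCat ℂ)).reflects_exact_of_faithful
      rw [ShortComplex.moduleCat_exact_iff]
      intro x hx
      have hx1 : ((cellComplex Γ).d (m + 1) m).hom x = 0 := hx
      rw [cellComplex_d] at hx1
      obtain ⟨y, hy⟩ := exact_bdry x hx1
      refine ⟨y, ?_⟩
      change ((cellComplex Γ).d (m + 2) (m + 1)).hom y = _
      rw [cellComplex_d]
      exact hy

/-- The cells form a projective resolution of the trivial representation. -/
noncomputable def cellResolution : ProjectiveResolution (Rep.trivial ℂ Γ ℂ) where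
  complex := cellComplex Γ
  projective k := inferInstanceAs (Projective (chainRep Γ k))
  π := cellπ Γ

end Resolution

end

section

open CategoryTheory

section LinearAlgebra

variable {A B C : Type*} [AddCommGroup A] [AddCommGroup B] [AddCommGroup C] [Module ℂ A]
  [Module ℂ B] [Module ℂ C]

lemma linearIndependent_of_triangular {m : ℕ} (v : Fin m → B) (p : Fin m → B → ℂ)
    (hp : ∀ i, IsLinearMap ℂ (p i)) (h1 : ∀ i, p i (v i) ≠ 0) (h2 : ∀ i j, i < j → p i (v j) = 0) :
    LinearIndependent ℂ v := by
  rw [Fintype.linearIndependent_iff]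
  intro c hc i
  induction i using WellFoundedLT.induction with
  | ind i ih =>
    have h3 := congrArg (hp i).mk' hc
    rw [map_sum, map_zero, Finset.sum_eq_single i] at h3
    · rw [map_smul, smul_eq_mul] at h3
      exact (mul_eq_zero.mp h3).resolve_right (h1 i)
    · intro j _ hj
      rcases lt_or_gt_of_ne hj with h | h
      · rw [ih j h, zero_smul, map_zero]
      · rw [map_smul]
        exact smul_eq_zero_of_right _ (h2 i j h)
    · intro h
      exact absurd (Finset.mem_univ i) h

/-- Computing the dimension of a homology space from test vectors and test functionals. -/
lemma finrank_ker_quotient (f : A →ₗ[ℂ] B) (g : B →ₗ[ℂ] C) (f' : A →ₗ[ℂ] LinearMap.ker g)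
    (hf' : ∀ a, (f' a : B) = f a) {m r : ℕ}
    (e : Fin (m + r) → B → ℂ) (he : ∀ i, IsLinearMap ℂ (e i))
    (hinj : ∀ x, g x = 0 → (∀ i, e i x = 0) → x = 0)
    (a : Fin m → A) (p : Fin m → B → ℂ) (hp : ∀ i, IsLinearMap ℂ (p i))
    (h1 : ∀ i, p i (f (a i)) ≠ 0) (h2 : ∀ i j, i < j → p i (f (a j)) = 0)
    (b : Fin r → B) (hb : ∀ i, g (b i) = 0) (W : Fin r → B → ℂ) (hW : ∀ i, IsLinearMap ℂ (W i))
    (hW0 : ∀ i x, W i (f x) = 0) (h3 : ∀ i, W i (b i) ≠ 0) (h4 : ∀ i j, i < j → W i (b j) = 0) :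
    Module.finrank ℂ (LinearMap.ker g ⧸ LinearMap.range f') = r := by
  let ev : LinearMap.ker g →ₗ[ℂ] (Fin (m + r) → ℂ) :=
    (LinearMap.pi fun i => (he i).mk').comp (LinearMap.ker g).subtype
  have hev : Function.Injective ev := by
    rw [injective_iff_map_eq_zero]
    intro x hx
    exact Subtype.ext (hinj x.1 x.2 fun i => congrFun hx i)
  have hfin : FiniteDimensional ℂ (LinearMap.ker g) := FiniteDimensional.of_injective ev hev
  have hle : Module.finrank ℂ (LinearMap.ker g) ≤ m + r := by
    have := LinearMap.finrank_le_finrank_of_injective hev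
    rwa [Module.finrank_fin_fun] at this
  have hind : LinearIndependent ℂ fun i => (⟨f' (a i), ⟨_, rfl⟩⟩ : LinearMap.range f') := by
    refine linearIndependent_of_triangular _ (fun i x => p i x.1.1)
      (fun i => ⟨fun x y => (hp i).map_add _ _, fun c x => (hp i).map_smul _ _⟩) (fun i => ?_)
      fun i j hij => ?_
    · simp only [hf']; exact h1 i
    · simp only [hf']; exact h2 i j hij
  have hm := hind.fintype_card_le_finrank
  rw [Fintype.card_fin] at hm
  have hq := Submodule.finrank_quotient_add_finrank (LinearMap.range f')
  have hind' : LinearIndependent ℂ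
      fun i => (LinearMap.range f').mkQ (⟨b i, hb i⟩ : LinearMap.ker g) := by
    have hlift : ∀ i, LinearMap.range f' ≤
        LinearMap.ker ((hW i).mk'.comp (LinearMap.ker g).subtype) := fun i => by
      rintro _ ⟨x, rfl⟩
      change W i (f' x).1 = 0
      rw [hf', hW0]
    exact linearIndependent_of_triangular _
      (fun i x => (LinearMap.range f').liftQ ((hW i).mk'.comp (LinearMap.ker g).subtype) (hlift i) x)
      (fun i => ⟨fun x y => map_add _ _ _, fun c x => map_smul _ _ _⟩) h3 h4
  have hr := hind'.fintype_card_le_finrank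
  rw [Fintype.card_fin] at hr
  omega

end LinearAlgebra

section Criterion

variable (Γ : Subgroup SL4)

/-- Equivariant cochains on cells. -/
def IsCoch (k : ℕ) (f : Cell k → ℂ) : Prop :=
  ∀ g ∈ Γ, ∀ S : Cell k, f (g • S) * ((cellSign k g S.1 : ℤ) : ℂ) = f S

/-- The coboundary. -/
noncomputable def cobdry (k : ℕ) (f : Cell k → ℂ) (S : Cell (k + 1)) : ℂ :=
  Finsupp.linearCombination ℂ f (bdry k S)

variable {Γ}

/-- The morphism given by an equivariant cochain. -/
noncomputable def IsCoch.hom {k : ℕ} {f : Cell k → ℂ} (hf : IsCoch Γ k f) :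
    chainRep Γ k ⟶ Rep.trivial ℂ Γ ℂ :=
  Rep.ofHom ⟨Finsupp.linearCombination ℂ f, fun g => by
    refine Finsupp.lhom_ext' fun S => LinearMap.ext_ring ?_
    simp only [LinearMap.comp_apply, Finsupp.lsingle_apply]
    rw [monomial_single, Finsupp.linearCombination_single, one_mul, smul_eq_mul, mul_comm]
    refine (hf g.1 g.2 S).trans ?_
    change _ = Finsupp.linearCombination ℂ f (Finsupp.single S 1)
    rw [Finsupp.linearCombination_single, one_smul]⟩

/-- The cochain of a morphism. -/
noncomputable def cochOf {k : ℕ} (φ : chainRep Γ k ⟶ Rep.trivial ℂ Γ ℂ) (S : Cell k) : ℂ :=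
  φ.hom (Finsupp.single S 1)

lemma linearCombination_cochOf {k : ℕ} (φ : chainRep Γ k ⟶ Rep.trivial ℂ Γ ℂ) (x : Cell k →₀ ℂ) :
    Finsupp.linearCombination ℂ (cochOf φ) x = φ.hom x := by
  induction x using Finsupp.induction_linear with
  | zero => rw [map_zero]; exact (map_zero φ.hom).symm
  | add x y hx hy => rw [map_add, hx, hy]; exact (map_add φ.hom x y).symm
  | single S a =>
    rw [Finsupp.linearCombination_single, cochOf]
    refine (map_smul φ.hom a (Finsupp.single S 1 : Cell k →₀ ℂ)).symm.trans (congrArg _ ?_)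
    rw [Finsupp.smul_single, smul_eq_mul, mul_one]

lemma isCoch_cochOf {k : ℕ} (φ : chainRep Γ k ⟶ Rep.trivial ℂ Γ ℂ) : IsCoch Γ k (cochOf φ) := by
  intro g hg S
  have h1 := Rep.hom_comm_apply φ (⟨g, hg⟩ : Γ) (Finsupp.single S 1 : Cell k →₀ ℂ)
  have h2 : (chainRep Γ k).ρ ⟨g, hg⟩ (Finsupp.single S 1 : Cell k →₀ ℂ) =
      Finsupp.single (g • S) ((cellSign k g S.1 : ℤ) : ℂ) := by
    have h := monomial_single (X := Cell k) (fun (g : Γ) (S : Cell k) => cellSign k g.1 S.1)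
      (fun S => cellSign_one k S.1) (fun g h S => cellSign_mul k g.1 h.1 S.1) ⟨g, hg⟩ S 1
    rw [one_mul] at h
    exact h
  have h3 := linearCombination_cochOf φ (Finsupp.single (g • S) ((cellSign k g S.1 : ℤ) : ℂ))
  rw [Finsupp.linearCombination_single, smul_eq_mul] at h3
  rw [mul_comm, h3, ← h2]
  exact h1

lemma cochOf_hom {k : ℕ} {f : Cell k → ℂ} (hf : IsCoch Γ k f) : cochOf hf.hom = f := by
  funext S
  change Finsupp.linearCombination ℂ f (Finsupp.single S 1) = f S
  rw [Finsupp.linearCombination_single, one_smul]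

lemma hom_eq_zero_of_cochOf {k : ℕ} {φ : chainRep Γ k ⟶ Rep.trivial ℂ Γ ℂ} (h : cochOf φ = 0) :
    φ = 0 := by
  apply Rep.hom_injective
  apply Representation.IntertwiningMap.toLinearMap_injective
  refine LinearMap.ext fun x => ?_
  refine (linearCombination_cochOf φ x).symm.trans ?_
  rw [h, Finsupp.linearCombination_zero_apply]
  rfl

lemma cochOf_bdryHom_comp {k : ℕ} (φ : chainRep Γ k ⟶ Rep.trivial ℂ Γ ℂ) :
    cochOf (bdryHom Γ k ≫ φ) = cobdry k (cochOf φ) := by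
  funext S
  rw [cobdry, linearCombination_cochOf]
  change φ.hom (Finsupp.linearCombination ℂ (bdry k) (Finsupp.single S 1)) = _
  rw [Finsupp.linearCombination_single, one_smul]

lemma cochOf_add {k : ℕ} (φ ψ : chainRep Γ k ⟶ Rep.trivial ℂ Γ ℂ) :
    cochOf (φ + ψ) = cochOf φ + cochOf ψ := rfl

lemma cochOf_smul {k : ℕ} (c : ℂ) (φ : chainRep Γ k ⟶ Rep.trivial ℂ Γ ℂ) :
    cochOf (c • φ) = c • cochOf φ := rfl

lemma isLinearMap_comp {k : ℕ} {p : (Cell k → ℂ) → ℂ} (hp : IsLinearMap ℂ p) :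
    IsLinearMap ℂ fun φ : chainRep Γ k ⟶ Rep.trivial ℂ Γ ℂ => p (cochOf φ) :=
  ⟨fun x y => by rw [cochOf_add, hp.map_add], fun c x => by rw [cochOf_smul, hp.map_smul]⟩

/-- Computing the dimension of a cohomology group from test cochains and test functionals. -/
theorem finrank_groupCohomology {n m r : ℕ} (e : Fin (m + r) → (Cell (n + 1) → ℂ) → ℂ)
    (he : ∀ i, IsLinearMap ℂ (e i))
    (hinj : ∀ f, IsCoch Γ (n + 1) f → (∀ S, cobdry (n + 1) f S = 0) → (∀ i, e i f = 0) →
      ∀ S, f S = 0)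
    (a : Fin m → Cell n → ℂ) (ha : ∀ i, IsCoch Γ n (a i)) (p : Fin m → (Cell (n + 1) → ℂ) → ℂ)
    (hp : ∀ i, IsLinearMap ℂ (p i)) (h1 : ∀ i, p i (cobdry n (a i)) ≠ 0)
    (h2 : ∀ i j, i < j → p i (cobdry n (a j)) = 0)
    (b : Fin r → Cell (n + 1) → ℂ) (hbc : ∀ i, IsCoch Γ (n + 1) (b i))
    (hb : ∀ i S, cobdry (n + 1) (b i) S = 0) (W : Fin r → (Cell (n + 1) → ℂ) → ℂ)
    (hW : ∀ i, IsLinearMap ℂ (W i)) (hW0 : ∀ i f, IsCoch Γ n f → W i (cobdry n f) = 0)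
    (h3 : ∀ i, W i (b i) ≠ 0) (h4 : ∀ i j, i < j → W i (b j) = 0) :
    Module.finrank ℂ (groupCohomology (Rep.trivial ℂ Γ ℂ) (n + 1)) = r := by
  let K := (cellResolution Γ).complex.linearYonedaObj ℂ (Rep.trivial ℂ Γ ℂ)
  let I : groupCohomology (Rep.trivial ℂ Γ ℂ) (n + 1) ≅ K.homology (n + 1) :=
    groupCohomologyIso _ _ _
  let J : K.homology (n + 1) ≅ (K.sc' n (n + 1) (n + 2)).homology :=
    K.homologyIsoSc' _ _ _ (by simp) (by simp)
  have L := (I ≪≫ J ≪≫ (K.sc' n (n + 1) (n + 2)).moduleCatHomologyIso).toLinearEquiv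
  rw [L.finrank_eq]
  have hd : ∀ (k : ℕ) (φ : chainRep Γ k ⟶ Rep.trivial ℂ Γ ℂ),
      K.d k (k + 1) φ = bdryHom Γ k ≫ φ := fun k φ => by
    rw [← cellComplex_d]; rfl
  refine finrank_ker_quotient (A := chainRep Γ n ⟶ Rep.trivial ℂ Γ ℂ)
    (B := chainRep Γ (n + 1) ⟶ Rep.trivial ℂ Γ ℂ) (C := chainRep Γ (n + 2) ⟶ Rep.trivial ℂ Γ ℂ)
    (K.d n (n + 1)).hom (K.d (n + 1) (n + 2)).hom
    (K.sc' n (n + 1) (n + 2)).moduleCatToCycles (fun _ => rfl)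
    (fun i φ => e i (cochOf φ)) (fun i => isLinearMap_comp (he i)) ?_
    (fun i => (ha i).hom) (fun i φ => p i (cochOf φ)) (fun i => isLinearMap_comp (hp i)) ?_ ?_
    (fun i => (hbc i).hom) ?_ (fun i φ => W i (cochOf φ)) (fun i => isLinearMap_comp (hW i))
    ?_ ?_ ?_
  · intro φ hφ h
    refine hom_eq_zero_of_cochOf (funext (hinj _ (isCoch_cochOf φ) (fun S => ?_) h))
    rw [← cochOf_bdryHom_comp, ← hd]
    exact congrFun (congrArg cochOf hφ) S
  · intro i
    have := h1 i
    rw [← cochOf_hom (ha i), ← cochOf_bdryHom_comp, ← hd] at this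
    exact this
  · intro i j hij
    have := h2 i j hij
    rw [← cochOf_hom (ha j), ← cochOf_bdryHom_comp, ← hd] at this
    exact this
  · intro i
    refine hom_eq_zero_of_cochOf ?_
    refine (congrArg cochOf (hd _ _)).trans ?_
    rw [cochOf_bdryHom_comp, cochOf_hom]
    exact funext (hb i)
  · intro i φ
    have := hW0 i _ (isCoch_cochOf φ)
    rw [← cochOf_bdryHom_comp, ← hd] at this
    exact this
  · intro i
    simpa only [cochOf_hom] using h3 i
  · intro i j hij
    simpa only [cochOf_hom] using h4 i j hij

end Criterion

end

section ListSign

variable {α : Type*} [LinearOrder α]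

/-- The sign of the permutation sorting a list. -/
def lsgn : List α → ℤˣ
  | [] => 1
  | a :: l => (l.map (ordSign a)).prod * lsgn l

lemma insSign_toFinset {a : α} {l : List α} (hl : l.Nodup) :
    insSign a l.toFinset = (l.map (ordSign a)).prod :=
  List.prod_toFinset _ hl

lemma setSign_toFinset {G : Type*} [Group G] [MulAction G α] (g : G) {l : List α} (hl : l.Nodup) :
    setSign g l.toFinset = lsgn l * lsgn (l.map (g • ·)) := by
  induction l with
  | nil => simp [lsgn]
  | cons a l ih =>
    have ha : a ∉ l.toFinset := by simpa using (List.nodup_cons.mp hl).1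
    have hl' := (List.nodup_cons.mp hl).2
    rw [List.toFinset_cons, setSign_insert _ ha, ih hl', List.prod_toFinset _ hl', List.map_cons, lsgn,
      lsgn, List.map_map]
    have h : (l.map (invSign g a)).prod =
        (l.map (ordSign a)).prod * (l.map (ordSign (g • a) ∘ (g • ·))).prod := by
      rw [← List.prod_map_mul]; rfl
    rw [h]
    exact mul_mul_mul_comm _ _ _ _

lemma lsgn_swap {a b : α} (h : a ≠ b) (l : List α) : lsgn (a :: b :: l) = -lsgn (b :: a :: l) := by
  simp only [lsgn, List.map_cons, List.prod_cons]
  rw [ordSign_swap h, neg_mul, neg_mul, mul_mul_mul_comm, mul_comm (List.prod _) (lsgn l)]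

lemma lsgn_cons_eq {a : α} {l l' : List α} (h : l.Perm l') {e : ℤ}
    (he : (lsgn l : ℤ) = e * lsgn l') : (lsgn (a :: l) : ℤ) = e * lsgn (a :: l') := by
  simp only [lsgn, Units.val_mul, he, (h.map (ordSign a)).prod_eq]
  ring

end ListSign

section VectorLists

/-- Equality of vectors up to sign. -/
def V4.pm (v w : V4) : Bool := v = w || v = w.neg

lemma V4.ray_eq_of_pm {v w : V4} (h : v.pm w = true) : v.ray = w.ray := by
  simp only [V4.pm, Bool.or_eq_true, decide_eq_true_eq] at h
  rcases h with rfl | rfl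
  · rfl
  · exact w.ray_neg

/-- Remove the first vector equal to `a` up to sign, recording the sign of moving it to the front. -/
def pull (a : V4) : List V4 → Option (ℤ × List V4)
  | [] => none
  | b :: l => if a.pm b then some (1, l) else (pull a l).map fun p => (-p.1, b :: p.2)

/-- The sign of the permutation relating two lists of vectors up to sign, or zero. -/
def psgn : List V4 → List V4 → ℤ
  | [], [] => 1
  | [], _ :: _ => 0
  | a :: l, m => match pull a m with
    | none => 0
    | some p => p.1 * psgn l p.2

/-- The rays of a translated list of vectors. -/
def rlist (g : SL4) (l : List V4) : List Ray := l.map fun v => g • v.ray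

lemma rlist_cons (g : SL4) (v : V4) (l : List V4) : rlist g (v :: l) = g • v.ray :: rlist g l := rfl

lemma rlist_smul (γ g : SL4) (l : List V4) : (rlist g l).map (γ • ·) = rlist (γ * g) l := by
  simp only [rlist, List.map_map]
  exact List.map_congr_left fun v _ => (mul_smul γ g v.ray).symm

lemma rlist_mulVec (g : SL4) (m : M4) (h : m.det = 1) (l : List V4) :
    rlist g (l.map m.mulVec) = rlist (g * m.sl h) l := by
  simp only [rlist, List.map_map]
  refine List.map_congr_left fun v _ => ?_
  change g • (m.mulVec v).ray = _
  rw [← m.sl_smul h, mul_smul]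

lemma rlist_toFinset (g : SL4) (l : List V4) : (rlist g l).toFinset = g • rays l := by
  ext X
  simp only [rlist, List.mem_toFinset, List.mem_map, Finset.mem_smul_finset, mem_rays]
  constructor
  · rintro ⟨v, hv, rfl⟩; exact ⟨_, ⟨v, hv, rfl⟩, rfl⟩
  · rintro ⟨_, ⟨v, hv, rfl⟩, rfl⟩; exact ⟨v, hv, rfl⟩

lemma rlist_pull (g : SL4) (a : V4) : ∀ {m : List V4} {p : ℤ × List V4}, pull a m = some p →
    (rlist g m).Nodup → (rlist g m).Perm (g • a.ray :: rlist g p.2) ∧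
      (lsgn (rlist g m) : ℤ) = p.1 * lsgn (g • a.ray :: rlist g p.2)
  | [], p, h, _ => by simp [pull] at h
  | b :: m, p, h, hn => by
    rw [pull] at h
    split_ifs at h with hab
    · rw [Option.some.injEq] at h
      subst h
      rw [rlist_cons, V4.ray_eq_of_pm hab]
      exact ⟨List.Perm.refl _, (one_mul _).symm⟩
    · obtain ⟨q, hq, rfl⟩ := Option.map_eq_some_iff.mp h
      rw [rlist_cons] at hn ⊢
      obtain ⟨h1, h2⟩ := rlist_pull g a hq (List.nodup_cons.mp hn).2
      have hne : g • b.ray ≠ g • a.ray := fun e => (List.nodup_cons.mp hn).1 <| by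
        rw [e]; exact h1.symm.subset List.mem_cons_self
      refine ⟨(h1.cons _).trans (List.Perm.swap _ _ _), ?_⟩
      rw [lsgn_cons_eq h1 h2, lsgn_swap hne, rlist_cons]
      push_cast
      ring

lemma rlist_psgn (g : SL4) : ∀ {l m : List V4}, psgn l m ≠ 0 → (rlist g m).Nodup →
    (rlist g m).Perm (rlist g l) ∧ (lsgn (rlist g m) : ℤ) = psgn l m * lsgn (rlist g l)
  | [], [], _, _ => ⟨List.Perm.refl _, (one_mul _).symm⟩
  | [], _ :: _, h, _ => absurd rfl h
  | a :: l, m, h, hn => by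
    rw [psgn] at h ⊢
    cases hp : pull a m with
    | none => rw [hp] at h; exact absurd rfl h
    | some p =>
      rw [hp] at h
      obtain ⟨h1, h2⟩ := rlist_pull g a hp hn
      obtain ⟨h3, h4⟩ := rlist_psgn g (right_ne_zero_of_mul h)
        (List.nodup_cons.mp (h1.nodup_iff.mp hn)).2
      refine ⟨h1.trans (h3.cons _), ?_⟩
      rw [h2, lsgn_cons_eq h3 h4, rlist_cons, mul_assoc]

end VectorLists

section Evaluation

open Classical in
/-- A cochain as an alternating function of lists. -/
noncomputable def ev {k : ℕ} (f : Cell k → ℂ) (l : List Ray) : ℂ :=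
  if h : IsKCell k l.toFinset ∧ l.Nodup then f ⟨l.toFinset, h.1⟩ * ((lsgn l : ℤ) : ℂ) else 0

variable {k : ℕ}

lemma ev_of_cell (f : Cell k → ℂ) {l : List Ray} (h : IsKCell k l.toFinset) (hl : l.Nodup) :
    ev f l = f ⟨l.toFinset, h⟩ * ((lsgn l : ℤ) : ℂ) := dif_pos ⟨h, hl⟩

lemma ev_eq_zero (f : Cell k → ℂ) {l : List Ray} (h : ¬(IsKCell k l.toFinset ∧ l.Nodup)) :
    ev f l = 0 := dif_neg h

lemma toFinset_map_smul (g : SL4) (l : List Ray) : (l.map (g • ·)).toFinset = g • l.toFinset := by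
  ext X
  simp [Finset.mem_smul_finset]

lemma ev_smul {Γ : Subgroup SL4} {f : Cell (k + 1) → ℂ} (hf : IsCoch Γ (k + 1) f) {γ : SL4}
    (hγ : γ ∈ Γ) (l : List Ray) : ev f (l.map (γ • ·)) = ev f l := by
  have hfs := toFinset_map_smul γ l
  have hnd : (l.map (γ • ·)).Nodup ↔ l.Nodup := List.nodup_map_iff (MulAction.injective γ)
  by_cases h : IsKCell (k + 1) l.toFinset ∧ l.Nodup
  · rw [ev_of_cell f h.1 h.2, ev_of_cell f (by rw [hfs]; exact h.1.smul γ) (hnd.mpr h.2),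
      ← hf γ hγ ⟨_, h.1⟩, cellSign_succ, setSign_toFinset γ h.2, Units.val_mul]
    have e : (⟨(l.map (γ • ·)).toFinset, by rw [hfs]; exact h.1.smul γ⟩ : Cell (k + 1)) =
      γ • ⟨l.toFinset, h.1⟩ := Subtype.ext hfs
    rw [e]
    have := intCast_sq (lsgn l)
    push_cast
    linear_combination (-f (γ • ⟨l.toFinset, h.1⟩) * ((lsgn (l.map (γ • ·)) : ℤ) : ℂ)) * this
  · rw [ev_eq_zero f h, ev_eq_zero f]
    rintro ⟨h1, h2⟩
    refine h ⟨?_, hnd.mp h2⟩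
    rw [hfs] at h1
    have := h1.smul γ⁻¹
    rwa [inv_smul_smul] at this

lemma ev_perm (f : Cell k → ℂ) {l m : List Ray} {e : ℤ} (h : m.Perm l)
    (he : (lsgn m : ℤ) = e * lsgn l) : ev f m = e * ev f l := by
  have hfs := List.toFinset_eq_of_perm _ _ h
  by_cases hc : IsKCell k l.toFinset ∧ l.Nodup
  · rw [ev_of_cell f hc.1 hc.2, ev_of_cell f (hfs ▸ hc.1) (h.nodup_iff.mpr hc.2), he]
    simp only [hfs]
    push_cast
    ring
  · rw [ev_eq_zero f hc, ev_eq_zero f, mul_zero]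
    rwa [hfs, h.nodup_iff]

lemma ev_psgn (f : Cell k → ℂ) (g : SL4) {l m : List V4} (h : psgn l m ≠ 0)
    (hn : (rlist g m).Nodup) : ev f (rlist g m) = psgn l m * ev f (rlist g l) := by
  obtain ⟨h1, h2⟩ := rlist_psgn g h hn
  exact ev_perm f h1 h2

lemma cobdry_ev (f : Cell (k + 1) → ℂ) {l : List Ray} (hl : IsKCell (k + 2) l.toFinset) (hn : l.Nodup)
    (C : List Ray) (hC : C.Nodup) (hCl : ∀ X ∈ C, X ∉ l)
    (hcov : ∀ T : Cell (k + 1), l.toFinset ⊆ T.1 → ∃ X ∈ C, T.1 = insert X l.toFinset) :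
    ev (cobdry (k + 1) f) l = (C.map fun X => ev f (X :: l)).sum := by
  classical
  rw [ev_of_cell _ hl hn, cobdry, Finsupp.linearCombination_apply, Finsupp.sum, Finset.sum_mul,
    ← List.sum_toFinset _ hC]
  symm
  refine Finset.sum_bij_ne_zero
    (fun X hX h => ⟨(X :: l).toFinset, by by_contra h'; exact h (ev_eq_zero f fun e => h' e.1)⟩)
    ?_ ?_ ?_ ?_
  · intro X hX h
    have hXl : X ∉ l.toFinset := by simpa using hCl X (by simpa using hX)
    rw [Finsupp.mem_support_iff, bdry_apply]
    simp only [List.toFinset_cons, inc_insert hXl]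
    exact_mod_cast (insSign X l.toFinset).ne_zero
  · intro X hX h Y hY h' e
    have hXl : X ∉ l.toFinset := by simpa using hCl X (by simpa using hX)
    have e1 := congrArg Subtype.val e
    simp only [List.toFinset_cons] at e1
    have := e1 ▸ Finset.mem_insert_self X l.toFinset
    exact (Finset.mem_insert.mp this).resolve_right hXl
  · intro T hT h
    obtain ⟨X, hX, hXT⟩ := hcov T (subset_of_bdry_ne_zero (Finsupp.mem_support_iff.mp hT))
    have e : (X :: l).toFinset = T.1 := by rw [List.toFinset_cons, hXT]
    have hc : IsKCell (k + 1) (X :: l).toFinset := e ▸ T.2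
    have e' : (⟨(X :: l).toFinset, hc⟩ : Cell (k + 1)) = T := Subtype.ext e
    refine ⟨X, by simpa using hX, ?_, e'⟩
    rw [ev_of_cell f hc (List.nodup_cons.mpr ⟨hCl X hX, hn⟩), e']
    refine mul_ne_zero (fun h0 => h (by rw [h0, smul_zero, zero_mul])) ?_
    exact_mod_cast (lsgn (X :: l)).ne_zero
  · intro X hX h
    have hX' : X ∈ C := by simpa using hX
    have hXl : X ∉ l.toFinset := by simpa using hCl X hX'
    rw [ev_of_cell f (by by_contra h'; exact h (ev_eq_zero f fun e => h' e.1))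
      (List.nodup_cons.mpr ⟨hCl X hX', hn⟩), bdry_apply]
    simp only [List.toFinset_cons, inc_insert hXl, insSign_toFinset hn, lsgn, smul_eq_mul]
    push_cast
    ring

end Evaluation

lemma ray_eq_iff {v w : Fin 4 → ℤ} (h : ray v = ray w) : v = w ∨ v = -w := by
  have h1 : ∀ i j, v i * v j = w i * w j := fun i j => congrFun (congrFun h i) j
  by_cases hw : ∀ i, w i = 0
  · left
    funext i
    have := h1 i i
    rw [hw i, mul_zero] at this
    rw [hw i]
    exact mul_self_eq_zero.mp this
  · push Not at hw
    obtain ⟨i, hi⟩ := hw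
    rcases mul_self_eq_mul_self_iff.mp (h1 i i) with e | e
    · left
      funext j
      have := h1 i j
      rw [e] at this
      exact mul_left_cancel₀ hi this
    · right
      funext j
      have := h1 i j
      rw [e, neg_mul, neg_eq_iff_eq_neg, ← mul_neg] at this
      exact mul_left_cancel₀ hi this

lemma V4.fn_injective : Function.Injective V4.fn := by
  intro v w h
  have h0 := congrFun h 0
  have h1 := congrFun h 1
  have h2 := congrFun h 2
  have h3 := congrFun h 3
  obtain ⟨a, b, c, d⟩ := v
  obtain ⟨a', b', c', d'⟩ := w
  simp only [V4.mk.injEq]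
  exact ⟨h0, h1, h2, h3⟩

lemma V4.pm_iff {v w : V4} : v.pm w = true ↔ v.ray = w.ray := by
  refine ⟨V4.ray_eq_of_pm, fun h => ?_⟩
  simp only [V4.pm, Bool.or_eq_true, decide_eq_true_eq]
  rcases ray_eq_iff h with h | h
  · exact Or.inl (V4.fn_injective h)
  · exact Or.inr (V4.fn_injective (by rw [h, V4.neg_fn]))

/-- The matrix with given columns. -/
def cols (a b c d : V4) : M4 :=
  ⟨⟨a.a, b.a, c.a, d.a⟩, ⟨a.b, b.b, c.b, d.b⟩, ⟨a.c, b.c, c.c, d.c⟩, ⟨a.d, b.d, c.d, d.d⟩⟩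

lemma cols_mat (v : Fin 4 → V4) :
    (cols (v 0) (v 1) (v 2) (v 3)).mat = Matrix.of fun i j => (v j).fn i := by
  funext i j
  fin_cases i <;> fin_cases j <;> rfl

lemma det_cols (v : Fin 4 → V4) :
    (cols (v 0) (v 1) (v 2) (v 3)).det = (Matrix.of fun i j => (v j).fn i).det := by
  rw [← cols_mat, M4.det_mat]

lemma natAbs_det_cols (g : SL4) (v u : Fin 4 → V4) (h : ∀ j, (v j).ray = g • (u j).ray) :
    (cols (v 0) (v 1) (v 2) (v 3)).det.natAbs = (cols (u 0) (u 1) (u 2) (u 3)).det.natAbs := by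
  have h1 : ∀ j, ∃ e : ℤˣ, (v j).fn = (e : ℤ) • (g.1 *ᵥ (u j).fn) := fun j => by
    have h2 := h j
    rw [V4.ray, V4.ray, smul_ray] at h2
    rcases ray_eq_iff h2 with h | h
    · exact ⟨1, by rw [h, Units.val_one, one_smul]⟩
    · exact ⟨-1, by rw [h, Units.val_neg, Units.val_one, neg_smul, one_smul]⟩
  choose e he using h1
  have h2 : (Matrix.of fun i j => (v j).fn i) =
      g.1 * (Matrix.of fun i j => (u j).fn i) * Matrix.diagonal fun j => (e j : ℤ) := by
    funext i j
    rw [Matrix.mul_diagonal, Matrix.of_apply, he, Pi.smul_apply, smul_eq_mul, mul_comm]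
    rfl
  rw [det_cols, det_cols, h2, Matrix.det_mul, Matrix.det_mul, g.2, one_mul, Matrix.det_diagonal,
    Int.natAbs_mul, ← Units.coe_prod, Int.isUnit_iff_natAbs_eq.mp (Units.isUnit _), mul_one]

instance : Inhabited V4 := ⟨⟨0, 0, 0, 0⟩⟩

/-- The minors of a list of vectors are at most one in absolute value, unless they use all vectors of
one of the lists in `C`. -/
def minorsOK (L : List V4) (C : List (List V4)) : Bool :=
  decide (∀ i < L.length, ∀ j < i, ∀ k < j, ∀ l < k,
    (cols (L.getD l default) (L.getD k default) (L.getD j default) (L.getD i default)).det.natAbs ≤ 1 ∨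
    (C.any fun F => F.all fun w => decide (w ∈
      [L.getD l default, L.getD k default, L.getD j default, L.getD i default])) = true)

lemma natAbs_det_perm (v : Fin 4 → V4) (σ : Equiv.Perm (Fin 4)) :
    (cols (v (σ 0)) (v (σ 1)) (v (σ 2)) (v (σ 3))).det.natAbs =
      (cols (v 0) (v 1) (v 2) (v 3)).det.natAbs := by
  rw [det_cols (fun j => v (σ j)), det_cols]
  have : (Matrix.of fun i j => (v (σ j)).fn i) = (Matrix.of fun i j => (v j).fn i).submatrix id σ := rfl
  rw [this, Matrix.det_permute', Int.natAbs_mul, Int.cast_id, Int.units_natAbs, one_mul]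

lemma minorsOK_spec {L : List V4} {C : List (List V4)} (h : minorsOK L C = true) (v : Fin 4 → V4)
    (hv : ∀ j, v j ∈ L) : (cols (v 0) (v 1) (v 2) (v 3)).det.natAbs ≤ 1 ∨
      ∃ F ∈ C, ∀ w ∈ F, ∃ j, w = v j := by
  have h1 : ∀ j, ∃ n < L.length, L.getD n default = v j := fun j => by
    obtain ⟨n, hn, e⟩ := List.mem_iff_getElem.mp (hv j)
    exact ⟨n, hn, by rw [List.getD_eq_getElem _ _ hn, e]⟩
  choose ι hι e using h1
  by_cases hi : Function.Injective ι
  · have hs : StrictMono (ι ∘ Tuple.sort ι) :=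
      (Tuple.monotone_sort ι).strictMono_of_injective (hi.comp (Tuple.sort ι).injective)
    set σ := Tuple.sort ι
    have h2 := of_decide_eq_true h (ι (σ 3)) (hι _) (ι (σ 2)) (hs (by decide)) (ι (σ 1))
      (hs (by decide)) (ι (σ 0)) (hs (by decide))
    rw [e, e, e, e, natAbs_det_perm] at h2
    refine h2.imp_right fun h3 => ?_
    obtain ⟨F, hF, h3⟩ := List.any_eq_true.mp h3
    refine ⟨F, hF, fun w hw => ?_⟩
    have h4 := of_decide_eq_true (List.all_eq_true.mp h3 w hw)
    simp only [List.mem_cons, List.not_mem_nil, or_false] at h4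
    rcases h4 with h | h | h | h <;> exact ⟨_, h⟩
  · left
    obtain ⟨i, j, hij, hne⟩ := Function.not_injective_iff.mp hi
    rw [det_cols, Matrix.det_zero_of_column_eq hne]
    · exact Nat.zero_le _
    · intro k
      simp only [Matrix.of_apply]
      rw [← e i, ← e j, hij]

lemma minorsOK_minA : minorsOK minA [] = true := by decide +kernel

lemma minorsOK_minD : minorsOK minD [frameD 0, frameD 1, frameD 2] = true := by decide +kernel

/-- Minors of a cell are at most one in absolute value. -/
lemma det_le_one {S : Finset Ray} (hS : (Vset S).Nontrivial) (v : Fin 4 → V4)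
    (hv : ∀ j, (v j).ray ∈ S) : (cols (v 0) (v 1) (v 2) (v 3)).det.natAbs ≤ 1 := by
  obtain ⟨M, hM, hSM⟩ := hS.nonempty
  obtain ⟨g, rfl | rfl⟩ := hM
  · have h1 : ∀ j, ∃ u ∈ minA, (v j).ray = g • u.ray := fun j => by
      obtain ⟨Y, hY, e⟩ := Finset.mem_smul_finset.mp (hSM (hv j))
      obtain ⟨u, hu, rfl⟩ := mem_rays.mp hY
      exact ⟨u, hu, e.symm⟩
    choose u hu e using h1
    rw [natAbs_det_cols g v u e]
    exact (minorsOK_spec minorsOK_minA u hu).resolve_right (by simp)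
  · have h1 : ∀ j, ∃ u ∈ minD, (v j).ray = g • u.ray := fun j => by
      obtain ⟨Y, hY, e⟩ := Finset.mem_smul_finset.mp (hSM (hv j))
      obtain ⟨u, hu, rfl⟩ := mem_rays.mp hY
      exact ⟨u, hu, e.symm⟩
    choose u hu e using h1
    rw [natAbs_det_cols g v u e]
    refine (minorsOK_spec minorsOK_minD u hu).resolve_right ?_
    rintro ⟨F, hF, h2⟩
    obtain ⟨i, hi3, rfl⟩ : ∃ i < 3, F = frameD i := by
      simp only [List.mem_cons, List.not_mem_nil, or_false] at hF
      rcases hF with rfl | rfl | rfl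
      exacts [⟨0, by omega, rfl⟩, ⟨1, by omega, rfl⟩, ⟨2, by omega, rfl⟩]
    obtain ⟨Y, hY, hYS⟩ := noFrame_of_nontrivial (vertexD.smul g) hS i hi3
    obtain ⟨hY1, hY2⟩ := VertexData.mem_frame _ |>.mp hY
    obtain ⟨X, hX, rfl⟩ := Finset.mem_smul_finset.mp hY1
    obtain ⟨w, hw, rfl⟩ := mem_rays.mp hX
    have hY3 : labD (g⁻¹ • g • w.ray) = i := hY2
    rw [inv_smul_smul] at hY3
    obtain ⟨j, h3⟩ := h2 w (mem_frameD w hw i hi3 hY3)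
    apply hYS
    rw [h3, ← e]
    exact hv j

/-- Quadruples of natural numbers, used for vectors modulo `9`. -/
structure N4 where
  a : ℕ
  b : ℕ
  c : ℕ
  d : ℕ

/-- The number of the point of the projective space over `ℤ/9` with given coordinates. -/
def enc (v : N4) : ℕ :=
  cond (Nat.beq (v.a % 3) 0)
    (cond (Nat.beq (v.b % 3) 0)
      (cond (Nat.beq (v.c % 3) 0)
        (1053 + 9 * (v.a * v.d ^ 5 % 9 / 3) + 3 * (v.b * v.d ^ 5 % 9 / 3) + v.c * v.d ^ 5 % 9 / 3)
        (972 + 27 * (v.a * v.c ^ 5 % 9 / 3) + 9 * (v.b * v.c ^ 5 % 9 / 3) + v.d * v.c ^ 5 % 9))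
      (729 + 81 * (v.a * v.b ^ 5 % 9 / 3) + 9 * (v.c * v.b ^ 5 % 9) + v.d * v.b ^ 5 % 9))
    (81 * (v.b * v.a ^ 5 % 9) + 9 * (v.c * v.a ^ 5 % 9) + v.d * v.a ^ 5 % 9)

/-- Coordinates of the point with given number. -/
def dig (n : ℕ) : N4 :=
  cond (Nat.blt n 729) ⟨1, n / 81, n / 9 % 9, n % 9⟩
    (cond (Nat.blt n 972) ⟨(n - 729) / 81 * 3, 1, (n - 729) / 9 % 9, (n - 729) % 9⟩
      (cond (Nat.blt n 1053) ⟨(n - 972) / 27 * 3, (n - 972) / 9 % 3 * 3, 1, (n - 972) % 9⟩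
        ⟨(n - 1053) / 9 % 3 * 3, (n - 1053) / 3 % 3 * 3, (n - 1053) % 3 * 3, 1⟩))

/-- Digits of a matrix modulo `9`, in hexadecimal. -/
def hd (h i : ℕ) : ℕ := h / 16 ^ i % 16

/-- The row vector with number `n` times the matrix `h`. -/
def rowMul (v : N4) (h : ℕ) : N4 :=
  ⟨(v.a * hd h 0 + v.b * hd h 4 + v.c * hd h 8 + v.d * hd h 12) % 9,
   (v.a * hd h 1 + v.b * hd h 5 + v.c * hd h 9 + v.d * hd h 13) % 9,
   (v.a * hd h 2 + v.b * hd h 6 + v.c * hd h 10 + v.d * hd h 14) % 9,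
   (v.a * hd h 3 + v.b * hd h 7 + v.c * hd h 11 + v.d * hd h 15) % 9⟩

/-- The right action of matrices on points. -/
def act (n h : ℕ) : ℕ := enc (rowMul (dig n) h)

/-- Decoding of an entry. -/
def hi (x : ℕ) : ℤ := cond (Nat.beq x 8) (-1) x

/-- The matrix with given digits. -/
def toM4 (h : ℕ) : M4 :=
  ⟨⟨hi (hd h 0), hi (hd h 1), hi (hd h 2), hi (hd h 3)⟩,
   ⟨hi (hd h 4), hi (hd h 5), hi (hd h 6), hi (hd h 7)⟩,
   ⟨hi (hd h 8), hi (hd h 9), hi (hd h 10), hi (hd h 11)⟩,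
   ⟨hi (hd h 12), hi (hd h 13), hi (hd h 14), hi (hd h 15)⟩⟩

lemma hi_modEq (x : ℕ) : hi x ≡ x [ZMOD 9] := by
  unfold hi
  by_cases h : x = 8
  · subst h; decide
  · have h1 : Nat.beq x 8 = false := by
      rw [← Bool.not_eq_true, Nat.beq_eq]; exact h
    rw [h1]; rfl

/-- Multiplication by two modulo `9`. -/
def N4.dbl (v : N4) : N4 := ⟨2 * v.a % 9, 2 * v.b % 9, 2 * v.c % 9, 2 * v.d % 9⟩

/-- Boolean equality. -/
def N4.eq (v w : N4) : Bool :=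
  Nat.beq v.a w.a && Nat.beq v.b w.b && Nat.beq v.c w.c && Nat.beq v.d w.d

/-- Coordinates that are not all divisible by three. -/
def N4.prim (v : N4) : Bool :=
  !(Nat.beq (v.a % 3) 0 && Nat.beq (v.b % 3) 0 && Nat.beq (v.c % 3) 0 && Nat.beq (v.d % 3) 0)

/-- The properties of `enc` and `dig` that we need. -/
def encOK (v : N4) : Bool :=
  !v.prim || (Nat.blt (enc v) 1080 && Nat.beq (enc v.dbl) (enc v) &&
    ((dig (enc v)).eq v || (dig (enc v)).eq v.dbl || (dig (enc v)).eq v.dbl.dbl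
      || (dig (enc v)).eq v.dbl.dbl.dbl || (dig (enc v)).eq v.dbl.dbl.dbl.dbl
      || (dig (enc v)).eq v.dbl.dbl.dbl.dbl.dbl))

/-- A Boolean test for all numbers less than `n`. -/
def allLT (n : ℕ) (p : ℕ → Bool) : Bool := Nat.rec true (fun k r => p k && r) n

lemma allLT_spec {n : ℕ} {p : ℕ → Bool} (h : allLT n p = true) : ∀ k < n, p k = true := by
  induction n with
  | zero => intro k hk; omega
  | succ n ih =>
    have h' : (p n && allLT n p) = true := h
    rw [Bool.and_eq_true] at h'
    intro k hk
    rcases Nat.lt_succ_iff_lt_or_eq.mp hk with hk | rfl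
    · exact ih h'.2 k hk
    · exact h'.1

lemma encOK_all : allLT 9 (fun a => allLT 9 fun b => allLT 9 fun c => allLT 9 fun d =>
    encOK ⟨a, b, c, d⟩) = true := by
  decide +kernel

lemma N4.eq_spec {v w : N4} (h : v.eq w = true) : v = w := by
  simp only [N4.eq, Bool.and_eq_true, Nat.beq_eq] at h
  obtain ⟨⟨⟨h1, h2⟩, h3⟩, h4⟩ := h
  cases v; cases w
  simp_all

/-- Reduction of an integral vector modulo `9`. -/
def redN (v : Fin 4 → ℤ) : N4 :=
  ⟨(v 0 % 9).toNat, (v 1 % 9).toNat, (v 2 % 9).toNat, (v 3 % 9).toNat⟩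

lemma toNat_emod_inj {x y : ℤ} (h : (x % 9).toNat = (y % 9).toNat) : x ≡ y [ZMOD 9] := by
  have := Int.emod_nonneg x (show (9 : ℤ) ≠ 0 by decide)
  have := Int.emod_nonneg y (show (9 : ℤ) ≠ 0 by decide)
  unfold Int.ModEq
  omega

lemma redN_eq {v w : Fin 4 → ℤ} : redN v = redN w ↔ ∀ j, v j ≡ w j [ZMOD 9] := by
  constructor
  · intro h j
    simp only [redN, N4.mk.injEq] at h
    obtain ⟨h0, h1, h2, h3⟩ := h
    fin_cases j
    exacts [toNat_emod_inj h0, toNat_emod_inj h1, toNat_emod_inj h2, toNat_emod_inj h3]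
  · intro h
    simp only [redN]
    rw [(h 0 : _ % _ = _), (h 1 : _ % _ = _), (h 2 : _ % _ = _), (h 3 : _ % _ = _)]

lemma dbl_redN (v : Fin 4 → ℤ) : (redN v).dbl = redN ((2 : ℤ) • v) := by
  simp only [redN, N4.dbl, Pi.smul_apply, smul_eq_mul, N4.mk.injEq]
  refine ⟨?_, ?_, ?_, ?_⟩ <;> omega

/-- A vector that is not divisible by three. -/
def Prim (v : Fin 4 → ℤ) : Prop := ∃ j, ¬(3 : ℤ) ∣ v j

lemma prim_redN {v : Fin 4 → ℤ} (h : Prim v) : (redN v).prim = true := by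
  obtain ⟨j, hj⟩ := h
  rw [N4.prim, Bool.not_eq_true', ← Bool.not_eq_true]
  simp only [redN, Bool.and_eq_true, Nat.beq_eq]
  rintro ⟨⟨⟨h0, h1⟩, h2⟩, h3⟩
  fin_cases j <;> simp only [Fin.zero_eta, Fin.mk_one, Fin.reduceFinMk] at hj <;> omega

lemma encOK_redN (v : Fin 4 → ℤ) : encOK (redN v) = true := by
  have h : ∀ x : ℤ, (x % 9).toNat < 9 := fun x => by omega
  exact allLT_spec (allLT_spec (allLT_spec (allLT_spec encOK_all _ (h _)) _ (h _)) _ (h _)) _ (h _)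

lemma Prim.smul {v : Fin 4 → ℤ} (h : Prim v) (k : ℕ) : Prim ((2 : ℤ) ^ k • v) := by
  obtain ⟨j, hj⟩ := h
  refine ⟨j, fun h => hj ?_⟩
  rw [Pi.smul_apply, smul_eq_mul] at h
  exact IsCoprime.dvd_of_dvd_mul_left (IsCoprime.pow_right (by norm_num)) h

lemma enc_spec {v : Fin 4 → ℤ} (h : Prim v) : enc (redN v) < 1080 ∧
    enc (redN ((2 : ℤ) • v)) = enc (redN v) ∧
    ∃ k : ℕ, dig (enc (redN v)) = redN ((2 : ℤ) ^ k • v) := by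
  have h1 := encOK_redN v
  simp only [encOK, prim_redN h, Bool.not_true, Bool.false_or, Bool.and_eq_true, Bool.or_eq_true,
    Nat.beq_eq, dbl_redN, smul_smul] at h1
  obtain ⟨⟨h2, h3⟩, h4⟩ := h1
  refine ⟨by simpa [Nat.blt] using h2, h3, ?_⟩
  rcases h4 with ((((h4 | h4) | h4) | h4) | h4) | h4
  · exact ⟨0, by rw [N4.eq_spec h4, pow_zero, one_smul]⟩
  · exact ⟨1, by rw [N4.eq_spec h4, pow_one]⟩
  · exact ⟨2, N4.eq_spec h4⟩
  · exact ⟨3, N4.eq_spec h4⟩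
  · exact ⟨4, N4.eq_spec h4⟩
  · exact ⟨5, N4.eq_spec h4⟩

lemma enc_smul {v : Fin 4 → ℤ} (h : Prim v) (k : ℕ) : enc (redN ((2 : ℤ) ^ k • v)) = enc (redN v) := by
  induction k with
  | zero => rw [pow_zero, one_smul]
  | succ k ih => rw [pow_succ', mul_smul, (enc_spec (h.smul k)).2.1, ih]

lemma toNat_sum (x y z w : ℤ) (a b c d : ℕ) (x' y' z' w' : ℤ) (ha : x' ≡ a [ZMOD 9])
    (hb : y' ≡ b [ZMOD 9]) (hc : z' ≡ c [ZMOD 9]) (hd : w' ≡ d [ZMOD 9]) :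
    ((x % 9).toNat * a + (y % 9).toNat * b + (z % 9).toNat * c + (w % 9).toNat * d) % 9 =
      ((x * x' + y * y' + z * z' + w * w') % 9).toNat := by
  have h : ∀ t : ℤ, ((t % 9).toNat : ℤ) = t % 9 := fun t => by omega
  zify
  rw [h, h, h, h, h]
  have e : ∀ t : ℤ, t % 9 ≡ t [ZMOD 9] := fun t => Int.mod_modEq t 9
  exact ((((e x).mul ha.symm).add ((e y).mul hb.symm)).add ((e z).mul hc.symm)).add
    ((e w).mul hd.symm)

lemma rowMul_redN (v : Fin 4 → ℤ) (h : ℕ) : rowMul (redN v) h = redN (v ᵥ* (toM4 h).mat) := by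
  have e : ∀ j, (v ᵥ* (toM4 h).mat) j = v 0 * (toM4 h).mat 0 j + v 1 * (toM4 h).mat 1 j +
      v 2 * (toM4 h).mat 2 j + v 3 * (toM4 h).mat 3 j := fun j => by
    simp only [Matrix.vecMul, dotProduct, Fin.sum_univ_four]
  simp only [rowMul, redN, e, N4.mk.injEq]
  refine ⟨toNat_sum _ _ _ _ _ _ _ _ _ _ _ _ ?_ ?_ ?_ ?_, toNat_sum _ _ _ _ _ _ _ _ _ _ _ _ ?_ ?_ ?_ ?_,
    toNat_sum _ _ _ _ _ _ _ _ _ _ _ _ ?_ ?_ ?_ ?_, toNat_sum _ _ _ _ _ _ _ _ _ _ _ _ ?_ ?_ ?_ ?_⟩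
  all_goals exact hi_modEq _

lemma prim_row (g : SL4) : Prim (g.1 3) := by
  by_contra h
  simp only [Prim, not_exists, not_not] at h
  have h1 : (g.1 * (g⁻¹).1) 3 3 = 1 := by
    rw [← Matrix.SpecialLinearGroup.coe_mul, mul_inv_cancel]; rfl
  rw [Matrix.mul_apply] at h1
  have h2 : (3 : ℤ) ∣ 1 := by
    rw [← h1]
    exact Finset.dvd_sum fun j _ => (h j).mul_right _
  norm_num at h2

/-- The point attached to a group element. -/
def code (g : SL4) : ℕ := enc (redN (g.1 3))

lemma code_lt (g : SL4) : code g < 1080 := (enc_spec (prim_row g)).1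

lemma row_mul (g h : SL4) : (g * h).1 3 = g.1 3 ᵥ* h.1 := by
  funext j
  rw [Matrix.SpecialLinearGroup.coe_mul, Matrix.mul_apply]
  rfl

lemma code_mul (g : SL4) (h : ℕ) (hd : (toM4 h).det = 1) :
    code (g * (toM4 h).sl hd) = act (code g) h := by
  obtain ⟨k, hk⟩ := (enc_spec (prim_row g)).2.2
  have h1 := prim_row (g * (toM4 h).sl hd)
  rw [act, code, code, hk, rowMul_redN, Matrix.smul_vecMul, ← enc_smul h1 k, row_mul]
  rfl

lemma mem_of_code {g g' : SL4} (h : code g = code g') : g' * g⁻¹ ∈ Gamma0 9 := by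
  obtain ⟨k, hk⟩ := (enc_spec (prim_row g)).2.2
  obtain ⟨l, hl⟩ := (enc_spec (prim_row g')).2.2
  rw [← code] at hk hl
  rw [h, hl, redN_eq] at hk
  intro j hj
  have e : ((g' * g⁻¹).1 3 j : ℤ) = (g'.1 3 ᵥ* (g⁻¹).1) j := by rw [← row_mul]; 
  have e1 : (g.1 3 ᵥ* (g⁻¹).1) j = 0 := by
    rw [← row_mul, mul_inv_cancel, Matrix.SpecialLinearGroup.coe_one, Matrix.one_apply_ne hj.symm]
  have h2 : (2 : ℤ) ^ l * (g' * g⁻¹).1 3 j ≡ 0 [ZMOD 9] := by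
    rw [e, ← mul_zero ((2 : ℤ) ^ k), ← e1]
    simp only [Matrix.vecMul, dotProduct, Finset.mul_sum]
    refine Int.ModEq.sum fun i _ => ?_
    rw [← mul_assoc, ← mul_assoc]
    exact (hk i).mul_right _
  rw [Int.modEq_zero_iff_dvd] at h2
  exact IsCoprime.dvd_of_dvd_mul_left (IsCoprime.pow_right (by norm_num)) h2

lemma exists_two_pow {u : ℤ} (h : ¬(3 : ℤ) ∣ u) : ∃ k : ℕ, u ≡ 2 ^ k [ZMOD 9] := by
  have : u % 9 = 1 ∨ u % 9 = 2 ∨ u % 9 = 4 ∨ u % 9 = 5 ∨ u % 9 = 7 ∨ u % 9 = 8 := by omega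
  rcases this with h | h | h | h | h | h
  exacts [⟨0, h⟩, ⟨1, h⟩, ⟨2, h⟩, ⟨5, h⟩, ⟨4, h⟩, ⟨3, h⟩]

lemma code_mul_left {γ : SL4} (hγ : γ ∈ Gamma0 9) (g : SL4) : code (γ * g) = code g := by
  have h0 : ∀ j : Fin 4, j ≠ 3 → (9 : ℤ) ∣ γ.1 3 j := hγ
  have h3 : ¬(3 : ℤ) ∣ γ.1 3 3 := by
    obtain ⟨j, hj⟩ := prim_row γ
    by_cases e : j = 3
    · rwa [e] at hj
    · exact absurd ((by norm_num : (3 : ℤ) ∣ 9).trans (h0 j e)) hj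
  obtain ⟨k, hk⟩ := exists_two_pow h3
  rw [code, code, ← enc_smul (prim_row g) k]
  congr 1
  rw [redN_eq]
  intro j
  rw [row_mul]
  simp only [Matrix.vecMul, dotProduct, Fin.sum_univ_four, Pi.smul_apply, smul_eq_mul]
  have e : ∀ i : Fin 4, i ≠ 3 → γ.1 3 i * g.1 i j ≡ 0 [ZMOD 9] := fun i hi =>
    Int.modEq_zero_iff_dvd.mpr ((h0 i hi).mul_right _)
  have := (((e 0 (by decide)).add (e 1 (by decide))).add (e 2 (by decide))).add (hk.mul_right (g.1 3 j))
  simpa using this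

/-- A matrix whose last row is the point with number `n`. -/
def liftM (n : ℕ) : M4 :=
  let v : V4 := ⟨(dig n).a, (dig n).b, (dig n).c, (dig n).d⟩
  cond (Nat.blt n 729) ⟨⟨0, -1, 0, 0⟩, ⟨0, 0, 1, 0⟩, ⟨0, 0, 0, 1⟩, v⟩
    (cond (Nat.blt n 972) ⟨⟨1, 0, 0, 0⟩, ⟨0, 0, 1, 0⟩, ⟨0, 0, 0, 1⟩, v⟩
      (cond (Nat.blt n 1053) ⟨⟨1, 0, 0, 0⟩, ⟨0, -1, 0, 0⟩, ⟨0, 0, 0, 1⟩, v⟩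
        ⟨⟨1, 0, 0, 0⟩, ⟨0, 1, 0, 0⟩, ⟨0, 0, 1, 0⟩, v⟩))

lemma liftM_ok : allLT 1080 (fun n => decide ((liftM n).det = 1) &&
    Nat.beq (enc ⟨((liftM n).r3.a % 9).toNat, ((liftM n).r3.b % 9).toNat,
      ((liftM n).r3.c % 9).toNat, ((liftM n).r3.d % 9).toNat⟩) n) = true := by
  decide +kernel

/-- A group element above the point with number `n`. -/
def lift (n : ℕ) : SL4 := if h : (liftM n).det = 1 then (liftM n).sl h else 1

lemma code_lift {n : ℕ} (hn : n < 1080) : code (lift n) = n := by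
  have h := allLT_spec liftM_ok n hn
  rw [Bool.and_eq_true, Nat.beq_eq] at h
  rw [lift, dif_pos (of_decide_eq_true h.1)]
  exact h.2

/-- A spanning set of rays contains four independent ones. -/
lemma exists_det_ne_zero {S : Finset Ray} (h : Spans S) (hr : ∀ X ∈ S, ∃ v : Fin 4 → ℤ, ray v = X) :
    ∃ v : Fin 4 → V4, (∀ j, (v j).ray ∈ S) ∧ (cols (v 0) (v 1) (v 2) (v 3)).det ≠ 0 := by
  let U : Set (Fin 4 → ℚ) := {u | ∃ v : V4, v.ray ∈ S ∧ u = fun i => (v.fn i : ℚ)}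
  have hU : Submodule.span ℚ U = ⊤ := by
    by_contra hne
    obtain ⟨f, hf, hle⟩ := Submodule.exists_le_ker_of_lt_top _ (lt_top_iff_ne_top.mpr hne)
    apply hf
    obtain ⟨b, hb⟩ := IsLocalization.exist_integer_multiples_of_finite (nonZeroDivisors ℤ)
      fun i : Fin 4 => f (Pi.single i 1)
    choose x hx using hb
    have hx' : ∀ i, (x i : ℚ) = (b : ℤ) * f (Pi.single i 1) := fun i => by
      have := hx i
      rwa [Algebra.smul_def, eq_intCast, eq_intCast] at this
    have hb0 : ((b : ℤ) : ℚ) ≠ 0 := by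
      exact_mod_cast nonZeroDivisors.ne_zero b.2
    have hx0 : x = 0 := by
      refine h x fun X hX => ?_
      obtain ⟨v, rfl⟩ := hr X hX
      rw [sqForm_ray, sq_eq_zero_iff]
      obtain ⟨w, rfl⟩ := V4.exists_fn v
      have h1 : f (fun i => (w.fn i : ℚ)) = 0 := hle (Submodule.subset_span ⟨w, hX, rfl⟩)
      have h2 : ((x ⬝ᵥ w.fn : ℤ) : ℚ) = (b : ℤ) * f (fun i => (w.fn i : ℚ)) := by
        rw [f.pi_apply_eq_sum_univ, Finset.mul_sum, dotProduct, Int.cast_sum]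
        refine Finset.sum_congr rfl fun i _ => ?_
        rw [Int.cast_mul, hx', smul_eq_mul]
        have e : (fun j => if i = j then (1 : ℚ) else 0) = Pi.single i 1 := by
          funext j
          simp [Pi.single_apply, eq_comm]
        rw [e]
        ring
      rw [h1, mul_zero] at h2
      exact_mod_cast h2
    refine LinearMap.pi_ext' fun i => LinearMap.ext_ring ?_
    have := hx' i
    rw [hx0, Pi.zero_apply, Int.cast_zero] at this
    exact (mul_eq_zero.mp this.symm).resolve_left hb0
  obtain ⟨b, hbU, hspan, hli⟩ := exists_linearIndependent ℚ U
  let B := Module.Basis.mk hli (by rw [Subtype.range_coe, hspan, hU])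
  let e := B.indexEquiv (Pi.basisFun ℚ (Fin 4))
  choose v hv hv' using fun j => hbU (e.symm j).2
  refine ⟨v, hv, ?_⟩
  have h1 : LinearIndependent ℚ (fun j => ((e.symm j : b) : Fin 4 → ℚ)) :=
    hli.comp e.symm e.symm.injective
  have h2 := Matrix.linearIndependent_cols_iff_isUnit (A := Matrix.of fun i j => ((v j).fn i : ℚ)) |>.mp
    (by
      rw [show (Matrix.of fun i j => ((v j).fn i : ℚ)).col = fun j => ((e.symm j : b) : Fin 4 → ℚ)
        from funext fun j => (hv' j).symm]
      exact h1)
  rw [Matrix.isUnit_iff_isUnit_det, isUnit_iff_ne_zero] at h2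
  rw [det_cols]
  intro h3
  apply h2
  have := congrArg (Int.castRingHom ℚ) h3
  rw [map_zero, RingHom.map_det] at this
  exact this

/-- The standard basis. -/
def basis4 : List V4 := [⟨1, 0, 0, 0⟩, ⟨0, 1, 0, 0⟩, ⟨0, 0, 1, 0⟩, ⟨0, 0, 0, 1⟩]

lemma cols_mulVec (a b c d : V4) : (cols a b c d).mulVec ⟨1, 0, 0, 0⟩ = a ∧
    (cols a b c d).mulVec ⟨0, 1, 0, 0⟩ = b ∧ (cols a b c d).mulVec ⟨0, 0, 1, 0⟩ = c ∧
    (cols a b c d).mulVec ⟨0, 0, 0, 1⟩ = d := by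
  simp [cols, M4.mulVec, V4.dot]

lemma IsCell.isRay {S : Finset Ray} (h : IsCell S) {X : Ray} (hX : X ∈ S) :
    ∃ v : V4, v.fn ≠ 0 ∧ v.ray = X := by
  obtain ⟨M, hM, hS⟩ := h.exists_vert
  obtain ⟨v, hv, e⟩ := hM.data.isRay X (hS hX)
  obtain ⟨w, rfl⟩ := V4.exists_fn v
  exact ⟨w, hv, e⟩

/-- Every cell contains a translate of the standard basis. -/
lemma IsCell.exists_basis {S : Finset Ray} (h : IsCell S) : ∃ g : SL4, g • rays basis4 ⊆ S := by
  obtain ⟨v, hv, hd⟩ := exists_det_ne_zero h.spans fun X hX => by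
    obtain ⟨v, -, e⟩ := h.isRay hX
    exact ⟨v.fn, e⟩
  have h1 := det_le_one h.nontrivial v hv
  have key : ∃ u : V4, u.ray ∈ S ∧ (cols u (v 1) (v 2) (v 3)).det = 1 := by
    have h2 : (cols (v 0) (v 1) (v 2) (v 3)).det = 1 ∨ (cols (v 0) (v 1) (v 2) (v 3)).det = -1 := by
      omega
    rcases h2 with h2 | h2
    · exact ⟨v 0, hv 0, h2⟩
    · refine ⟨(v 0).neg, by rw [V4.ray_neg]; exact hv 0, ?_⟩
      rw [← neg_eq_iff_eq_neg] at h2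
      rw [← h2]
      simp only [cols, M4.det, V4.neg]
      ring
  obtain ⟨u, hu, hd⟩ := key
  refine ⟨(cols u (v 1) (v 2) (v 3)).sl hd, fun Y hY => ?_⟩
  obtain ⟨X, hX, rfl⟩ := Finset.mem_smul_finset.mp hY
  obtain ⟨w, hw, rfl⟩ := mem_rays.mp hX
  rw [M4.sl_smul]
  obtain ⟨e0, e1, e2, e3⟩ := cols_mulVec u (v 1) (v 2) (v 3)
  simp only [basis4, List.mem_cons, List.not_mem_nil, or_false] at hw
  rcases hw with rfl | rfl | rfl | rfl
  · rwa [e0]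
  · rw [e1]; exact hv 1
  · rw [e2]; exact hv 2
  · rw [e3]; exact hv 3

/-- The vectors that complete the standard basis to a representative of an orbit of cells. -/
def extra : ℕ → List V4
  | 0 => []
  | 1 => [⟨1, 1, 0, 0⟩]
  | 2 => [⟨1, 1, 1, 0⟩]
  | 3 => [⟨1, 1, 1, 1⟩]
  | 4 => [⟨1, 1, 0, 0⟩, ⟨0, 0, 1, -1⟩]
  | 5 => [⟨1, 1, 0, 0⟩, ⟨0, 1, -1, -1⟩]
  | 6 => [⟨1, 1, 0, 0⟩, ⟨0, 1, -1, 0⟩]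
  | _ => [⟨1, 1, 1, 0⟩, ⟨0, 1, 1, -1⟩]

/-- Representatives of the orbits of cells with four, five and six rays. -/
def repL (t : ℕ) : List V4 := basis4 ++ extra t

/-- Data showing that the representatives are cells. -/
def wit : ℕ → M4 × M4 × V4
  | 0 =>
    (⟨⟨-1, -1, -1, -1⟩, ⟨0, 0, 0, 1⟩, ⟨0, 0, 1, 0⟩, ⟨0, 1, 0, 0⟩⟩,
     ⟨⟨-1, -1, -1, 0⟩, ⟨0, 0, 0, 1⟩, ⟨0, 0, 1, -1⟩, ⟨0, 1, 0, 0⟩⟩, ⟨0, -1, 0, 1⟩)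
  | 1 =>
    (⟨⟨-1, 0, -1, -1⟩, ⟨0, 0, 0, 1⟩, ⟨0, 0, 1, 0⟩, ⟨0, 1, 0, 0⟩⟩,
     ⟨⟨-1, 0, -1, 0⟩, ⟨0, 0, 0, 1⟩, ⟨0, 0, 1, -1⟩, ⟨0, 1, 0, 0⟩⟩, ⟨1, 0, 0, -1⟩)
  | 2 =>
    (⟨⟨-1, 0, 0, 0⟩, ⟨0, -1, 1, 0⟩, ⟨0, 0, 0, -1⟩, ⟨0, 1, 0, 0⟩⟩,
     ⟨⟨-1, 0, 0, 0⟩, ⟨0, -1, 1, 0⟩, ⟨0, 0, 0, -1⟩, ⟨0, 1, 0, 1⟩⟩, ⟨0, 1, 1, 1⟩)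
  | 3 =>
    (⟨⟨-1, 0, 0, 0⟩, ⟨0, -1, 0, 1⟩, ⟨0, 0, 1, 0⟩, ⟨0, 1, -1, 0⟩⟩,
     ⟨⟨-1, 0, 0, 0⟩, ⟨0, -1, 0, 1⟩, ⟨0, 0, 1, -1⟩, ⟨0, 1, 0, 0⟩⟩, ⟨0, 1, 1, 0⟩)
  | 4 =>
    (⟨⟨-1, 0, -1, -1⟩, ⟨0, 0, 0, 1⟩, ⟨0, 0, 1, 0⟩, ⟨0, 1, 0, 0⟩⟩,
     ⟨⟨-1, 0, -1, 0⟩, ⟨0, 0, 1, 1⟩, ⟨0, 0, 0, -1⟩, ⟨0, 1, 0, 0⟩⟩, ⟨1, 1, 0, -1⟩)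
  | 5 =>
    (⟨⟨-1, 0, 0, 0⟩, ⟨0, 0, -1, 0⟩, ⟨0, 0, 0, 1⟩, ⟨0, 1, 1, 0⟩⟩,
     ⟨⟨-1, 0, 0, 0⟩, ⟨0, 0, -1, 1⟩, ⟨0, 0, 1, 0⟩, ⟨0, 1, 0, 0⟩⟩, ⟨1, 1, -1, 0⟩)
  | 6 =>
    (⟨⟨-1, 0, 0, -1⟩, ⟨0, 0, -1, 0⟩, ⟨0, 0, 0, 1⟩, ⟨0, 1, 1, 0⟩⟩,
     ⟨⟨-1, 0, 0, 0⟩, ⟨0, 0, -1, -1⟩, ⟨0, 0, 0, 1⟩, ⟨0, 1, 1, 0⟩⟩, ⟨1, 0, 0, -1⟩)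
  | _ =>
    (⟨⟨-1, 0, 0, 0⟩, ⟨0, -1, 1, 0⟩, ⟨0, 0, 0, -1⟩, ⟨0, 1, 0, 1⟩⟩,
     ⟨⟨-1, 0, 0, 0⟩, ⟨0, -1, 1, 0⟩, ⟨0, 1, 0, 0⟩, ⟨0, 0, 0, 1⟩⟩, ⟨0, -1, 0, 1⟩)

/-- The sizes of the stabilizers, modulo `±1`. -/
def stabN : ℕ → ℕ
  | 0 => 96
  | 1 => 24
  | 2 => 24
  | 3 => 60
  | 4 => 72
  | 5 => 6
  | 6 => 8
  | _ => 24

/-- The elements of the stabilizers. -/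
def stabD : ℕ → ℕ
  | 0 => 1270747874668624346150595426350176723725041160271832875683618024614176153765133021377953939365445492495614393053095729727283914365163152203131788732853216635851166025836079786658369697367378185875339283557625693987370933292403134170453010168128134997739903047664552511493609621057101599232287431481498500272379276667296245530011453033299760776449348677980781877259975341665897988503272952650298951201103116519442536651784320154035469126429476141368283104902926925250956705832696347655155095012118576931451456492633484203319369458334647026617695910645599775809432075784996564955964756916140191015118459877284517726450808812693144432885184502973132315426276199242776818388512166230882935387941825223311597370058613146116425016377724261552801941324555020386535142173549240134234061358946462769331230548396406247222404769302579845379517327305381222125578552518283134786400297651572411648580071260343486007921293746387630883371046389129102778164372685513365700820270735615613674047827327268492921384773340877642825933411796886250630461382626258244457454068228251650574951978152011214535463845013783675229843537656353163973230085485513953493708267738269946634726712784688843176486137045619383101002892944278445565324706741298695320575162133606209307006895504789926670454270345923534953708987792717326970474529963087333018155778399593771827834854912861382198349738028749738576610598875827603325864494574606198718293425995194052168505826503514398345513291557173205389678488969966290148579586879225212529310286038073534667144139385378899775288473008065053663118398677893629490010524591625738019233549120023526066183349294563261846758720806224525830779582891937205124322705136346871020155782615934073629777232716482027515263740508973304853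071657862151282448834788431290621074492650758801276938206672475226610937973120088246928386600087483785266793128637919827136020504464311820512933667519132851616975970564835466998318680265467104357825789670391129953469086463991742465
  | 1 => 373068841593497952440886699030978669046848865444501835025209187220386028337243041248893456265950378619226727528787046710477032219276345322428135159429620236235756401210201718381724124018995012520582541171996250273885246661622353800721321959035555615977879952038741793119292568073165328221878481379767453423963090287089631222671458516947956452096752085378419762361221910094794625765417081629852261785172904831547000698896876870532584392024094945458330093137506428374300912032907219927302145
  | 2 => 5967644879510442618336457767720477244485186626608388543551529445545054328794138930259138285255717016576105606744557330430255231213909910533480825694690293568626857238672751665634912050049918065803139939114406999579769251844180251788589072388185795843193344927216754240892290022924287126432931842105358151893761600843534491853211035470006786243759787497767842359601572125353933743094772058925508986909579178270458488093904371688721587613630230637777292795574193826481071905012345652372307969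
  | 3 => 1960999023274758144992770981404481175652435389621092409586793587203885213107410173165639539111599197364822873522934711490830915306608919161383754168365690496945444044027961420786579947777952295377959819940074261845399198427140359595221600907416769880193672222567556899281676411260095049897328170750456118190896631048126490263455408725426617018881220096198480220121531737223383605903030684756702425992370326691549255323782147540928633000637311188493776048466726179324715148093347648112748294720609459158198127141825535650682852318158824037356434667485836816410912896858696379472851719709436728641547274402265640530433702557495309663351682898088398896790199477663179874367751121963342603367761376552021364090359285067596310294590980158340244273594103687664760263809205962890928684888069217620940253793763809399094750973653992452164595137109055259334072360805763454153432826262023055994210694976864536921323509880695420337913236769847955146563828102447916705612622798951308852329748756561164838302919042622554927288539036406132350099648084957894499828406336798445342889315243182367464312172315181856698216889126696103529272940376016313310993882306001098037553048201295520017386828828527699931614121942653488455350748450529476609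
  | 4 => 435409401893942687802264072110966241019032800732520340482219585917964883539320417395060669419479967894613219775231300216181197939410910896813236145688935417895998899593635157440161689747990800602878672527651015060378293265318054467372541442715265578619313529944476479278786388086522055044696949182052215537349045569871106659567672211262993840658933397024537393174335147546528947999641683455217659189540297519105072189018625603351727323644425414100259647940126009442868771202816613066391830439852353545753580314002039231132310181902201325649328726726497703426299915280322659816503801316579229719661480853746903368424411748009195508537124046163268092663549475751176170804429057979847022089918825218170066508536405827011677812963111625842112504747902204244937323123262813230977587760079379771413063464670448995689240157067334240442873440134291794734620194057531440938794974625362943006567405777629753598201240617024861846453991172524685979106211474488602418251122718473668218545623325041836039394200086961128137696512702035176746798421011301731428307327969705565291341577282429223094192160805497987235151699878400731083207810371656109443126751979233603559655022250146199736109977151981574605608848315410726547081643360971018172586248666812989236859256567200040218389047936721020657946757845112282309989313763542774354756226753902289424141328326906164318189056083590298532482137217012742430456262763061522921570254483119963304085570033362119922238638617252013609731263904612353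
  | 5 => 20819392105020636356168584086904954299026108480280619644376443413068321522095642113405337118063580706803185871859246694401
  | 6 => 224945696458900790563110711252336126282733618660324003517750660688015036247122681973307527654061741387562057697080778905491293669600676446443031500680260716855297
  | _ => 1457304336274971366092636703158159313368316560767149937362054158427211663690284502543419233694082600424086768656605278228338379495573319171839277815486029700108418349007645974616168706127625868221408654219783441049778047443718795819744523197181368177869943976700326910070013462862871077112062258193733188668743932472873615510869756493356930270351527929597408974813160492616385986360429215564077340343537778888801763168957328002221843039719966544158450324711172574428964835308410437107713

/-- The numbers of cofaces. -/
def cofN : ℕ → ℕ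
  | 0 => 36
  | 1 => 26
  | 2 => 17
  | _ => 10

/-- The cofaces. -/
def cofD : ℕ → ℕ
  | 0 => 30686475855703969223055802356874885816193886611739494237602077108255925752430257299781082158959655652005213521377949126045814754825172876402412542534137639816307643779363016094367684336331366603064517172320515250643510567514946766013576450766772689757427123289195675753331954944093205705440653294173227003811439910814219082763243647790157256340467571606162147454784337996719238656821065142947780231114197488700678159258113231187206145460133962959228429727605199468200905305064607951658776241866385718498065135406180717696052590442418787310201947369675704050410702136754017344366965531878922893659594459431738032640214107553865377439229388269788014812254085706189894041397550842359218088686148719062676922666617955632129828981742199966875772286583184603974695663716870007632688838902767989115106403595161035458947883700674117021787822206269822280305297763185638201377000299523685069903271561495194846257938850904379707264877503760120521558367749089001728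
  | 1 => 3806831729667879281263106335472260214733693535045644914836041323611382158176025703691953169416213167272360867589329782867416223280470126600552303056219854202407282296975987439539893228186467830979474162877649562891023657851866085400087010158460450833713779203394793837514639341513071544857751041125583724247187386339932688133169865763458674214280104874489930243835302245243120892619709063521994793371570451826300151108689699571634834133786900896331718451218241027895546365429097091225950486707761748760349861756740326871460110580484904712660273732010625788336899637060714621787019444870152818846348370977361393553489470568423872960721819802261242731819971862817624284619984807956710424832
  | 2 => 146152779202355803227788291796860799106277510719013575153630646146442063695969053888934885169466285361843200087961430304608578812670241556440161620031805037965746746032858473435037475698597094918041416102014330687641497541490870473971559748835530875783672042928548968836202664238679422572814688397266751368631805086982481851317978945737724988198997199758782426330798637975093940273505604675165963557568456797791976758313205948551918121536866469576960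
  | _ => 33618300006371236828839173194823042852795445935289156116286522511351805066524709599774897661082671130670622807221888908153838289896067109811685146581858606797107908874062593832909635140326647906892371687356248797914672568588686036198035543883032570119576598118656

/-- The matrix of an element of the stabilizer. -/
def stabH (t i : ℕ) : ℕ := stabD t / 16 ^ (17 * i) % 16 ^ 16

/-- The sign with which an element of the stabilizer acts on the orientation. -/
def stabS (t i : ℕ) : ℤ := cond (Nat.beq (stabD t / 16 ^ (17 * i + 16) % 16) 0) 1 (-1)

/-- The matrix identifying a coface with a representative. -/
def cofH (t i : ℕ) : ℕ := cofD t / 16 ^ (22 * i) % 16 ^ 16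

/-- The sign with which the identification acts on the orientation. -/
def cofS (t i : ℕ) : ℤ := cond (Nat.beq (cofD t / 16 ^ (22 * i + 16) % 16) 0) 1 (-1)

/-- The type of a coface. -/
def cofT (t i : ℕ) : ℕ := cofD t / 16 ^ (22 * i + 17) % 16

/-- The additional vector of a coface. -/
def cofW (t i : ℕ) : V4 :=
  ⟨hi (cofD t / 16 ^ (22 * i + 18) % 16), hi (cofD t / 16 ^ (22 * i + 19) % 16),
   hi (cofD t / 16 ^ (22 * i + 20) % 16), hi (cofD t / 16 ^ (22 * i + 21) % 16)⟩

lemma stab_ok : allLT 8 (fun t => allLT (stabN t) fun i => decide ((toM4 (stabH t i)).det = 1) &&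
    decide (psgn ((repL t).map (toM4 (stabH t i)).mulVec) (repL t) = stabS t i)) = true := by
  decide +kernel

lemma cof_ok : allLT 4 (fun t => allLT (cofN t) fun i => decide ((toM4 (cofH t i)).det = 1) &&
    decide (psgn ((repL (cofT t i)).map (toM4 (cofH t i)).mulVec) (cofW t i :: repL t) = cofS t i) &&
    Nat.blt (cofT t i) 8 && (repL t).all (fun u => !(cofW t i).pm u) &&
    allLT i (fun j => !(cofW t j).pm (cofW t i))) = true := by
  decide +kernel

lemma stabS_ne_zero (t i : ℕ) : stabS t i ≠ 0 := by
  unfold stabS; cases Nat.beq _ _ <;> simp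

lemma cofS_ne_zero (t i : ℕ) : cofS t i ≠ 0 := by
  unfold cofS; cases Nat.beq _ _ <;> simp

/-- Vectors that are pairwise distinct up to sign. -/
def nodupPM : List V4 → Bool
  | [] => true
  | v :: l => l.all (fun w => !v.pm w) && nodupPM l

lemma nodupPM_spec : ∀ {l : List V4}, nodupPM l = true → (l.map V4.ray).Nodup
  | [], _ => List.nodup_nil
  | v :: l, h => by
    rw [nodupPM, Bool.and_eq_true, List.all_eq_true] at h
    rw [List.map_cons, List.nodup_cons]
    refine ⟨fun h1 => ?_, nodupPM_spec h.2⟩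
    obtain ⟨w, hw, e⟩ := List.mem_map.mp h1
    have := h.1 w hw
    rw [V4.pm_iff.mpr e.symm] at this
    exact absurd this (by decide)

lemma rep_ok : allLT 8 (fun t => nodupPM (repL t)
    && decide ((wit t).1.det = 1) && decide ((wit t).2.1.det = 1)
    && (repL t).all (fun u => decide (qA ((wit t).1.mulVec u) = 1) && decide (qA ((wit t).2.1.mulVec u) = 1))
    && decide (qA ((wit t).1.mulVec (wit t).2.2) = 1)
    && !decide (qA ((wit t).2.1.mulVec (wit t).2.2) = 1)) = true := by
  decide +kernel

lemma repL_nodup {t : ℕ} (ht : t < 8) : ((repL t).map V4.ray).Nodup := by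
  have := allLT_spec rep_ok t ht
  simp only [Bool.and_eq_true] at this
  exact nodupPM_spec this.1.1.1.1.1

lemma rlist_nodup {l : List V4} (h : (l.map V4.ray).Nodup) (g : SL4) : (rlist g l).Nodup := by
  have : rlist g l = (l.map V4.ray).map (g • ·) := by
    rw [rlist, List.map_map]; rfl
  rw [this]
  exact h.map (MulAction.injective g)

lemma qA_of_mem {v : V4} (h : v.ray ∈ rays minA) : qA v = 1 := by
  obtain ⟨w, hw, e⟩ := mem_rays.mp h
  rw [← formA_ray, ← e, formA_ray]
  exact qA_minA w hw

lemma vset_repL {t : ℕ} (ht : t < 8) : (Vset (rays (repL t))).Nontrivial := by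
  have := allLT_spec rep_ok t ht
  simp only [Bool.and_eq_true, decide_eq_true_eq, List.all_eq_true, Bool.not_eq_true',
    decide_eq_false_iff_not] at this
  obtain ⟨⟨⟨⟨⟨-, h1⟩, h2⟩, h3⟩, h4⟩, h5⟩ := this
  have key : ∀ (m : M4) (h : m.det = 1), (∀ u ∈ repL t, qA (m.mulVec u) = 1) →
      (m.sl h)⁻¹ • rays minA ∈ Vset (rays (repL t)) := fun m h hm => by
    refine ⟨⟨_, Or.inl rfl⟩, fun X hX => ?_⟩
    obtain ⟨u, hu, rfl⟩ := mem_rays.mp hX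
    rw [Finset.mem_inv_smul_finset_iff, M4.sl_smul]
    exact mem_of_qA _ (hm u hu)
  refine ⟨_, key _ h1 fun u hu => (h3 u hu).1, _, key _ h2 fun u hu => (h3 u hu).2, fun e => h5 ?_⟩
  have h6 : (wit t).2.2.ray ∈ ((wit t).1.sl h1)⁻¹ • rays minA := by
    rw [Finset.mem_inv_smul_finset_iff, M4.sl_smul]
    exact mem_of_qA _ h4
  rw [e, Finset.mem_inv_smul_finset_iff, M4.sl_smul] at h6
  exact qA_of_mem h6

/-- Parallelogram law. -/
lemma ray_add_ray (v w : Fin 4 → ℤ) :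
    ray (v - w) + ray (v + w) = ray v + ray v + ray w + ray w := by
  refine Ray.ext' fun i j => ?_
  simp only [Ray.add_apply, ray_apply, Pi.add_apply, Pi.sub_apply]
  ring

lemma minA_diff : ∀ b ∈ minA, b ∈ basis4 ∨ ∃ u ∈ basis4, ∃ v ∈ basis4,
    b = ⟨u.a - v.a, u.b - v.b, u.c - v.c, u.d - v.d⟩ ∧
    (⟨u.a + v.a, u.b + v.b, u.c + v.c, u.d + v.d⟩ : V4) ≠ ⟨0, 0, 0, 0⟩ := by
  decide

lemma isCell_basis4 : IsCell (rays basis4) where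
  spans x hx := by
    have h : ∀ v ∈ basis4, x ⬝ᵥ v.fn = 0 := fun v hv => by
      have := hx _ (mem_rays.mpr ⟨v, hv, rfl⟩)
      rwa [V4.ray, sqForm_ray, sq_eq_zero_iff] at this
    simp only [basis4, List.forall_mem_cons, V4.fn, dotProduct, Fin.sum_univ_four] at h
    funext i
    fin_cases i <;> simp_all
  finite := by
    refine (finite_vheight_le (∑ b ∈ rays minA, genericWeight b * 3)).subset ?_
    rintro M ⟨hM, hS⟩
    refine ⟨hM, ?_⟩
    rw [vheight_eq hM, height]
    refine Finset.sum_le_sum fun b hb => mul_le_mul_of_nonneg_left ?_ (genericWeight_pos b).le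
    have h1 : ∀ u ∈ basis4, hM.data.form u.ray = 1 := fun u hu =>
      hM.data.form_eq_one _ (hS (mem_rays.mpr ⟨u, hu, rfl⟩))
    obtain ⟨v, hv, rfl⟩ := mem_rays.mp hb
    have h2 : hM.data.form v.ray ≤ 3 := by
      rcases minA_diff v hv with h | ⟨u, hu, w, hw, rfl, h⟩
      · rw [h1 v h]; decide
      · have e1 : (⟨u.a - w.a, u.b - w.b, u.c - w.c, u.d - w.d⟩ : V4).fn = u.fn - w.fn := by
          funext i; fin_cases i <;> rfl
        have e2 : (⟨u.a + w.a, u.b + w.b, u.c + w.c, u.d + w.d⟩ : V4).fn = u.fn + w.fn := by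
          funext i; fin_cases i <;> rfl
        have h3 := congrArg hM.data.form (ray_add_ray u.fn w.fn)
        have h4 := hM.data.one_le_form (u.fn + w.fn) (by
          rw [← e2]; exact fun h5 => h (V4.fn_eq_zero h5))
        have h5 := h1 u hu
        have h6 := h1 w hw
        rw [V4.ray] at h5 h6
        simp only [map_add, h5, h6] at h3
        rw [V4.ray, e1]
        omega
    exact_mod_cast h2
  nontrivial := vset_repL (t := 0) (by decide)

lemma basis4_subset (t : ℕ) : rays basis4 ⊆ rays (repL t) := fun X hX => by
  obtain ⟨v, hv, rfl⟩ := mem_rays.mp hX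
  exact mem_rays.mpr ⟨v, List.mem_append_left _ hv, rfl⟩

lemma isCell_repL {t : ℕ} (ht : t < 8) : IsCell (rays (repL t)) :=
  isCell_basis4.of_subset (basis4_subset t) subset_rfl (vset_repL ht)

lemma card_repL {t : ℕ} (ht : t < 8) : (rays (repL t)).card = (repL t).length := by
  rw [rays, List.toFinset_card_of_nodup (repL_nodup ht), List.length_map]

lemma isKCell_repL {t : ℕ} (ht : t < 8) {k : ℕ} (hk : (repL t).length + k = 9) (g : SL4) :
    IsKCell (k + 1) (g • rays (repL t)) :=
  (isKCell_succ.mpr ⟨isCell_repL ht, by rw [card_repL ht, hk]⟩).smul g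

/-- The determinant of the sum of a set of forms. -/
def dsum (S : Finset Ray) : ℤ := Matrix.det (∑ X ∈ S, X : Ray)

lemma dsum_smul (g : SL4) (S : Finset Ray) : dsum (g • S) = dsum S := by
  have h : (∑ X ∈ g • S, X : Ray) = g • ∑ X ∈ S, X := by
    rw [sum_smul_finset g S fun X => X, Finset.smul_sum]
  rw [dsum, dsum, h]
  change Matrix.det (congruence g.1 (∑ X ∈ S, X) : Matrix (Fin 4) (Fin 4) ℤ) = _
  rw [congruence, Matrix.det_mul, Matrix.det_mul, Matrix.det_transpose, g.2, one_mul, mul_one]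
  rfl

/-- The sum of the forms attached to vectors. -/
def sumM : List V4 → M4
  | [] => ⟨⟨0, 0, 0, 0⟩, ⟨0, 0, 0, 0⟩, ⟨0, 0, 0, 0⟩, ⟨0, 0, 0, 0⟩⟩
  | v :: l =>
    ⟨⟨v.a * v.a + (sumM l).r0.a, v.a * v.b + (sumM l).r0.b, v.a * v.c + (sumM l).r0.c,
      v.a * v.d + (sumM l).r0.d⟩,
     ⟨v.b * v.a + (sumM l).r1.a, v.b * v.b + (sumM l).r1.b, v.b * v.c + (sumM l).r1.c,
      v.b * v.d + (sumM l).r1.d⟩,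
     ⟨v.c * v.a + (sumM l).r2.a, v.c * v.b + (sumM l).r2.b, v.c * v.c + (sumM l).r2.c,
      v.c * v.d + (sumM l).r2.d⟩,
     ⟨v.d * v.a + (sumM l).r3.a, v.d * v.b + (sumM l).r3.b, v.d * v.c + (sumM l).r3.c,
      v.d * v.d + (sumM l).r3.d⟩⟩

lemma sumM_mat : ∀ l : List V4, (l.map V4.ray).sum = (sumM l).mat
  | [] => by
    refine Ray.ext' fun i j => ?_
    fin_cases i <;> fin_cases j <;> rfl
  | v :: l => by
    rw [List.map_cons, List.sum_cons, sumM_mat l]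
    refine Ray.ext' fun i j => ?_
    fin_cases i <;> fin_cases j <;> rfl

lemma dsum_repL {t : ℕ} (ht : t < 8) : dsum (rays (repL t)) = (sumM (repL t)).det := by
  rw [dsum, rays, ← M4.det_mat, ← sumM_mat, List.sum_toFinset (fun X => X) (repL_nodup ht), List.map_id']

lemma type_ok : allLT 8 (fun t => allLT t fun t' =>
    !decide ((sumM (repL t)).det = (sumM (repL t')).det)) = true := by
  decide +kernel

/-- Representatives of different types lie in different orbits. -/
lemma eq_type {t t' : ℕ} (ht : t < 8) (ht' : t' < 8) {g g' : SL4}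
    (h : g • rays (repL t) = g' • rays (repL t')) : t = t' := by
  have h1 := congrArg dsum h
  rw [dsum_smul, dsum_smul, dsum_repL ht, dsum_repL ht'] at h1
  by_contra hne
  rcases lt_or_gt_of_ne hne with h2 | h2
  · have := allLT_spec (allLT_spec type_ok t' ht') t h2
    simp [h1] at this
  · have := allLT_spec (allLT_spec type_ok t ht) t' h2
    simp [h1] at this

/-- The classification of the vectors that may extend a representative. -/
def cofOK (t : ℕ) (w : V4) : Bool :=
  decide (w = ⟨0, 0, 0, 0⟩) || (repL t).any w.pm || !allLT (cofN t) (fun i => !w.pm (cofW t i)) ||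
    (extra t).any fun x => basis4.any fun a => basis4.any fun b =>
      decide (1 < (cols w x a b).det.natAbs)

lemma cofOK_all : allLT 4 (fun t => allLT 3 fun a => allLT 3 fun b => allLT 3 fun c => allLT 3 fun d =>
    cofOK t ⟨a - 1, b - 1, c - 1, d - 1⟩) = true := by
  decide +kernel

lemma exists_of_not_allLT {p : ℕ → Bool} {n : ℕ} (h : (!allLT n fun i => !p i) = true) :
    ∃ i < n, p i = true := by
  induction n with
  | zero => exact absurd h Bool.false_ne_true
  | succ n ih =>
    have h' : (!(!p n && allLT n fun i => !p i)) = true := h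
    rw [Bool.not_and, Bool.not_not, Bool.or_eq_true] at h'
    rcases h' with h' | h'
    · exact ⟨n, n.lt_succ_self, h'⟩
    · obtain ⟨i, hi, e⟩ := ih h'
      exact ⟨i, hi.trans n.lt_succ_self, e⟩

lemma eq_coface {t : ℕ} (ht : t < 4) {T : Finset Ray} (hT : IsCell T) (hS : rays (repL t) ⊆ T)
    {w : V4} (hw : w.ray ∈ T) (h0 : w.fn ≠ 0) (hn : w.ray ∉ rays (repL t)) :
    ∃ i < cofN t, w.ray = (cofW t i).ray := by
  have hb : ∀ u ∈ basis4, u.ray ∈ T := fun u hu =>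
    hS (basis4_subset t (mem_rays.mpr ⟨u, hu, rfl⟩))
  have hx : ∀ u ∈ extra t, u.ray ∈ T := fun u hu =>
    hS (mem_rays.mpr ⟨u, List.mem_append_right _ hu, rfl⟩)
  have hdet : ∀ x y z : V4, x.ray ∈ T → y.ray ∈ T → z.ray ∈ T →
      (cols w x y z).det.natAbs ≤ 1 := fun x y z h1 h2 h3 =>
    det_le_one hT.nontrivial ![w, x, y, z] (by
      intro j; fin_cases j; exacts [hw, h1, h2, h3])
  have e1 : (⟨1, 0, 0, 0⟩ : V4).ray ∈ T := hb _ (by decide)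
  have e2 : (⟨0, 1, 0, 0⟩ : V4).ray ∈ T := hb _ (by decide)
  have e3 : (⟨0, 0, 1, 0⟩ : V4).ray ∈ T := hb _ (by decide)
  have e4 : (⟨0, 0, 0, 1⟩ : V4).ray ∈ T := hb _ (by decide)
  have ha := hdet _ _ _ e2 e3 e4
  have hb' := hdet _ _ _ e1 e3 e4
  have hc := hdet _ _ _ e1 e2 e4
  have hd := hdet _ _ _ e1 e2 e3
  obtain ⟨a, b, c, d⟩ := w
  simp only [cols, M4.det] at ha hb' hc hd
  have hr : ∀ x : ℤ, x.natAbs ≤ 1 → ∃ n < 3, x = ((n : ℕ) : ℤ) - 1 := fun x hx =>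
    ⟨(x + 1).toNat, by omega, by omega⟩
  obtain ⟨a, ha3, rfl⟩ := hr a (by ring_nf at ha ⊢; omega)
  obtain ⟨b, hb3, rfl⟩ := hr b (by ring_nf at hb' ⊢; omega)
  obtain ⟨c, hc3, rfl⟩ := hr c (by ring_nf at hc ⊢; omega)
  obtain ⟨d, hd3, rfl⟩ := hr d (by ring_nf at hd ⊢; omega)
  have h := allLT_spec (allLT_spec (allLT_spec (allLT_spec (allLT_spec cofOK_all t ht) a ha3) b hb3)
    c hc3) d hd3
  simp only [cofOK, Bool.or_eq_true] at h
  rcases h with ((h | h) | h) | h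
  · refine absurd ?_ h0
    rw [decide_eq_true_eq] at h
    rw [h]
    funext i; fin_cases i <;> rfl
  · obtain ⟨u, hu, e⟩ := List.any_eq_true.mp h
    exact absurd (mem_rays.mpr ⟨u, hu, (V4.pm_iff.mp e).symm⟩) hn
  · obtain ⟨i, hi, e⟩ := exists_of_not_allLT h
    exact ⟨i, hi, V4.pm_iff.mp e⟩
  · obtain ⟨x, hx', h⟩ := List.any_eq_true.mp h
    obtain ⟨u, hu, h⟩ := List.any_eq_true.mp h
    obtain ⟨v, hv, h⟩ := List.any_eq_true.mp h
    rw [decide_eq_true_eq] at h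
    exact absurd h (not_lt.mpr (hdet _ _ _ (hx x hx') (hb u hu) (hb v hv)))

lemma cofaces {t : ℕ} (ht : t < 4) {k : ℕ} (g : SL4) {T : Finset Ray} (hT : IsKCell (k + 1) T)
    (hS : g • rays (repL t) ⊆ T) (hc : T.card = (repL t).length + 1) :
    ∃ i < cofN t, T = insert (g • (cofW t i).ray) (g • rays (repL t)) := by
  have hT' := (isKCell_succ.mp (hT.smul g⁻¹)).1
  have hS' : rays (repL t) ⊆ g⁻¹ • T := by
    rw [← Finset.smul_finset_subset_iff]; exact hS
  have hc' : (g⁻¹ • T).card = (rays (repL t)).card + 1 := by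
    rw [Finset.card_smul_finset, card_repL (ht.trans (by decide)), hc]
  obtain ⟨X, hX, e⟩ := Finset.exists_eq_insert_iff.mpr ⟨hS', hc'.symm⟩
  have hXT : X ∈ g⁻¹ • T := by rw [← e]; exact Finset.mem_insert_self _ _
  obtain ⟨w, hw, rfl⟩ := hT'.isRay hXT
  obtain ⟨i, hi, e'⟩ := eq_coface ht hT' hS' hXT hw hX
  refine ⟨i, hi, ?_⟩
  rw [← Finset.smul_finset_insert, ← e', e, smul_inv_smul]

lemma rays_cons (v : V4) (l : List V4) : rays (v :: l) = insert v.ray (rays l) := by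
  rw [rays, rays, List.map_cons, List.toFinset_cons]

lemma toFinset_eq_of_psgn {l m : List V4} (g : SL4) (h : psgn l m ≠ 0) (hn : (rlist g m).Nodup) :
    g • rays l = g • rays m := by
  rw [← rlist_toFinset, ← rlist_toFinset]
  exact List.toFinset_eq_of_perm _ _ (rlist_psgn g h hn).1.symm

lemma cof_spec {t i : ℕ} (ht : t < 4) (hi : i < cofN t) : ∃ _ : (toM4 (cofH t i)).det = 1,
    cofT t i < 8 ∧
    psgn ((repL (cofT t i)).map (toM4 (cofH t i)).mulVec) (cofW t i :: repL t) = cofS t i ∧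
    ((cofW t i :: repL t).map V4.ray).Nodup ∧ ∀ j < i, (cofW t j).ray ≠ (cofW t i).ray := by
  have h := allLT_spec (allLT_spec cof_ok t ht) i hi
  simp only [Bool.and_eq_true, decide_eq_true_eq, Nat.blt_eq, List.all_eq_true,
    Bool.not_eq_true'] at h
  obtain ⟨⟨⟨⟨h1, h2⟩, h3⟩, h4⟩, h5⟩ := h
  refine ⟨h1, h3, h2, ?_, fun j hj e => ?_⟩
  · rw [List.map_cons, List.nodup_cons]
    refine ⟨fun h => ?_, repL_nodup (ht.trans (by decide))⟩
    obtain ⟨u, hu, e⟩ := List.mem_map.mp h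
    have := h4 u hu
    rw [V4.pm_iff.mpr e.symm] at this
    exact absurd this (by decide)
  · have := allLT_spec h5 j hj
    rw [V4.pm_iff.mpr e] at this
    exact absurd this (by decide)

lemma rays_map_mulVec (m : M4) (h : m.det = 1) (l : List V4) :
    rays (l.map m.mulVec) = m.sl h • rays l := by
  rw [← rlist_toFinset, ← one_mul (m.sl h), ← rlist_mulVec, rlist_toFinset, one_smul]

/-- Cofaces are translates of representatives. -/
lemma insert_cof {t i : ℕ} (ht : t < 4) (hi : i < cofN t) (hd : (toM4 (cofH t i)).det = 1) (g : SL4) :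
    insert (g • (cofW t i).ray) (g • rays (repL t)) =
      (g * (toM4 (cofH t i)).sl hd) • rays (repL (cofT t i)) := by
  obtain ⟨_, -, h1, h2, -⟩ := cof_spec ht hi
  rw [← Finset.smul_finset_insert, ← rays_cons, mul_smul, ← rays_map_mulVec]
  exact (toFinset_eq_of_psgn g (by rw [h1]; exact cofS_ne_zero _ _) (rlist_nodup h2 g)).symm

lemma cell_eq_six (S : Cell 6) : ∃ g : SL4, S.1 = g • rays (repL 0) := by
  obtain ⟨hc, hk⟩ := isKCell_succ.mp S.2
  obtain ⟨g, hg⟩ := hc.exists_basis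
  refine ⟨g, (Finset.eq_of_subset_of_card_le hg ?_).symm⟩
  rw [Finset.card_smul_finset]
  change S.1.card ≤ (rays (repL 0)).card
  rw [card_repL (by decide)]
  change S.1.card ≤ 4
  omega

lemma cofT_zero : allLT (cofN 0) (fun i => Nat.blt 0 (cofT 0 i) && Nat.blt (cofT 0 i) 4) = true := by
  decide +kernel

lemma cell_eq_five (S : Cell 5) : ∃ t, 0 < t ∧ t < 4 ∧ ∃ g : SL4, S.1 = g • rays (repL t) := by
  obtain ⟨hc, hk⟩ := isKCell_succ.mp S.2
  obtain ⟨g, hg⟩ := hc.exists_basis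
  obtain ⟨i, hi, e⟩ := cofaces (t := 0) (by decide) g S.2 hg (by
    change _ = 5
    omega)
  obtain ⟨hd, -⟩ := cof_spec (by decide) hi
  rw [insert_cof (by decide) hi hd] at e
  have h := allLT_spec cofT_zero i hi
  rw [Bool.and_eq_true, Nat.blt_eq, Nat.blt_eq] at h
  exact ⟨_, h.1, h.2, _, e⟩

/-- The test for the completeness of the list of elements of a stabilizer. -/
def stabOK (t : ℕ) (m : M4) : Bool :=
  !((extra t).all fun x => (repL t).any (m.mulVec x).pm) || !decide (m.det = 1) ||
    !allLT (stabN t) fun i => !decide (toM4 (stabH t i) = m)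

/-- Vectors and their negatives. -/
def signed (l : List V4) : List V4 := l ++ l.map V4.neg

/-- The test that the sum of the first two columns is a vector of the representative. -/
def sumOK (t : ℕ) (a b : V4) : Bool :=
  Nat.beq t 3 || (repL t).any (V4.pm ⟨a.a + b.a, a.b + b.b, a.c + b.c, a.d + b.d⟩)

lemma stabOK_all : [1, 3, 5, 6].all (fun t => (repL t).all fun a => (signed (repL t)).all fun b =>
    b.pm a || (!sumOK t a b || (signed (repL t)).all fun c => c.pm a || (c.pm b ||
      (signed (repL t)).all fun d => d.pm a || (d.pm b || (d.pm c ||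
        stabOK t (cols a b c d)))))) = true := by
  decide +kernel

lemma V4.neg_neg (v : V4) : v.neg.neg = v := by
  obtain ⟨a, b, c, d⟩ := v
  simp [V4.neg]

lemma mem_signed {l : List V4} {v : V4} (h : v.ray ∈ rays l) : v ∈ l ∨ v.neg ∈ l := by
  obtain ⟨u, hu, e⟩ := mem_rays.mp h
  have := V4.pm_iff.mpr e.symm
  simp only [V4.pm, Bool.or_eq_true, decide_eq_true_eq] at this
  rcases this with rfl | rfl
  · exact Or.inl hu
  · exact Or.inr (by rwa [V4.neg_neg])

lemma mem_signed' {l : List V4} {v : V4} (h : v.ray ∈ rays l) : v ∈ signed l := by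
  rcases mem_signed h with h | h
  · exact List.mem_append_left _ h
  · exact List.mem_append_right _ (List.mem_map.mpr ⟨_, h, V4.neg_neg v⟩)

lemma code_neg {g h : SL4} (e : g.1 = -h.1) (k : SL4) : code (k * g) = code (k * h) := by
  rw [code, code, ← enc_smul (prim_row (k * h)) 3]
  congr 1
  rw [redN_eq, row_mul, row_mul, e]
  intro j
  rw [Matrix.vecMul_neg, Pi.neg_apply, Pi.smul_apply, smul_eq_mul]
  exact Int.modEq_iff_dvd.mpr ⟨(k.1 3 ᵥ* h.1) j, by ring⟩

lemma sum_mem : ∀ t ∈ [1, 3, 5, 6], t ≠ 3 → (⟨1, 1, 0, 0⟩ : V4) ∈ repL t := by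
  decide

lemma exists_stab {t : ℕ} (ht : t ∈ [1, 3, 5, 6]) {m : M4} (hm : m.det = 1)
    (hs : m.sl hm • rays (repL t) = rays (repL t)) (h0 : ⟨m.r0.a, m.r1.a, m.r2.a, m.r3.a⟩ ∈ repL t) :
    ∃ i < stabN t, toM4 (stabH t i) = m := by
  have hL : ∀ u ∈ repL t, (m.mulVec u).ray ∈ rays (repL t) := fun u hu => by
    rw [← M4.sl_smul m hm, ← hs]
    exact Finset.smul_mem_smul_finset (mem_rays.mpr ⟨u, hu, rfl⟩)
  have hpm : ∀ u v : V4, u.pm v = false → (m.mulVec u).pm (m.mulVec v) = false := fun u v h => by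
    rw [← Bool.not_eq_true, V4.pm_iff, ← M4.sl_smul m hm, ← M4.sl_smul m hm] at *
    exact fun e => h (MulAction.injective _ e)
  have c0 : m.mulVec ⟨1, 0, 0, 0⟩ = ⟨m.r0.a, m.r1.a, m.r2.a, m.r3.a⟩ := by
    simp [M4.mulVec, V4.dot]
  have c1 : m.mulVec ⟨0, 1, 0, 0⟩ = ⟨m.r0.b, m.r1.b, m.r2.b, m.r3.b⟩ := by
    simp [M4.mulVec, V4.dot]
  have c2 : m.mulVec ⟨0, 0, 1, 0⟩ = ⟨m.r0.c, m.r1.c, m.r2.c, m.r3.c⟩ := by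
    simp [M4.mulVec, V4.dot]
  have c3 : m.mulVec ⟨0, 0, 0, 1⟩ = ⟨m.r0.d, m.r1.d, m.r2.d, m.r3.d⟩ := by
    simp [M4.mulVec, V4.dot]
  have hb : ∀ u ∈ basis4, m.mulVec u ∈ signed (repL t) := fun u hu =>
    mem_signed' (hL u (List.mem_append_left _ hu))
  have h := List.all_eq_true.mp stabOK_all t ht
  have h := List.all_eq_true.mp h _ h0
  rw [← c0] at h
  have h := List.all_eq_true.mp h _ (hb ⟨0, 1, 0, 0⟩ (by decide))
  have hsum : sumOK t (m.mulVec ⟨1, 0, 0, 0⟩) (m.mulVec ⟨0, 1, 0, 0⟩) = true := by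
    rw [sumOK, Bool.or_eq_true, Nat.beq_eq, or_iff_not_imp_left]
    intro h3
    have h4 : (⟨1, 1, 0, 0⟩ : V4) ∈ repL t := sum_mem t ht h3
    obtain ⟨u, hu, e⟩ := mem_rays.mp (hL _ h4)
    refine List.any_eq_true.mpr ⟨u, hu, V4.pm_iff.mpr ?_⟩
    rw [e]
    simp [M4.mulVec, V4.dot]
  rw [hpm _ _ (by decide), hsum, Bool.not_true, Bool.false_or, Bool.false_or] at h
  have h := List.all_eq_true.mp h _ (hb ⟨0, 0, 1, 0⟩ (by decide))
  rw [hpm _ _ (by decide), hpm _ _ (by decide), Bool.false_or, Bool.false_or] at h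
  have h := List.all_eq_true.mp h _ (hb ⟨0, 0, 0, 1⟩ (by decide))
  rw [hpm _ _ (by decide), hpm _ _ (by decide), hpm _ _ (by decide), Bool.false_or,
    Bool.false_or, Bool.false_or, c0, c1, c2, c3] at h
  change stabOK t m = true at h
  simp only [stabOK, Bool.or_eq_true] at h
  rcases h with (h | h) | h
  · refine absurd h ?_
    rw [Bool.not_eq_true, Bool.not_eq_false', List.all_eq_true]
    intro x hx
    obtain ⟨u, hu, e⟩ := mem_rays.mp (hL x (List.mem_append_right _ hx))
    exact List.any_eq_true.mpr ⟨u, hu, V4.pm_iff.mpr e.symm⟩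
  · rw [hm] at h
    exact absurd h (by decide)
  · obtain ⟨i, hi, e⟩ := exists_of_not_allLT h
    exact ⟨i, hi, of_decide_eq_true e⟩

lemma stab_complete {t : ℕ} (ht : t ∈ [1, 3, 5, 6]) {s : SL4}
    (hs : s • rays (repL t) = rays (repL t)) : ∃ i < stabN t, ∃ hd : (toM4 (stabH t i)).det = 1,
      (∀ v : V4, s • v.ray = (toM4 (stabH t i)).sl hd • v.ray) ∧
      ∀ g : SL4, code (g * s) = code (g * (toM4 (stabH t i)).sl hd) := by
  obtain ⟨m, hm, rfl⟩ := M4.exists_sl s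
  have h : (⟨m.r0.a, m.r1.a, m.r2.a, m.r3.a⟩ : V4).ray ∈ rays (repL t) := by
    have h1 : m.sl hm • (⟨1, 0, 0, 0⟩ : V4).ray ∈ m.sl hm • rays (repL t) :=
      Finset.smul_mem_smul_finset
        (mem_rays.mpr ⟨⟨1, 0, 0, 0⟩, List.mem_append_left _ (by decide), rfl⟩)
    have h2 : m.mulVec ⟨1, 0, 0, 0⟩ = ⟨m.r0.a, m.r1.a, m.r2.a, m.r3.a⟩ := by
      simp [M4.mulVec, V4.dot]
    rwa [M4.sl_smul, hs, h2] at h1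
  rcases mem_signed h with h | h
  · obtain ⟨i, hi, rfl⟩ := exists_stab ht hm hs h
    exact ⟨i, hi, hm, fun v => rfl, fun g => rfl⟩
  · obtain ⟨m', hm', e, e0⟩ : ∃ (m' : M4) (hm' : m'.det = 1), (m'.sl hm').1 = -(m.sl hm).1 ∧
        (⟨m.r0.a, m.r1.a, m.r2.a, m.r3.a⟩ : V4).neg = ⟨m'.r0.a, m'.r1.a, m'.r2.a, m'.r3.a⟩ := by
      refine ⟨⟨m.r0.neg, m.r1.neg, m.r2.neg, m.r3.neg⟩, ?_, ?_, rfl⟩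
      · rw [← hm]
        simp only [M4.det, V4.neg]
        ring
      · funext i j
        fin_cases i <;> fin_cases j <;> rfl
    have hv : ∀ v : V4, m'.sl hm' • v.ray = m.sl hm • v.ray := fun v => by
      rw [V4.ray, smul_ray, smul_ray, e, Matrix.neg_mulVec, ray_neg]
    have hs' : m'.sl hm' • rays (repL t) = rays (repL t) := by
      refine Eq.trans (Finset.image_congr fun X hX => ?_) hs
      obtain ⟨v, -, rfl⟩ := mem_rays.mp (Finset.mem_coe.mp hX)
      exact hv v
    obtain ⟨i, hi, rfl⟩ := exists_stab ht hm' hs' (e0 ▸ h)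
    exact ⟨i, hi, hm', fun v => (hv v).symm, fun g => (code_neg e g).symm⟩

/-- Hints for the reduction to representatives of orbits. -/
def tab : ℕ → ℕ
  | 0 => 2332158554728229581708927787092434629951151421812623118149855040022120201893524908865733049400535844781176054934140989858632326675691723865930358473772632705108787675404989899163363815378259587521622434795869185789743224660424200987252801323795476518014374268681502434807819732997818737954886742049708437262057728312039042534530433360732159901041526327476407801291578642457253019880374520804124973069131021587036982692472232921070205660039906026927487871944743074553949060893434499769177572355839707457290672122363995857614540895283183734263083409583437411640126308737873674546479800398403346973480682618727700671311905173440917717561760752685104964914553339416180790054056281275263226964568095959865833239991001562624486126126827334131121862906136232616873036228501380067472295983100100758114651868850185189640514177357682216454923344938133484245477953187939508393716833225279976901165024009803039252185483393943197307182930408830077952154962251070818796308930904122210007517962003093400576831448672463656813111894043632340444428980216293092561042029879866727080614891411472443363211803602661631517006211927498255001600377448600033757554442424383076989888800674968073136758895194569675414576430921968059640210059547751396004837925865651437967204928291643594693356886806853939423017634175783148597879196902098406852636564894423350459460617072425511052174886973661687685436422665302549116802897669921505715653959201982549032388345478030926759395852974185368756384429852117373387090457383825955195116242744432796601377291621979728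48594890354763145031650486747927665441859519375847603049292754793853770203997673241939559448749369327290423134603297597167470652275328146621255506507439225749925989107820013574408788881689895004978154922429388086195218726669070252253872140437307708568390954040321197054651655484324036359373473128691651715440881918421092815620560283167029589711436336015078035149504767886547062615808382571745514721314375674447992267785239433091937846970109101918248338733869681396454756183118372251685137699663565457398569919353316206379331954687002827025531022441744406856480718402507123215779964204540017578632366461002555233101915368363500527379830030741495872378321686605409614835961774537317887326063169237969705124686414684726846497742979199146927360687517745454130040524396117620691983221780371418369310006966294193324665014590775760390255335850495287787033958055972405806675042854850637235569455156572919996263325636136751876804749190281468465839522738506297689845825098851571718672898151340525045802233386592101025981855441856290957646283912001464859735975719400113557546738485636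
  | 1 => 9381569508962506329320608617968664951544631646375805490897457803457658945413686130971847153489176447019240502305393403673930907430769772456418306809737124040969727359556852062532879564357160116687875803069290009286961570415622670909666211677328482780306503044518298575191943240205693812561588341200858522441606956062592771955145662645834358827424264910656764547807459076444889985577413684133414336727893574381953483277798099857602815751890561300924901433877397533710530457338886678461440487505207025062061692876133786015503948420523218830706440073830745639468469119561681066382448936199494887211232448653746157538512071018941432921617252132017536202723093301208042158138728449548334322157490178503733595938362191030328057913946120504504328469909358368766127671761499329921624512895741901794343551260442610528762510829790497503271602189949194438610624460960147418780247737845114169034855466566486640573433091856906307564263075734924886427772980838699554421101299664326705619500836476502826250904269729371876740852699449451369102752738839074467687335110043468408647225706250377660543278486547654464863347211854464710983888775547830957728992418825126642714894610907077275561425236031839936097359040640753968102944343821865708097352156459767789416576381328157592815961912316442030950649433111251064299132862612415505278556547583614764088453695367901645756709063215533708401029767981024853267689810533294681790223230265053987822251575211662925274418371045157653349104950750415314426872849804022783236767851483766538478663795901583823945048585525180767351502006657293546913971034126205825536286489083970534813604371479043091728445422993563993379646138391024645996756673843276223543507134648787790351767567248403283469606002701862157016592711719039707213482968330647024900965997126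501686714853051198436138548857227684493522680854606904767788952577533177092530706153665521221503681983378031040362199893192101462312822464338711047396316917814559570004601433927614113929960587414699491192933366696636564717585063635745884387398533026185053948195302419958034425609918448108120034752753029847642982430724126158123828950478783948683166986057654625370947287898127974087318378938129003274054702210670619801102264948190190732350608125284039671171373981274154175558562035221057941173510991594482972253679290716081209733947835213278188821054069558691693859438363895848663250379456649384109441761851302446445221071929507336434255113377242715833899067631229364103580287391410801833789486076045359102512830706800198551548127294402475802026118727288520957069012255738920660966422100351742263929326834064930189962917549442
  | 2 => 5749833279919877660023150458656462981488994251699629440651437795315343296692487181603415719151804870652961504217855408629084250530560327127007102606760832607917391433601305606203140727545329463693561157610391394044553531718383504319274736600239743375629311939095081577406768628397978797001710149519651651034748895676531797335724075387505767843499747393415368806184539569184106867491758761210385709079290314014130691012298852756753494461965949521292077027444024633095317358459311509767116314411856518298633786482522760426698731292183446812416955182070129258696167846596092807941865236118845827623202514652815717321219023601081201580039917878177742919325436062088685860197459365834599566422591524476702917098874023534374152158715584682779472015219066661278258553493669531431075046564624381875303754945194428655193541986588916744722364191692324076495598273796957440431409531559083571535575914902323555499629990067847093274449998293881756535219879840881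6601649327665195648602092886733039418548067716405856286424091428345992001644536436581142239708878928106731122170030628940061451745073823803966906355682558903747548483007244798305674142711489655634124444443189530058847375772358688768512754673698170908483582781369904542800835411391403077844182459652786902696157618465447295034530043453384438814363056807855818633933295221988803234869580880358570032080104221265159205834496358263587573036430662933312578873242275146609316786931538117856777288405986237650729055011679375320410935910241724292103066347042437376384042265346000016554850237467744783058397221009938269570580264197476207285175571591128671344506550817560580271082654353222687623773860742806038305453368322597115720517562146635473679349678675595543456845936472445325879161939521269481243864617991820944967928092275813288362153233904858190738079514547043233820824499092500416312720618676531352398258850447285122523381777249349760874867732062777078403144357238990314205347073786024030557745492734681201574424573366921170360212203559691506240699195643791847150227521367283302956988057185280331965984079543202851914235050251956857180059305267515271073380684565438193342682447991501759702480349800109957537241306711731498873073770265827991561963582936498842979928332342067280202487957834894357076038762102901391651345544795699510526490065483044628258938460771639972988465495840481588256480784364553693071779099229986898058718399578937107182432806664018266397912785792207440597546360090044528801447734979852721525397545270756705653137719301398998264092758960875832466799789425664935335159144115514834810642890470558701159754703198236876181286533043586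
  | 3 => 1492208421208492486909200377531041270629982487822185271828694264375569036129918890395603929239729403130301665329795556086401801779238074964525597478139151061903135703804848583404423766357476964458984520219603720514657576547779544816843706900310669985103972260747545521486045194401183683184397525341189219508287488743657205689541391962187851465807892282188449446701000979485219164461930824994927159852307295760487014973196421704773792351462283973003410128754360236780103318505120897742305496128980903002993353000389131303451393687046280571122731089197676230947836120899348672023073344396141958599548753327500693571239156826939366667235835356439863687819076050559463388834761343582908246114341971158871829904137878441516849921162442711559017583266131820447101615818850461710568483829463626066262927171409595290468006690143270573361084718249237511456135506821349317705816566578136868258268573694602740847075697978594932719344150490928032879163880730883089536395684963772319983788120447356229125234442294056335959784623011694342409010069371951577890223825290207353148288592855678538863818753817204849034970551460994376523732201722709484720039890011249388293815117430144353273395034387047067838236075042451295166627058864879589046648735482362916879763825189850982102260017387957992695094647204485524603115128806131308248967985652806457714416611728873090702742587540892002906547982038369877659178692630369237674471767240501075898998893862488289234778199014317143378434767934893387038644889406076526590960014400908029388091942315071072121810291771260465962555134593206080840478297325789791500325943483257231784612906594907101566301014545379122813146879043485838491771369338822648077614671585892178585986937669634950958942549478188359271592562129195700701809094078356050625318174918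96489809150153563602112534754611864047442911892568334075207133663023335649428070065597100443705482231322304214637498801781124590642890404488484474139917621498799320741219490448726899230638697271185876254416530759150232835310246777993324260808982203621379964578755458737433105224629225018082938914828264147445322805158095345919185924438271681547809251213094156753135247629865168901705977376147359819628994146269495479427646994581989262782096003628104436071012728947594928299401316490761881823726575566823752929999935512441233836382275095225461254957820563038639414889580549992991093843534148733817792717989127831933405831251393039818649402495987116686404605404740537075624438634559057873817710521379307096070168108262443263592927051831587262920116828615291300847987836144106810299725470303000311673116418328700303169797113249792
  | 4 => 2049151685544470462494870200977122443886870697015881846356781015238990989356528886239353798148786744878954552446561428026996134529355558880495244570607947153744665853610578033405044252026274449714608051890863719979952853611189200819342758850099583207860126478910111903305500598979113703763949980104469549449951513761017861331471181624913252120960753376858419129346866534874616200700750756938026906328191936504924811561723822534867763451560635841257180063666913839267122725358120894402157522252426033621981732577185396087013830997661321177818382191105804300376702999567497697180945855723237451643292145582050589834414515114364657827304903957948671530394340898444159670142412045541572288386861128794609816819001690711935607900189697720496999940917909449355682755597908398187352664767028126024315643018285026618383329909537270678350139425718066222981196859318998007751788717030494313543712338757556243172043391750195894301556322009679418960903096518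68183478073300878848544076022530557990795942539867700399116122746449279899422055956979956147701282175444225434314281508928899944514645551772641762515497840174687926240736879806682828474336193144139241992430757850640458347194101783517552798075096622071852647020343413497810885190328154568758057295503076382151622088309655895007873588918535619272550302381088480816325500897915531150153826513692082674385894013216704369249364556478683098868082481926404105062473159105365297372737428414365458063736129242522906834531117968001158994257987865199563628812245681482777205814823066806572038903345732848679468503979673700343672849353122050078890405722302859619050130376900933205298554058842282565923727923005730995926741924158431761878383572759034102634333135322532475013806742956717853668407950921494048294584229707674595867655038229313009581465663093174534840403547627611956096486088106709950883818303647802881915052512475073615522533091985133643444382673958074392230458339155221837727247781239706193651804111403905403466101397149452975865443631749441554300005086694344085362403390316180468575205203716104284851431549938362947295467870884814152220775334576954982495280218109122987535567808230567815076826486941845623574240181988362161983102969028527952917504955654792959964446292301480124779315133392460924038045491414910615002002408923735590679189915764923476723775715253056389419520034573914582036425943307476934220069975052119543530719303546503947812216632211527675205037544360418146164045827242594414971403773613222746022756033814216388190156867984791723494405505035931592591178300466573474917967329730028208901456263968627660124501913598133017914883149178624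
  | 5 => 6254315181601410886421540446377068668415466577310815267332762592796480189567274189280654650198678228947912778918963120250612345757155499902755034381824310304630239854803101240986596832653641695482748003570060405764326250365091707738924307696558829750483785971033124870803852309360622093111203061416169446197170143272625837725445154974906688408429182204998686398233849754184419145939290513370448753472459488256161588275434779419604572304739355597722060310657986197519275413963746851051490047356188887117321752013964095217267142973788093937590447181653283221205083199436485875905269786066793499879561246848314490247331544144798201284887599146626537613111138716516662090020365952177859416485223795258271597492302569797093449489285733422133065945117857507823446135807568849118040786758153042677774068408540384353118852851225877136238877333224674396961172757440083882136991467536242634658955950922430924152621811410170128199718344261652550164835543938284398206072520240063344673794850234998869474956244829761314286591103012180035446683262958004145595351495105772256240841964188223706352755804672730178681801115274477820987776683488997670319214723313500006998174411856228170537210178770387250275994633480561365130277469365078405453144409939899623308324636885106817283718459310108638535068556178743819802829545491666965817129791121244298355205414030863528758658770958759995105791229617917256977271070999217827267664506738834535307438871778745988132098700541349910984227852085555114447692174254997135050594446748932714054734858192959049909413168712408807473148056353616235191979635608404302902627762953483610414817199987073436297543290639597896472571326110366503349558783188259825791442824232298282352047713068671097286825498748535667178930439181376807987523483916241298034875641219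368170357412191296268480052609361258577712752743998813713116025030962134210820874183428276175786932885307473828478788247731158137392671805228319987599144879898593528401348399228577324409196077314673781815643495140500667712514175153570588530381187277158079220368113261479442788341931183177158164028042987457096647857532908814033105186315621285846409807607613061334398049257866846705912217899838035795442575980343939698060569728320502515925753469521277479211591451191519790923220885453965170898667941561451111600725464205306896567483375154041633193010561201574228669160523664279645226687343148367445411024153044174980683568889662797934545810587398170848504391961315711488566900518136425578529006255787376102807063776873825888853894013748581598906565659378414980884954651637019326746502018679067728797341893740944288197503877120
  | 6 => 2326289026758067144736394857833624402248393049410080739911374170169500507225844386095901775627332274492995904352812853323888694857731221504894782490345363703256058556255960784464590679280795988412898610888228845330444078846021153107170841854747781096776887986053427103165280233052784835628947490772251152371849932301983390510352459522508526737871138905400418339715422542609992295287288362386936652982202266628130198772222840206807292834718748885094834833800677941637855451302156152025765595875902030504106246233599316790979175548876042549808268093611046545531933687425231877659560494838792541490035804378808787225244442613335902582369745666396228345041303222267052258205414709784908208304798944067697108713010533103841099977651360423652645216066761170358942433319758262728707083056258270417361365058837260945488376107904805343376711018244891214540602612064876709950901167462547838790807114979990008363181120565879946213390316595127432382917518002176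4255603337791987233637631913991338712564819181629081469635464845659065027206878057879985195970253512149647025329538354042872443428472114304839356540544653816491490766265336838825489509257566168738640514215165254607429080245609844355997795145386310901010455305269458961353987583981062239890117048959942738542395291333035191822359459744375961429642381746692379893046095341735923621379894544397856998252519282455374552538955107176889636000181758846364711882292831614268830227254132183607288681025507955982062035322729905589452021694318493849720536356449295326688827994471899224252322067066843870330397446115856774197953895771556770360133418899555676556788392205856490346516127440424573650699370214671359834161264584730925401105482094403360041170776057461971673388944321732598942374164556575544148853095326750949034492748252827795162775859465464718784317046777160400364570866129242470752989094594140770528672324805429535179482537033074016068737731012687459384410584675215493757353072396289661470519051351390055289618878456761113533984587375504770810197279661357542831057932645800030447276552435609344709641867180649651526000801987875678601929196569616953078932502517416405329430363775282981611794335082981089215155081491033796000299756016975318691653716125258943513204634362017681862267596823979581781647376805727135731122949289535335353326550126095602098643098459227928235280517905420864440392879456016032625881915116483083548404669484744661134594416079475342698377634301384804631883136760910749025645579634683928295129648401501812384662779615907572581666143529828785251764253336184463765998944711430650231766110309013219529976051352663756031565716817025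
  | _ => 7282545306515217925537846531251390495558791895888947914884966018162646054228064658166145967857074105905283593907188495804360111568437195513217184033728844443387420142973048216717706778295923763254221895680823921041225031560848368431922169813612749514591993839240011258010603151534326065562625638749860890702724214827894556708052366560046604310021268652100193033494602715886300210523506138535276808666891574995499272360067232977091193700080364376666737205815374120772855369154089551931916823692109075211252851322717051471689133210489937025203787093845915521382389638596795822558370024745148388695766710310918889624945824102838063487200073164308815247750811164985615994131534584211097951695984549064403936372857861546582029491744177380099495682109552178446065434919529562255205389958535256854533723389298732985442151937998430776870603209800841385572481750536365877278318681516322559213518897717542888426314310377808413749140238847025251267692310196336432966284529329734768814943117684114622063819887256746087442136506860573575446513851435301837077294628586755092510510579820394805493723222104288065554096781084002383569245565690846529277923271055177415223327678456932396676800656070647023161029135276133023762402303582819303648507905910846443993117420957198564402426405566188167068764120726046307791624545950374468049177703062356734631046267139359694663254901338900553608279968093550036012050598925815916240372493515930796104648206021814097011945926832906485180042258065647521056219964584726063455738554508562408963020007507380155970736572283669792123992396446929570834013817662352664035765083005363579446098071572033889785976186309766456668382593097851766656953397052498811645977469104269508370468085046804719371320891334252620141226014381854846596146273517711121669579056853863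8218831718629512632043542548902390545090399129286606154591151993102936560201655513868969071269285776986457062871629399402252149624991406962876523536535259081299123086710547945169066971397538176332565416193850823495771355827053092092235391792484578333704159108886012942503946435331562123469461719865951293275775424799827745243619135817373454374621705730533621410904985214871603787833559627884207431558243708507600492691015171026004558706664989192645449791098357785386003474828640216190489118160886359096563051681056402341267428388518051905923139437747525738800417463493513974625683987805244797429977589045417173262143732380054683480030856357181610090821649708542765549707570501071277961645014542082764902796659537473051948093062919143737755401770070230901854930148507555346001484461745544254327435500217009629979214428016258

/-- The values of a cochain on the translates of the representatives. -/
noncomputable def Phi {k : ℕ} (f : Cell k → ℂ) (t n : ℕ) : ℂ := ev f (rlist (lift n) (repL t))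

section Values

variable {k : ℕ} {f : Cell (k + 1) → ℂ}

lemma ev_eq_Phi (hf : IsCoch (Gamma0 9) (k + 1) f) (g : SL4) (t : ℕ) :
    ev f (rlist g (repL t)) = Phi f t (code g) := by
  rw [Phi, ← ev_smul hf (mem_of_code (code_lift (code_lt g)).symm) (rlist g (repL t)), rlist_smul,
    inv_mul_cancel_right]

lemma ev_translate (hf : IsCoch (Gamma0 9) (k + 1) f) {l : List V4} {h t : ℕ}
    (hd : (toM4 h).det = 1) {e : ℤ} (he : psgn ((repL t).map (toM4 h).mulVec) l = e) (h0 : e ≠ 0)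
    (hl : (l.map V4.ray).Nodup) (g : SL4) :
    ev f (rlist g l) = e * Phi f t (act (code g) h) := by
  rw [ev_psgn f g (by rw [he]; exact h0) (rlist_nodup hl g), he, rlist_mulVec g _ hd,
    ev_eq_Phi hf, code_mul]

lemma stab_spec {t i : ℕ} (ht : t < 8) (hi : i < stabN t) : (toM4 (stabH t i)).det = 1 ∧
    psgn ((repL t).map (toM4 (stabH t i)).mulVec) (repL t) = stabS t i := by
  have h := allLT_spec (allLT_spec stab_ok t ht) i hi
  simpa only [Bool.and_eq_true, decide_eq_true_eq] using h

lemma act_lt {n h : ℕ} (hn : n < 1080) (hd : (toM4 h).det = 1) : act n h < 1080 := by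
  rw [← code_lift hn, ← code_mul _ _ hd]
  exact code_lt _

lemma Phi_stab (hf : IsCoch (Gamma0 9) (k + 1) f) {t i n : ℕ} (ht : t < 8) (hi : i < stabN t)
    (hn : n < 1080) : Phi f t n = stabS t i * Phi f t (act n (stabH t i)) := by
  obtain ⟨hd, he⟩ := stab_spec ht hi
  have := ev_translate hf hd he (stabS_ne_zero t i) (repL_nodup ht) (lift n)
  rwa [code_lift hn] at this

/-- Reduction to a representative of an orbit of the stabilizer, given a hint. -/
def redAux (t n v : ℕ) : ℤ × ℕ :=
  cond (Nat.blt v 128)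
    (cond (Nat.blt v (stabN t)) (stabS t v, act n (stabH t v)) (1, n))
    (cond (Nat.blt (v - 128) (stabN t) && Nat.beq (act n (stabH t (v - 128))) n &&
      decide (stabS t (v - 128) = -1)) (0, n) (1, n))

/-- Reduction to a representative of an orbit of the stabilizer. -/
def red (t n : ℕ) : ℤ × ℕ := redAux t n (tab t / 256 ^ n % 256)

lemma redAux_spec (hf : IsCoch (Gamma0 9) (k + 1) f) {t n : ℕ} (ht : t < 8) (hn : n < 1080) (v : ℕ) :
    (redAux t n v).2 < 1080 ∧ Phi f t n = (redAux t n v).1 * Phi f t (redAux t n v).2 := by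
  have h1 : ((1, n) : ℤ × ℕ).2 < 1080 ∧
      Phi f t n = (((1, n) : ℤ × ℕ).1 : ℂ) * Phi f t ((1, n) : ℤ × ℕ).2 :=
    ⟨hn, by rw [Int.cast_one, one_mul]⟩
  unfold redAux
  cases Nat.blt v 128
  · rw [cond_false]
    cases h : (Nat.blt (v - 128) (stabN t) && Nat.beq (act n (stabH t (v - 128))) n &&
      decide (stabS t (v - 128) = -1))
    · exact h1
    · rw [Bool.and_eq_true, Bool.and_eq_true, Nat.blt_eq, Nat.beq_eq, decide_eq_true_eq] at h
      refine ⟨hn, ?_⟩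
      have h2 := Phi_stab hf ht h.1.1 hn
      rw [h.1.2, h.2] at h2
      rw [cond_true]
      push_cast at h2 ⊢
      linear_combination h2 / 2
  · rw [cond_true]
    cases h : Nat.blt v (stabN t)
    · exact h1
    · rw [Nat.blt_eq] at h
      exact ⟨act_lt hn (stab_spec ht h).1, Phi_stab hf ht h hn⟩

lemma red_lt {t n : ℕ} (ht : t < 8) (hn : n < 1080) : (red t n).2 < 1080 := by
  refine (redAux_spec (k := 0) (f := fun _ => 0) (fun g _ S => ?_) ht hn _).1
  rw [zero_mul]

lemma Phi_red (hf : IsCoch (Gamma0 9) (k + 1) f) {t n : ℕ} (ht : t < 8) (hn : n < 1080) :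
    Phi f t n = (red t n).1 * Phi f t (red t n).2 := (redAux_spec hf ht hn _).2

/-- The values of a cochain, indexed by a single number. -/
noncomputable def PhiK (f : Cell k → ℂ) (K : ℕ) : ℂ := Phi f (K / 1080) (K % 1080)

/-- The value of a linear form. -/
def evalL {R : Type*} [Ring R] (φ : ℕ → R) (l : List (ℤ × ℕ)) : R :=
  (l.map fun p => (p.1 : R) * φ p.2).sum

/-- A reduced value. -/
def term (s : ℤ) (t n : ℕ) : ℤ × ℕ := (s * (red t n).1, 1080 * t + (red t n).2)

lemma term_spec (hf : IsCoch (Gamma0 9) (k + 1) f) (s : ℤ) {t n : ℕ} (ht : t < 8) (hn : n < 1080) :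
    ((term s t n).1 : ℂ) * PhiK f (term s t n).2 = s * Phi f t n := by
  have h := red_lt ht hn
  rw [Phi_red hf ht hn, term, PhiK]
  dsimp only
  rw [show (1080 * t + (red t n).2) / 1080 = t by omega,
    show (1080 * t + (red t n).2) % 1080 = (red t n).2 by omega]
  push_cast
  ring

/-- The coboundary as a linear form. -/
def rowL (t n : ℕ) : List (ℤ × ℕ) :=
  (List.range (cofN t)).map fun i => term (cofS t i) (cofT t i) (act n (cofH t i))

lemma Phi_cobdry (hf : IsCoch (Gamma0 9) (k + 1) f) {t n : ℕ} (ht : t < 4)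
    (hk : (repL t).length + (k + 1) = 9) (hn : n < 1080) :
    Phi (cobdry (k + 1) f) t n = evalL (PhiK f) (rowL t n) := by
  have hl := rlist_nodup (repL_nodup (ht.trans (by decide : 4 < 8))) (lift n)
  rw [Phi, cobdry_ev f (by
      rw [rlist_toFinset]
      exact isKCell_repL (ht.trans (by decide)) hk _) hl
    ((List.range (cofN t)).map fun i => lift n • (cofW t i).ray), evalL, rowL]
  · rw [List.map_map, List.map_map]
    refine congrArg List.sum (List.map_congr_left fun i hi => ?_)
    rw [List.mem_range] at hi
    obtain ⟨hd, h8, he, hN, -⟩ := cof_spec ht hi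
    rw [Function.comp_apply, Function.comp_apply, term_spec hf _ h8 (act_lt hn hd), ← rlist_cons,
      ev_translate hf hd he (cofS_ne_zero t i) hN, code_lift hn]
  · refine List.Nodup.map_on (fun i hi j hj e => ?_) List.nodup_range
    rw [List.mem_range] at hi hj
    have e' := MulAction.injective (lift n) e
    rcases lt_trichotomy i j with h | h | h
    · obtain ⟨-, -, -, -, h'⟩ := cof_spec ht hj
      exact absurd e' (h' i h)
    · exact h
    · obtain ⟨-, -, -, -, h'⟩ := cof_spec ht hi
      exact absurd e'.symm (h' j h)
  · intro X hX
    obtain ⟨i, hi, rfl⟩ := List.mem_map.mp hX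
    obtain ⟨-, -, -, hN, -⟩ := cof_spec ht (List.mem_range.mp hi)
    exact (List.nodup_cons.mp (rlist_nodup hN (lift n))).1
  · intro T hT
    rw [rlist_toFinset] at hT ⊢
    have hc := (isKCell_succ.mp T.2).2
    obtain ⟨i, hi, e⟩ := cofaces ht (lift n) T.2 hT (by omega)
    exact ⟨_, List.mem_map.mpr ⟨i, List.mem_range.mpr hi, rfl⟩, e⟩

lemma eq_zero_of_Phi (hf : IsCoch (Gamma0 9) (k + 1) f) {S : Cell (k + 1)} {t : ℕ} (ht : t < 8)
    {g : SL4} (hS : S.1 = g • rays (repL t)) (h : Phi f t (code g) = 0) : f S = 0 := by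
  have hS' : (rlist g (repL t)).toFinset = S.1 := by rw [rlist_toFinset, hS]
  have e : (⟨(rlist g (repL t)).toFinset, by rw [hS']; exact S.2⟩ : Cell (k + 1)) = S :=
    Subtype.ext hS'
  rw [← ev_eq_Phi hf, ev_of_cell f (by rw [hS']; exact S.2) (rlist_nodup (repL_nodup ht) g), e] at h
  exact (mul_eq_zero.mp h).resolve_right (by exact_mod_cast (lsgn _).ne_zero)

end Values

section Delta

variable {t : ℕ}

lemma lt_of_mem (ht : t ∈ [1, 3, 5, 6]) : t < 8 := by
  simp only [List.mem_cons, List.not_mem_nil, or_false] at ht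
  omega

lemma exists_stab_of_smul_eq (ht : t ∈ [1, 3, 5, 6]) {g g' : SL4}
    (h : g • rays (repL t) = g' • rays (repL t)) : ∃ i < stabN t,
      code g' = act (code g) (stabH t i) ∧
      (lsgn (rlist g (repL t)) : ℤ) = stabS t i * lsgn (rlist g' (repL t)) := by
  have hs : (g⁻¹ * g') • rays (repL t) = rays (repL t) := by
    rw [mul_smul, ← h, inv_smul_smul]
  obtain ⟨i, hi, hd, h1, h2⟩ := stab_complete ht hs
  obtain ⟨-, he⟩ := stab_spec (lt_of_mem ht) hi
  have e : rlist g' (repL t) = rlist g ((repL t).map (toM4 (stabH t i)).mulVec) := by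
    rw [rlist_mulVec g _ hd, rlist, rlist]
    refine List.map_congr_left fun v _ => ?_
    rw [mul_smul, ← h1, mul_smul, smul_inv_smul]
  refine ⟨i, hi, ?_, ?_⟩
  · rw [← code_mul _ _ hd, ← h2, mul_inv_cancel_left]
  · rw [e, ← he]
    exact (rlist_psgn g (by rw [he]; exact stabS_ne_zero t i)
      (rlist_nodup (repL_nodup (lt_of_mem ht)) g)).2

open Classical in
/-- The cochain supported on one orbit. -/
noncomputable def delta {k : ℕ} (t m : ℕ) (S : Cell k) : ℂ :=
  if h : ∃ g : SL4, g • rays (repL t) = S.1 ∧ code g = m then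
    ((lsgn (rlist h.choose (repL t)) : ℤ) : ℂ) else 0

/-- An orbit supporting a cochain, with its representative. -/
def deltaOK (t m : ℕ) : Bool :=
  Nat.blt m 1080 && allLT (stabN t) fun i =>
    (!Nat.beq (act m (stabH t i)) m || decide (stabS t i = 1)) &&
      Nat.beq (red t (act m (stabH t i))).2 m

lemma deltaOK_spec {m : ℕ} (h : deltaOK t m = true) : m < 1080 ∧ ∀ i < stabN t,
    (act m (stabH t i) = m → stabS t i = 1) ∧ (red t (act m (stabH t i))).2 = m := by
  rw [deltaOK, Bool.and_eq_true, Nat.blt_eq] at h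
  refine ⟨h.1, fun i hi => ?_⟩
  have := allLT_spec h.2 i hi
  rw [Bool.and_eq_true, Nat.beq_eq, Bool.or_eq_true, Bool.not_eq_true', decide_eq_true_eq] at this
  refine ⟨fun e => this.1.resolve_left ?_, this.2⟩
  rw [e, Bool.not_eq_false, Nat.beq_eq]

variable {k m : ℕ}

lemma delta_eq (ht : t ∈ [1, 3, 5, 6]) (hm : deltaOK t m = true) {S : Cell k} {g : SL4}
    (hg : g • rays (repL t) = S.1) (hc : code g = m) :
    delta t m S = ((lsgn (rlist g (repL t)) : ℤ) : ℂ) := by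
  have h : ∃ g : SL4, g • rays (repL t) = S.1 ∧ code g = m := ⟨g, hg, hc⟩
  obtain ⟨h1, h2⟩ := h.choose_spec
  rw [delta, dif_pos h]
  obtain ⟨i, hi, e1, e2⟩ := exists_stab_of_smul_eq ht (hg.trans h1.symm)
  rw [h2, hc] at e1
  rw [((deltaOK_spec hm).2 i hi).1 e1.symm, one_mul] at e2
  rw [e2]

lemma isCoch_delta (ht : t ∈ [1, 3, 5, 6]) (hm : deltaOK t m = true) :
    IsCoch (Gamma0 9) (k + 1) (delta t m) := by
  intro γ hγ S
  by_cases h : ∃ g : SL4, g • rays (repL t) = S.1 ∧ code g = m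
  · obtain ⟨g, h1, h2⟩ := h
    have h3 : (γ * g) • rays (repL t) = (γ • S).1 := by rw [mul_smul, h1, Cell.smul_val]
    rw [delta_eq ht hm h1 h2, delta_eq ht hm h3 (by rw [code_mul_left hγ, h2]), cellSign_succ, ← h1,
      ← rlist_toFinset, setSign_toFinset γ (rlist_nodup (repL_nodup (lt_of_mem ht)) g), rlist_smul]
    have := intCast_sq (lsgn (rlist (γ * g) (repL t)))
    push_cast
    linear_combination ((lsgn (rlist g (repL t)) : ℤ) : ℂ) * this
  · rw [delta, delta, dif_neg h, dif_neg, zero_mul]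
    rintro ⟨g, h1, h2⟩
    refine h ⟨γ⁻¹ * g, ?_, by rw [code_mul_left (inv_mem hγ), h2]⟩
    rw [mul_smul, h1, Cell.smul_val, inv_smul_smul]

lemma exists_of_ev_delta {l : List Ray} (h : ev (delta (k := k) t m) l ≠ 0) :
    ∃ g : SL4, g • rays (repL t) = l.toFinset ∧ code g = m := by
  by_contra hn
  refine h ?_
  by_cases hl : IsKCell k l.toFinset ∧ l.Nodup
  · rw [ev_of_cell _ hl.1 hl.2, delta, dif_neg hn, zero_mul]
  · exact ev_eq_zero _ hl

lemma Phi_delta_of_ne (ht : t < 8) {t' : ℕ} (ht' : t' < 8) (h : t ≠ t') (n : ℕ) :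
    Phi (delta (k := k) t m) t' n = 0 := by
  by_contra hn
  obtain ⟨g, h1, -⟩ := exists_of_ev_delta hn
  rw [rlist_toFinset] at h1
  exact h (eq_type ht ht' h1)

lemma Phi_delta (ht : t ∈ [1, 3, 5, 6]) (hk : (repL t).length + k = 9) (hm : deltaOK t m = true)
    {n : ℕ} (hn : n < 1080) :
    Phi (delta (k := k + 1) t m) t n = if (red t n).2 = m then ((red t n).1 : ℂ) else 0 := by
  have h8 := lt_of_mem ht
  split_ifs with h
  · have hN := rlist_nodup (repL_nodup h8) (lift m)
    have hc : IsKCell (k + 1) (rlist (lift m) (repL t)).toFinset := by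
      rw [rlist_toFinset]; exact isKCell_repL h8 hk _
    rw [Phi_red (isCoch_delta ht hm) h8 hn, h, Phi, ev_of_cell _ hc hN,
      delta_eq ht hm (g := lift m) (rlist_toFinset _ _).symm (code_lift (deltaOK_spec hm).1),
      intCast_sq, mul_one]
  · by_contra h0
    obtain ⟨g, h1, h2⟩ := exists_of_ev_delta h0
    rw [rlist_toFinset] at h1
    obtain ⟨i, hi, e, -⟩ := exists_stab_of_smul_eq ht h1
    rw [code_lift hn, h2] at e
    exact h (e ▸ ((deltaOK_spec hm).2 i hi).2)

end Delta

section

open CategoryTheory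

section LinearForms

variable {R : Type*} [CommRing R]

lemma evalL_nil (φ : ℕ → R) : evalL φ [] = 0 := rfl

lemma evalL_cons (φ : ℕ → R) (p : ℤ × ℕ) (l : List (ℤ × ℕ)) :
    evalL φ (p :: l) = (p.1 : R) * φ p.2 + evalL φ l := by
  simp [evalL]

lemma evalL_append (φ : ℕ → R) (l m : List (ℤ × ℕ)) :
    evalL φ (l ++ m) = evalL φ l + evalL φ m := by
  simp [evalL]

/-- The coefficient of a variable in a linear form. -/
def coefAt (K : ℕ) : List (ℤ × ℕ) → ℤ
  | [] => 0
  | p :: l => cond (Nat.beq p.2 K) p.1 0 + coefAt K l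

lemma evalL_eq_coefAt {φ : ℕ → R} {K : ℕ} : ∀ {l : List (ℤ × ℕ)},
    (∀ p ∈ l, p.1 = 0 ∨ p.2 = K ∨ φ p.2 = 0) → evalL φ l = coefAt K l * φ K
  | [], _ => by simp [evalL, coefAt]
  | p :: l, h => by
    rw [evalL_cons, evalL_eq_coefAt fun q hq => h q (List.mem_cons_of_mem _ hq), coefAt]
    cases e : Nat.beq p.2 K
    · rw [cond_false, zero_add]
      rcases h p List.mem_cons_self with h | h | h
      · rw [h, Int.cast_zero, zero_mul, zero_add]
      · rw [h, Nat.beq_refl] at e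
        exact absurd e (by decide)
      · rw [h, mul_zero, zero_add]
    · rw [cond_true, Nat.eq_of_beq_eq_true e]
      push_cast
      ring

/-- Adding a term to a linear form. -/
def addTerm (p : ℤ × ℕ) : List (ℤ × ℕ) → List (ℤ × ℕ)
  | [] => [p]
  | q :: l => cond (Nat.beq q.2 p.2) ((p.1 + q.1, q.2) :: l) (q :: addTerm p l)

lemma evalL_addTerm (φ : ℕ → R) (p : ℤ × ℕ) : ∀ l : List (ℤ × ℕ),
    evalL φ (addTerm p l) = (p.1 : R) * φ p.2 + evalL φ l
  | [] => evalL_cons φ p []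
  | q :: l => by
    rw [addTerm]
    cases e : Nat.beq q.2 p.2
    · rw [cond_false, evalL_cons, evalL_cons, evalL_addTerm φ p l]
      ring
    · rw [cond_true, evalL_cons, evalL_cons, Nat.eq_of_beq_eq_true e]
      push_cast
      ring

/-- Collecting terms. -/
def collect (l : List (ℤ × ℕ)) : List (ℤ × ℕ) := l.foldr addTerm []

lemma evalL_collect (φ : ℕ → R) (l : List (ℤ × ℕ)) : evalL φ (collect l) = evalL φ l := by
  induction l with
  | nil => rfl
  | cons p l ih => rw [collect, List.foldr_cons, evalL_addTerm, evalL_cons, ← ih, collect]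

/-- Scaling a linear form. -/
def scaleL (c : ℤ) (l : List (ℤ × ℕ)) : List (ℤ × ℕ) := l.map fun p => (c * p.1, p.2)

lemma evalL_scaleL (φ : ℕ → R) (c : ℤ) (l : List (ℤ × ℕ)) :
    evalL φ (scaleL c l) = c * evalL φ l := by
  induction l with
  | nil => simp [scaleL, evalL]
  | cons p l ih =>
    rw [scaleL, List.map_cons, evalL_cons, evalL_cons, ← scaleL, ih]
    push_cast
    ring

/-- Whether a linear form vanishes identically. -/
def isZeroL (l : List (ℤ × ℕ)) : Bool := (collect l).all fun p => decide (p.1 = 0)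

lemma evalL_of_isZeroL {l : List (ℤ × ℕ)} (h : isZeroL l = true) (φ : ℕ → R) : evalL φ l = 0 := by
  rw [← evalL_collect]
  refine List.sum_eq_zero fun x hx => ?_
  obtain ⟨p, hp, rfl⟩ := List.mem_map.mp hx
  rw [of_decide_eq_true (List.all_eq_true.mp h p hp), Int.cast_zero, zero_mul]

lemma evalL_congr {φ ψ : ℕ → R} {l : List (ℤ × ℕ)} (h : ∀ p ∈ l, φ p.2 = ψ p.2) :
    evalL φ l = evalL ψ l :=
  congrArg List.sum (List.map_congr_left fun p hp => by rw [h p hp])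

lemma evalL_intCast (φ : ℕ → ℤ) (l : List (ℤ × ℕ)) :
    ((evalL φ l : ℤ) : R) = evalL (fun K => (φ K : R)) l := by
  induction l with
  | nil => simp [evalL]
  | cons p l ih =>
    rw [evalL_cons, evalL_cons, ← ih]
    push_cast
    ring

end LinearForms

section Functionals

variable {k : ℕ}

lemma isLinearMap_ev (l : List Ray) : IsLinearMap ℂ fun f : Cell k → ℂ => ev f l := by
  by_cases h : IsKCell k l.toFinset ∧ l.Nodup
  · exact ⟨fun f g => by simp only [ev, dif_pos h, Pi.add_apply, add_mul],
      fun c f => by simp only [ev, dif_pos h, Pi.smul_apply, smul_eq_mul, mul_assoc]⟩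
  · exact ⟨fun f g => by simp only [ev, dif_neg h, add_zero],
      fun c f => by simp only [ev, dif_neg h, smul_zero]⟩

lemma isLinearMap_PhiK (K : ℕ) : IsLinearMap ℂ fun f : Cell k → ℂ => PhiK f K :=
  isLinearMap_ev _

lemma isLinearMap_evalL (l : List (ℤ × ℕ)) :
    IsLinearMap ℂ fun f : Cell k → ℂ => evalL (PhiK f) l := by
  induction l with
  | nil => exact ⟨fun f g => by simp [evalL], fun c f => by simp [evalL]⟩
  | cons p l ih =>
    refine ⟨fun f g => ?_, fun c f => ?_⟩
    · simp only [evalL_cons]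
      rw [ih.map_add, (isLinearMap_PhiK p.2).map_add]
      ring
    · simp only [evalL_cons]
      rw [ih.map_smul, (isLinearMap_PhiK p.2).map_smul, smul_eq_mul, smul_eq_mul, smul_eq_mul]
      ring

end Functionals

section Check

/-- Normalization of a variable. -/
def norm1 (K : ℕ) : ℤ × ℕ := term 1 (K / 1080) (K % 1080)

lemma rowL_lt {t n : ℕ} (ht : t < 4) (hn : n < 1080) : ∀ p ∈ rowL t n, p.2 < 8640 := by
  intro p hp
  obtain ⟨i, hi, rfl⟩ := List.mem_map.mp hp
  obtain ⟨hd, h8, -⟩ := cof_spec ht (List.mem_range.mp hi)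
  have := red_lt h8 (act_lt hn hd)
  change 1080 * _ + _ < 8640
  omega

/-- The cochain on the orbit with the given index. -/
noncomputable def deltaK {k : ℕ} (A : ℕ) : Cell k → ℂ := delta (A / 1080) (A % 1080)

/-- Indices of orbits supporting cochains, in the given dimension. -/
def goodK (d A : ℕ) : Bool :=
  [1, 3, 5, 6].contains (A / 1080) && Nat.beq (repL (A / 1080)).length d &&
    deltaOK (A / 1080) (A % 1080)

/-- The values of a cochain supported on one orbit. -/
def valK (A K : ℕ) : ℤ := cond (Nat.beq (norm1 K).2 A) (norm1 K).1 0

lemma goodK_spec {d A : ℕ} (h : goodK d A = true) : A / 1080 ∈ [1, 3, 5, 6] ∧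
    (repL (A / 1080)).length = d ∧ deltaOK (A / 1080) (A % 1080) = true := by
  rw [goodK, Bool.and_eq_true, Bool.and_eq_true, Nat.beq_eq, List.contains_iff_mem] at h
  exact ⟨h.1.1, h.1.2, h.2⟩

lemma isCoch_deltaK {k d A : ℕ} (h : goodK d A = true) :
    IsCoch (Gamma0 9) (k + 1) (deltaK A) :=
  isCoch_delta (goodK_spec h).1 (goodK_spec h).2.2

lemma PhiK_deltaK {k d A : ℕ} (h : goodK d A = true) (hd : d + k = 9) {K : ℕ} (hK : K < 8640) :
    PhiK (deltaK (k := k + 1) A) K = valK A K := by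
  obtain ⟨ht, hl, hm⟩ := goodK_spec h
  rw [PhiK, deltaK, valK, norm1, term]
  dsimp only
  have hr := red_lt (t := K / 1080) (n := K % 1080) (by omega) (by omega)
  by_cases e : A / 1080 = K / 1080
  · rw [← e] at hr ⊢
    rw [Phi_delta ht (by omega) hm (by omega)]
    cases h2 : Nat.beq (1080 * (A / 1080) + (red (A / 1080) (K % 1080)).2) A
    · rw [if_neg, cond_false, Int.cast_zero]
      intro h3
      rw [h3, Nat.div_add_mod, Nat.beq_refl] at h2
      exact absurd h2 (by decide)
    · rw [if_pos, cond_true, one_mul]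
      have := Nat.eq_of_beq_eq_true h2
      omega
  · rw [Phi_delta_of_ne (lt_of_mem ht) (by omega) e]
    cases h2 : Nat.beq (1080 * (K / 1080) + (red (K / 1080) (K % 1080)).2) A
    · rw [cond_false, Int.cast_zero]
    · have := Nat.eq_of_beq_eq_true h2
      omega

/-- The set of indices of a list, as a bit mask. -/
def maskOf (l : List ℕ) : ℕ := l.foldr (fun K m => m ||| 2 ^ K) 0

lemma testBit_maskOf {l : List ℕ} {K : ℕ} : (maskOf l).testBit K = true ↔ K ∈ l := by
  induction l with
  | nil => simp [maskOf]
  | cons a l ih =>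
    rw [maskOf, List.foldr_cons, ← maskOf, Nat.testBit_or, Bool.or_eq_true, ih,
      Nat.testBit_two_pow, decide_eq_true_eq, List.mem_cons, or_comm, eq_comm]

/-- Successive elimination of variables. -/
def elim : List (ℕ × ℕ) → ℕ → Option ℕ
  | [], m => some m
  | p :: l, m => cond (Nat.blt p.1 1080 && ((collect (rowL 0 p.1)).all fun q =>
      decide (q.1 = 0) || Nat.beq q.2 p.2 || m.testBit q.2) &&
        !decide (coefAt p.2 (collect (rowL 0 p.1)) = 0)) (elim l (m ||| 2 ^ p.2)) none

lemma elim_spec {φ : ℕ → ℂ} (h : ∀ n < 1080, evalL φ (rowL 0 n) = 0) :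
    ∀ {l : List (ℕ × ℕ)} {m m' : ℕ}, elim l m = some m' → (∀ K, m.testBit K = true → φ K = 0) →
      ∀ K, m'.testBit K = true → φ K = 0
  | [], m, m', e, hm => by
    cases e
    exact hm
  | p :: l, m, m', e, hm => by
    rw [elim] at e
    generalize hb : (Nat.blt p.1 1080 && ((collect (rowL 0 p.1)).all fun q =>
      decide (q.1 = 0) || Nat.beq q.2 p.2 || m.testBit q.2) &&
        !decide (coefAt p.2 (collect (rowL 0 p.1)) = 0)) = b at e
    cases b with
    | false => cases e
    | true =>
      rw [Bool.and_eq_true, Bool.and_eq_true, Nat.blt_eq, List.all_eq_true,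
        Bool.not_eq_true', decide_eq_false_iff_not] at hb
      obtain ⟨⟨h1, h2⟩, h3⟩ := hb
      refine elim_spec h e fun K hK => ?_
      rw [Nat.testBit_or, Nat.testBit_two_pow, Bool.or_eq_true, decide_eq_true_eq] at hK
      rcases hK with hK | rfl
      · exact hm K hK
      · have h4 := h _ h1
        rw [← evalL_collect, evalL_eq_coefAt (K := p.2) fun q hq => ?_] at h4
        · exact (mul_eq_zero.mp h4).resolve_left (Int.cast_ne_zero.mpr h3)
        · have := h2 q hq
          rw [Bool.or_eq_true, Bool.or_eq_true, decide_eq_true_eq, Nat.beq_eq, or_assoc] at this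
          exact this.imp_right (Or.imp_right (hm _))

/-- Whether all indices of nonzero variables of the given type lie in a set. -/
def covers (m t : ℕ) : Bool := allLT 1080 fun n =>
  decide ((red t n).1 = 0) || m.testBit (1080 * t + (red t n).2)

lemma covers_spec {k : ℕ} {f : Cell (k + 1) → ℂ} (hf : IsCoch (Gamma0 9) (k + 1) f) {m t : ℕ}
    (ht : t < 8) (h : covers m t = true) (hm : ∀ K, m.testBit K = true → PhiK f K = 0) {n : ℕ}
    (hn : n < 1080) : Phi f t n = 0 := by
  have h1 := allLT_spec h n hn
  have h2 := red_lt ht hn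
  rw [Phi_red hf ht hn]
  rw [Bool.or_eq_true, decide_eq_true_eq] at h1
  rcases h1 with h1 | h1
  · rw [h1, Int.cast_zero, zero_mul]
  · have h3 := hm _ h1
    rw [PhiK, show (1080 * t + (red t n).2) / 1080 = t by omega,
      show (1080 * t + (red t n).2) % 1080 = (red t n).2 by omega] at h3
    rw [h3, mul_zero]

/-- A coboundary value in normalized variables. -/
def rowK (K : ℕ) : List (ℤ × ℕ) := rowL (K / 1080) (K % 1080)

/-- Triangularity of the coboundary values at the first entries on the second entries. -/
def triOK : List (ℕ × ℕ) → Bool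
  | [] => true
  | p :: l => Nat.blt p.1 4320 && Nat.ble 1080 p.1 && goodK 6 p.2 &&
      !decide (evalL (valK p.2) (rowK p.1) = 0) &&
      ((collect (rowK p.1)).all fun q => decide (q.1 = 0) || decide ((norm1 q.2).1 = 0) ||
        !(maskOf (l.map Prod.snd)).testBit (norm1 q.2).2) && triOK l

lemma PhiK_cobdry {k : ℕ} {f : Cell (k + 1) → ℂ} (hf : IsCoch (Gamma0 9) (k + 1) f) {K : ℕ}
    (h : (repL (K / 1080)).length + (k + 1) = 9) (hK : K < 4320) :
    PhiK (cobdry (k + 1) f) K = evalL (PhiK f) (rowK K) := by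
  rw [PhiK, Phi_cobdry hf (by omega) h (by omega), rowK]

lemma PhiK_cobdry_deltaK {k d A K : ℕ} (hA : goodK d A = true) (hd : d + k = 9)
    (h : (repL (K / 1080)).length + (k + 1) = 9) (hK : K < 4320) :
    PhiK (cobdry (k + 1) (deltaK A)) K = ((evalL (valK A) (rowK K) : ℤ) : ℂ) := by
  rw [PhiK_cobdry (isCoch_deltaK hA) h hK, evalL_intCast]
  exact evalL_congr fun p hp =>
    PhiK_deltaK hA hd (rowL_lt (t := K / 1080) (by omega) (by omega) p hp)

lemma length_of_le {K : ℕ} (h1 : 1080 ≤ K) (h2 : K < 4320) : (repL (K / 1080)).length = 5 := by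
  have : K / 1080 = 1 ∨ K / 1080 = 2 ∨ K / 1080 = 3 := by omega
  rcases this with h | h | h <;> rw [h] <;> rfl

lemma triOK_spec : ∀ {l : List (ℕ × ℕ)}, triOK l = true →
    (∀ p ∈ l, goodK 6 p.2 = true ∧ PhiK (cobdry 4 (deltaK p.2)) p.1 ≠ 0) ∧
      l.Pairwise fun p q => PhiK (cobdry 4 (deltaK q.2)) p.1 = 0
  | [], _ => ⟨by simp, List.Pairwise.nil⟩
  | p :: l, h => by
    rw [triOK] at h
    simp only [Bool.and_eq_true, Nat.blt_eq, Nat.ble_eq, Bool.not_eq_true',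
      decide_eq_false_iff_not] at h
    obtain ⟨⟨⟨⟨⟨h1, h2⟩, h3⟩, h4⟩, h5⟩, h6⟩ := h
    obtain ⟨i1, i2⟩ := triOK_spec h6
    have hl := length_of_le h2 h1
    refine ⟨fun q hq => ?_, List.pairwise_cons.mpr ⟨fun q hq => ?_, i2⟩⟩
    · rcases List.mem_cons.mp hq with rfl | hq
      · refine ⟨h3, ?_⟩
        rw [PhiK_cobdry_deltaK (k := 3) h3 rfl (by omega) h1]
        exact Int.cast_ne_zero.mpr h4
      · exact i1 q hq
    · rw [PhiK_cobdry_deltaK (k := 3) (i1 q hq).1 rfl (by omega) h1, Int.cast_eq_zero,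
        ← evalL_collect]
      refine List.sum_eq_zero fun x hx => ?_
      obtain ⟨r, hr, rfl⟩ := List.mem_map.mp hx
      have := List.all_eq_true.mp h5 r hr
      rw [Bool.or_eq_true, Bool.or_eq_true, decide_eq_true_eq, decide_eq_true_eq, Bool.not_eq_true',
        ← Bool.not_eq_true, testBit_maskOf] at this
      rcases this with (h | h) | h
      · rw [h]; simp
      · rw [valK, h, Bool.cond_self, mul_zero]
      · rw [valK, cond_eq_ite, if_neg, mul_zero]
        intro e
        rw [Nat.beq_eq] at e
        exact h (e ▸ List.mem_map.mpr ⟨q, hq, rfl⟩)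

/-- A sum of cochains supported on one orbit. -/
noncomputable def sumK {k : ℕ} (l : List ℕ) (S : Cell k) : ℂ := (l.map fun A => deltaK A S).sum

/-- The values of a sum of cochains supported on one orbit. -/
def valL (l : List ℕ) (K : ℕ) : ℤ := (l.map fun A => valK A K).sum

lemma sumK_cons {k : ℕ} (A : ℕ) (l : List ℕ) :
    (sumK (A :: l) : Cell k → ℂ) = deltaK A + sumK l := by
  funext S
  simp [sumK]

lemma isCoch_sumK {k d : ℕ} : ∀ {l : List ℕ}, (∀ A ∈ l, goodK d A = true) →
    IsCoch (Gamma0 9) (k + 1) (sumK l)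
  | [], _ => fun g _ S => by simp [sumK]
  | A :: l, h => fun g hg S => by
    have h1 := isCoch_deltaK (k := k) (h A List.mem_cons_self) g hg S
    have h2 := isCoch_sumK (k := k) (fun B hB => h B (List.mem_cons_of_mem _ hB)) g hg S
    rw [sumK_cons, Pi.add_apply, Pi.add_apply, add_mul, h1, h2]

lemma PhiK_sumK {k d : ℕ} (hd : d + k = 9) {K : ℕ} (hK : K < 8640) : ∀ {l : List ℕ},
    (∀ A ∈ l, goodK d A = true) → PhiK (sumK l : Cell (k + 1) → ℂ) K = valL l K
  | [], _ => by
    have : (sumK [] : Cell (k + 1) → ℂ) = 0 := by funext S; simp [sumK]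
    rw [this, (isLinearMap_PhiK K).map_zero]
    simp [valL]
  | A :: l, h => by
    rw [sumK_cons, (isLinearMap_PhiK K).map_add, PhiK_deltaK (h A List.mem_cons_self) hd hK,
      PhiK_sumK hd hK fun B hB => h B (List.mem_cons_of_mem _ hB)]
    simp [valL]

/-- Whether a sum of cochains is a cocycle, given the relevant orbits. -/
def cocycleOK (Q l : List ℕ) : Bool :=
  l.all (goodK 5) && Q.all fun n => Nat.blt n 1080 && decide (evalL (valL l) (rowL 0 n) = 0)

lemma cobdry_sumK {Q l : List ℕ} (hQ : covers (maskOf Q) 0 = true) (h : cocycleOK Q l = true)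
    (S : Cell 6) : cobdry 5 (sumK l) S = 0 := by
  rw [cocycleOK, Bool.and_eq_true, List.all_eq_true, List.all_eq_true] at h
  have hc : IsCoch (Gamma0 9) 5 (sumK l) := isCoch_sumK (k := 4) h.1
  have hc' : IsCoch (Gamma0 9) 6 (cobdry 5 (sumK l)) := by
    have := isCoch_cochOf (bdryHom (Gamma0 9) 5 ≫ hc.hom)
    rwa [cochOf_bdryHom_comp, cochOf_hom] at this
  obtain ⟨g, hg⟩ := cell_eq_six S
  refine eq_zero_of_Phi (k := 5) hc' (by decide) hg (covers_spec (k := 5) hc' (by decide) hQ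
    (fun K hK => ?_) (code_lt g))
  have hK' := h.2 K (testBit_maskOf.mp hK)
  rw [Bool.and_eq_true, Nat.blt_eq, decide_eq_true_eq] at hK'
  obtain ⟨h1, h2⟩ := hK'
  have h0 : K / 1080 = 0 := by omega
  rw [PhiK_cobdry (k := 4) hc (by rw [h0]; rfl) (by omega), rowK, h0,
    show K % 1080 = K by omega,
    evalL_congr (ψ := fun K => ((valL l K : ℤ) : ℂ)) fun p hp =>
      PhiK_sumK (k := 4) rfl (rowL_lt (by decide) h1 p hp) h.1, ← evalL_intCast, h2, Int.cast_zero]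

/-- Whether a functional vanishes on coboundaries. -/
def killsOK (w : List (ℤ × ℕ)) : Bool :=
  (w.all fun p => Nat.blt p.2 4320 && Nat.ble 1080 p.2) &&
    isZeroL (w.flatMap fun p => scaleL p.1 (rowK p.2))

lemma killsOK_spec {w : List (ℤ × ℕ)} (h : killsOK w = true) {f : Cell 4 → ℂ}
    (hf : IsCoch (Gamma0 9) 4 f) : evalL (PhiK (cobdry 4 f)) w = 0 := by
  rw [killsOK, Bool.and_eq_true, List.all_eq_true] at h
  obtain ⟨h1, h2⟩ := h
  rw [← evalL_of_isZeroL h2 (PhiK f)]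
  clear h2
  induction w with
  | nil => rfl
  | cons p w ih =>
    have h3 := h1 p List.mem_cons_self
    rw [Bool.and_eq_true, Nat.blt_eq, Nat.ble_eq] at h3
    have hl := length_of_le h3.2 h3.1
    rw [evalL_cons, ih fun q hq => h1 q (List.mem_cons_of_mem _ hq), List.flatMap_cons,
      evalL_append, evalL_scaleL, PhiK_cobdry (k := 3) hf (by omega) h3.1]

end Check

end

section

open CategoryTheory

/-- Representatives of the orbits of type `0` supporting cochains. -/
def orbits6 : List ℕ :=
  [21, 22, 91, 92, 93, 94, 101, 102, 103, 111, 112, 192, 193, 194, 273]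

/-- Orbits at which cochains are evaluated. -/
def evals : List ℕ :=
  [1090, 1091, 1093, 1100, 1101, 1102, 1110, 1111, 1120, 1171, 1172, 1173, 1174, 1181, 1182,
    1183, 1191, 1192, 1201, 1243, 1244, 1246, 1252, 1253, 1254, 1255, 1256, 1257, 1258, 1262,
    1263, 1264, 1265, 1266, 1272, 1273, 1274, 1282, 2053, 2054, 2055, 2062, 2063, 2064, 2089,
    2090, 2170, 2171, 2173, 2178, 2179, 2180, 2181, 2182, 2184, 2185, 2186, 2252, 2253, 2254,
    2260, 2261, 2262, 2263, 2269, 2270, 2271, 2272, 2350, 2351, 2385, 2386, 2387, 2388, 2389,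
    2457, 2458, 2459, 2460, 2461, 2538, 2539, 2540, 2544, 3217, 3240, 3241, 3242, 3250, 3257,
    3261, 3266, 3275, 3282, 3283, 3332, 3333, 3337, 3341, 3346, 3353, 3354, 3362, 3363, 3433,
    3434, 3435, 3513, 3514]

/-- The order of elimination for cocycles vanishing at `evals`. -/
def elims : List (ℕ × ℕ) :=
  [(112, 3252), (273, 2091), (22, 2183), (194, 2353), (94, 3331), (92, 3345), (102, 2172), (193,
    2541), (103, 3251), (111, 3273), (91, 2251), (101, 3265), (21, 1245), (192, 2352), (93,
    1092)]

/-- Pairs of orbits for which the coboundary is triangular. -/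
def tris : List (ℕ × ℕ) :=
  [(2064, 7538), (3283, 6388), (3282, 6091), (2538, 6597), (2183, 5645), (2182, 5567), (2541,
    6412), (3514, 5511), (2353, 6779), (1256, 6602), (2262, 6738), (2270, 5663), (1265, 6598),
    (1273, 6600), (2540, 5504), (2544, 5821), (2539, 6599), (1274, 6688), (1255, 5656), (3331,
    5653), (2251, 5516), (3337, 5983), (1090, 6569), (3257, 5975), (2254, 5713), (2253, 6409),
    (3333, 5979), (1173, 5968), (2269, 6060), (3250, 5563), (2252, 6653), (2272, 6082), (2271,
    6445), (3363, 5541), (2172, 7050), (3252, 5488), (3332, 5978), (1172, 6563), (1181, 5497),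
    (2260, 6059), (3346, 5413), (2170, 6049), (1174, 6565), (1091, 6890), (1092, 6644), (3251,
    5969), (2173, 7051), (1183, 6608), (1201, 6008), (3362, 5420), (2171, 6052), (1100, 6073),
    (3265, 5405), (1120, 6643), (2261, 6739), (1253, 6943), (2263, 6737), (3341, 5657), (3266,
    5651), (2179, 6727), (1254, 6672), (2350, 6069), (1102, 5421), (1257, 6888), (2186, 6054),
    (2351, 6778), (2180, 6731), (1111, 6648), (2185, 6724), (1266, 6940), (2089, 6411), (3513,
    5430), (3273, 5403), (1110, 6081), (1191, 5493), (3354, 6400), (3275, 6399), (1262, 5822),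
    (3345, 5674), (2184, 6729), (2181, 6383), (1245, 6669), (2178, 6642), (1244, 6732), (3433,
    5664), (3434, 5668), (2090, 6413), (2063, 6402), (3261, 5649), (3435, 5583), (2352, 6690),
    (2458, 6508), (2053, 6373), (2459, 6509), (2386, 6580), (2461, 6511), (2054, 6374), (3240,
    5400), (3242, 5805), (2457, 6507), (2388, 6582), (2385, 6579), (2387, 6500), (2389, 6502),
    (2460, 6510), (3241, 5967)]

/-- Functionals vanishing on coboundaries. -/
def functionals : List (List (ℤ × ℕ)) :=
  [[(1, 2055)], [(3, 2064), (-2, 2091)], [(3, 1173), (-3, 1182), (3, 1192), (3, 2172), (-1,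
    2251), (1, 2252), (1, 2253), (-1, 2254), (3, 2269), (-3, 2270), (3, 2271), (3, 2272), (-3,
    2539), (3, 2540), (1, 2541), (-1, 2544), (-1, 3250), (3, 3252), (-1, 3282), (-1, 3283), (1,
    3333), (-3, 3363), (2, 3514)]]

/-- Cocycles, as sums of cochains supported on one orbit. -/
def cocycles : List (List ℕ) :=
  [[2055], [2064, 2091], [3252, 1111]]

lemma covers_orbits6 : covers (maskOf orbits6) 0 = true := by decide +kernel

lemma elim_covers : ((elim elims (maskOf evals)).map fun m =>
    covers m 1 && covers m 2 && covers m 3) = some true := by decide +kernel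

lemma triOK_tris : triOK tris = true := by decide +kernel

lemma killsOK_functionals : ∀ w ∈ functionals, killsOK w = true := by decide +kernel

lemma cocycleOK_cocycles : ∀ l ∈ cocycles, cocycleOK orbits6 l = true := by decide +kernel

lemma pairing : ∀ i j : Fin 3, i ≤ j →
    (decide (evalL (valL (cocycles.get j)) (functionals.get i) = 0) = decide (i < j)) := by
  decide +kernel

lemma lt_of_mem_functionals : ∀ w ∈ functionals, ∀ p ∈ w, p.2 < 8640 := by decide +kernel

lemma eq_zero_of_evals {f : Cell 5 → ℂ} (hf : IsCoch (Gamma0 9) 5 f)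
    (hd : ∀ S, cobdry 5 f S = 0) (he : ∀ K ∈ evals, PhiK f K = 0) (S : Cell 5) : f S = 0 := by
  have h := elim_covers
  cases hm : elim elims (maskOf evals) with
  | none => rw [hm] at h; cases h
  | some m =>
    rw [hm, Option.map_some, Option.some_inj, Bool.and_eq_true, Bool.and_eq_true] at h
    have h0 : cobdry 5 f = 0 := funext hd
    have hz := elim_spec (φ := PhiK f) (fun n hn => by
      rw [← Phi_cobdry (k := 4) hf (by decide) rfl hn, h0]
      exact (isLinearMap_ev _).map_zero) hm fun K hK => he K (testBit_maskOf.mp hK)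
    obtain ⟨t, h1, h2, g, hg⟩ := cell_eq_five S
    refine eq_zero_of_Phi (k := 4) hf (by omega) hg
      (covers_spec (k := 4) hf (by omega) ?_ hz (code_lt g))
    have : t = 1 ∨ t = 2 ∨ t = 3 := by omega
    rcases this with rfl | rfl | rfl
    exacts [h.1.1, h.1.2, h.2]

lemma evalL_sumK {w : List (ℤ × ℕ)} (hw : ∀ p ∈ w, p.2 < 8640) {l : List ℕ}
    (hl : ∀ A ∈ l, goodK 5 A = true) :
    evalL (PhiK (sumK l : Cell 5 → ℂ)) w = ((evalL (valL l) w : ℤ) : ℂ) := by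
  rw [evalL_intCast]
  exact evalL_congr fun p hp => PhiK_sumK (k := 4) rfl (hw p hp) hl

lemma goodK_of_cocycleOK {Q l : List ℕ} (h : cocycleOK Q l = true) : ∀ A ∈ l, goodK 5 A = true := by
  rw [cocycleOK, Bool.and_eq_true, List.all_eq_true] at h
  exact h.1

end

end Voronoi

open Voronoi in
/-- `dim_ℂ H^5(Γ₀(9), ℂ) = 3`. -/
theorem finrank_H5_Gamma0_9 :
    Module.finrank ℂ (groupCohomology (Rep.trivial ℂ (Gamma0 9) ℂ) 5) = 3 := by
  have ht := triOK_spec triOK_tris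
  have hg : ∀ j : Fin 3, cocycleOK orbits6 (cocycles.get j) = true := fun j =>
    cocycleOK_cocycles _ (List.get_mem _ _)
  have hw : ∀ i : Fin 3, ∀ p ∈ functionals.get i, p.2 < 8640 := fun i =>
    lt_of_mem_functionals _ (List.get_mem _ _)
  refine finrank_groupCohomology (n := 4) (m := 106) (r := 3)
    (fun (i : Fin 109) f => PhiK f (evals.get i)) (fun i => isLinearMap_PhiK _)
    (fun f hf hd he => eq_zero_of_evals hf hd fun K hK => ?_)
    (fun (i : Fin 106) => deltaK (tris.get i).2)
    (fun i => isCoch_deltaK (k := 3) (ht.1 _ (List.get_mem _ _)).1)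
    (fun (i : Fin 106) f => PhiK f (tris.get i).1) (fun i => isLinearMap_PhiK _)
    (fun i => (ht.1 _ (List.get_mem _ _)).2)
    (fun i j hij => List.pairwise_iff_get.mp ht.2 i j hij)
    (fun (i : Fin 3) => sumK (cocycles.get i))
    (fun i => isCoch_sumK (k := 4) (goodK_of_cocycleOK (hg i)))
    (fun i => cobdry_sumK covers_orbits6 (hg i))
    (fun (i : Fin 3) f => evalL (PhiK f) (functionals.get i)) (fun i => isLinearMap_evalL _)
    (fun i f hf => killsOK_spec (killsOK_functionals _ (List.get_mem _ _)) hf)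
    (fun i => ?_) (fun i j hij => ?_)
  · obtain ⟨i, rfl⟩ := List.mem_iff_get.mp hK
    exact he i
  · have h := pairing i i le_rfl
    rw [decide_eq_decide] at h
    rw [evalL_sumK (hw i) (goodK_of_cocycleOK (hg i))]
    exact Int.cast_ne_zero.mpr fun h0 => lt_irrefl i (h.mp h0)
  · have h := pairing i j hij.le
    rw [decide_eq_decide] at h
    rw [evalL_sumK (hw i) (goodK_of_cocycleOK (hg j)), h.mpr hij, Int.cast_zero]
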